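/- Let F be a free group of countably infinite rank. Then the outer automorphism group Out(F) is complete; that is, Out(F) has trivial center and every automorphism of the group Out(F) is an inner automorphism of Out(F). -/

import Mathlib

open Pointwise

/-- A subset `S` of a free group is a basis if the canonical homomorphism
`FreeGroup S →* FreeGroup X` extending the inclusion is bijective. -/
def FreeGroup.IsBasis {X : Type*} (S : Set (FreeGroup X)) : Prop :=
  Function.Bijective (FreeGroup.lift (fun s : S => (s : FreeGroup X)))

/-- The subgroup of inner automorphisms of a group `G`, as a subgroup of `MulAut G`. -/
def Inn (G : Type*) [Group G] : Subgroup (MulAut G) :=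
  (MulAut.conj : G →* MulAut G).range

instance Inn.normal (G : Type*) [Group G] : (Inn G).Normal := by
  constructor
  rintro - ⟨g, rfl⟩ σ
  refine ⟨σ g, ?_⟩
  ext x
  simp [MulAut.conj, MulAut.mul_apply, mul_assoc]

/-- The outer automorphism group `Out G = Aut G / Inn G`. -/
abbrev OutAut (G : Type*) [Group G] := MulAut G ⧸ Inn G

/-- The natural homomorphism `Aut G → Out G`. -/
def toOut {G : Type*} [Group G] : MulAut G →* OutAut G :=
  QuotientGroup.mk' (Inn G)

/-- `g` is an involution of the group `G`. -/
def IsInvolution {G : Type*} [Group G] (g : G) : Prop :=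
  g ≠ 1 ∧ g ^ 2 = 1

/-- A subset of a group is anti-commutative if its elements pairwise do not commute. -/
def AntiCommSet {G : Type*} [Group G] (s : Set G) : Prop :=
  ∀ a ∈ s, ∀ b ∈ s, a ≠ b → a * b ≠ b * a

/-- A decomposition `U ⊔ S ⊔ ⊔_{x ∈ S} Y x` of a basis of a free group. -/
structure IsBasisDecomposition {X : Type*} (U S : Set (FreeGroup X))
    (Y : FreeGroup X → Set (FreeGroup X)) : Prop where
  isBasis : FreeGroup.IsBasis (U ∪ S ∪ ⋃ x ∈ S, Y x)
  disjUS : Disjoint U S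
  disjUY : ∀ x ∈ S, Disjoint U (Y x)
  disjSY : ∀ x ∈ S, Disjoint S (Y x)
  disjYY : ∀ x ∈ S, ∀ x' ∈ S, x ≠ x' → Disjoint (Y x) (Y x')

/-- `U ⊔ S ⊔ ⊔_{x ∈ S} Y x` is a canonical basis for the (soft) involution `φ`:
`φ` fixes `U` pointwise, inverts the elements of `S` and conjugates the elements of
`Y x` by `x`. -/
def IsCanonicalBasis {X : Type*} (φ : MulAut (FreeGroup X)) (U S : Set (FreeGroup X))
    (Y : FreeGroup X → Set (FreeGroup X)) : Prop :=
  IsBasisDecomposition U S Y ∧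
    (∀ u ∈ U, φ u = u) ∧ (∀ x ∈ S, φ x = x⁻¹) ∧
    (∀ x ∈ S, ∀ y ∈ Y x, φ y = x * y * x⁻¹)

/-- A soft involution of `Aut F`: an involution admitting a canonical basis. -/
def IsSoftInvolution {X : Type*} (φ : MulAut (FreeGroup X)) : Prop :=
  IsInvolution φ ∧ ∃ U S Y, IsCanonicalBasis φ U S Y

/-- A soft involution of `Out F`: an involution induced by a soft involution of `Aut F`. -/
def IsSoftOutInvolution {X : Type*} (f : OutAut (FreeGroup X)) : Prop :=
  IsInvolution f ∧ ∃ φ, IsSoftInvolution φ ∧ toOut φ = f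

/-- A `1`-involution of `Aut F`: a soft involution whose canonical bases have exactly
one block. -/
def IsOneInvolution {X : Type*} (ψ : MulAut (FreeGroup X)) : Prop :=
  IsInvolution ψ ∧ ∃ (U Y : Set (FreeGroup X)) (x : FreeGroup X),
    IsCanonicalBasis ψ U {x} (fun _ => Y)

/-- A `1`-involution of `Out F`: an involution induced by a `1`-involution of `Aut F`. -/
def IsOneOutInvolution {X : Type*} (f : OutAut (FreeGroup X)) : Prop :=
  IsInvolution f ∧ ∃ ψ, IsOneInvolution ψ ∧ toOut ψ = f

/-- An extremal involution of `Aut F`: an involution inverting one element of a suitable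
basis and fixing all other elements of that basis. -/
def IsExtremalInvolution {X : Type*} (φ : MulAut (FreeGroup X)) : Prop :=
  IsInvolution φ ∧ ∃ (B : Set (FreeGroup X)) (x : FreeGroup X),
    FreeGroup.IsBasis B ∧ x ∈ B ∧ φ x = x⁻¹ ∧ ∀ b ∈ B, b ≠ x → φ b = b

/-- An extremal involution of `Out F`: an involution induced by an extremal involution
of `Aut F`. -/
def IsExtremalOutInvolution {X : Type*} (f : OutAut (FreeGroup X)) : Prop :=
  IsInvolution f ∧ ∃ φ, IsExtremalInvolution φ ∧ toOut φ = f

/-- A symmetry of `Aut F`: an involution inverting all elements of some basis. -/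
def IsSymmetryAut {X : Type*} (θ : MulAut (FreeGroup X)) : Prop :=
  IsInvolution θ ∧ ∃ B : Set (FreeGroup X), FreeGroup.IsBasis B ∧ ∀ b ∈ B, θ b = b⁻¹

/-- A symmetry of `Out F`: an involution whose full preimage in `Aut F` contains a
symmetry. -/
def IsSymmetryOut {X : Type*} (f : OutAut (FreeGroup X)) : Prop :=
  IsInvolution f ∧ ∃ θ, IsSymmetryAut θ ∧ toOut θ = f

/-- Condition (★): the product set `K·K` contains exactly one conjugacy class of
involutions, and no element of `K` is a square. -/
def StarCondition {G : Type*} [Group G] (K : Set G) : Prop :=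
  (∃ c ∈ K * K, IsInvolution c ∧ ∀ d ∈ K * K, IsInvolution d → IsConj c d) ∧
    ∀ k ∈ K, ¬ ∃ g : G, g ^ 2 = k

namespace OutFree

open FreeGroup (of)

/-! ### Standard free factors and pointwise stabilizers -/

/-- The subgroup of `FreeGroup ℕ` generated by the letters in `C`. -/
def FC (C : Set ℕ) : Subgroup (FreeGroup ℕ) := Subgroup.closure (FreeGroup.of '' C)

/-- The subgroup generated by the first `n` letters. -/
abbrev Fn (n : ℕ) : Subgroup (FreeGroup ℕ) := FC (Set.Iio n)

open Classical in
/-- The retraction onto `FC C` killing all other letters. -/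
noncomputable def retr (C : Set ℕ) : FreeGroup ℕ →* FreeGroup ℕ :=
  FreeGroup.lift fun i => if i ∈ C then of i else 1

/-- The automorphisms fixing `S` pointwise. -/
def PS (S : Subgroup (FreeGroup ℕ)) : Subgroup (MulAut (FreeGroup ℕ)) where
  carrier := {g | ∀ a ∈ S, g a = a}
  one_mem' := fun _ _ => rfl
  mul_mem' := fun {g h} hg hh a ha => by rw [MulAut.mul_apply, hh a ha, hg a ha]
  inv_mem' := fun {g} hg a ha => by
    conv_lhs => rw [← hg a ha]
    exact MulAut.inv_apply_self _ g a

/-- The subgroup of elements fixed by all automorphisms in `M`. -/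
def Fix (M : Subgroup (MulAut (FreeGroup ℕ))) : Subgroup (FreeGroup ℕ) where
  carrier := {a | ∀ g ∈ M, g a = a}
  one_mem' := fun g _ => map_one g
  mul_mem' := fun {a b} ha hb g hg => by rw [map_mul, ha g hg, hb g hg]
  inv_mem' := fun {a} ha g hg => by rw [map_inv, ha g hg]

theorem PS_anti {S T : Subgroup (FreeGroup ℕ)} (h : S ≤ T) : PS T ≤ PS S :=
  fun _ hg a ha => hg a (h ha)

theorem Fix_anti {M N : Subgroup (MulAut (FreeGroup ℕ))} (h : M ≤ N) : Fix N ≤ Fix M :=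
  fun _ ha g hg => ha g (h hg)

theorem le_PS_iff {S : Subgroup (FreeGroup ℕ)} {M : Subgroup (MulAut (FreeGroup ℕ))} :
    M ≤ PS S ↔ S ≤ Fix M :=
  ⟨fun h _ ha _ hg => h hg _ ha, fun h _ hg _ ha => h ha _ hg⟩

theorem retr_of_mem {C : Set ℕ} {i : ℕ} (h : i ∈ C) : retr C (of i) = of i := by
  simp [retr, h]

theorem retr_of_notMem {C : Set ℕ} {i : ℕ} (h : i ∉ C) : retr C (of i) = 1 := by
  simp [retr, h]

theorem of_mem_FC {C : Set ℕ} {i : ℕ} (h : i ∈ C) : of i ∈ FC C :=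
  Subgroup.subset_closure ⟨i, h, rfl⟩

theorem FC_le {C : Set ℕ} {S : Subgroup (FreeGroup ℕ)} :
    FC C ≤ S ↔ ∀ i ∈ C, of i ∈ S := by
  rw [FC, Subgroup.closure_le]
  exact ⟨fun h i hi => h ⟨i, hi, rfl⟩, by rintro h _ ⟨i, hi, rfl⟩; exact h i hi⟩

theorem FC_mono {C D : Set ℕ} (h : C ⊆ D) : FC C ≤ FC D :=
  FC_le.2 fun _ hi => of_mem_FC (h hi)

theorem Fn_mono {m n : ℕ} (h : m ≤ n) : Fn m ≤ Fn n := FC_mono (Set.Iio_subset_Iio h)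

theorem of_mem_Fn {i n : ℕ} (h : i < n) : of i ∈ Fn n := of_mem_FC h

theorem hom_eqOn {G : Type*} [Group G] {f g : FreeGroup ℕ →* G} {C : Set ℕ}
    (h : ∀ i ∈ C, f (of i) = g (of i)) {w : FreeGroup ℕ} (hw : w ∈ FC C) : f w = g w := by
  have : FC C ≤ f.eqLocus g := FC_le.2 h
  exact this hw

theorem aut_eqOn {f g : MulAut (FreeGroup ℕ)} {C : Set ℕ}
    (h : ∀ i ∈ C, f (of i) = g (of i)) {w : FreeGroup ℕ} (hw : w ∈ FC C) : f w = g w :=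
  hom_eqOn (f := f.toMonoidHom) (g := g.toMonoidHom) h hw

theorem mem_PS_FC {C : Set ℕ} {g : MulAut (FreeGroup ℕ)} :
    g ∈ PS (FC C) ↔ ∀ i ∈ C, g (of i) = of i :=
  ⟨fun h _ hi => h _ (of_mem_FC hi), fun h _ hw => aut_eqOn (g := 1) h hw⟩

theorem aut_ext {f g : MulAut (FreeGroup ℕ)} (h : ∀ i, f (of i) = g (of i)) : f = g := by
  have : f.toMonoidHom = g.toMonoidHom := FreeGroup.ext_hom _ _ h
  ext w
  exact DFunLike.congr_fun this w

theorem FC_univ : FC Set.univ = ⊤ := by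
  rw [FC, Set.image_univ, FreeGroup.closure_range_of]

theorem retr_mem (C : Set ℕ) (w : FreeGroup ℕ) : retr C w ∈ FC C := by
  have : FC Set.univ ≤ (FC C).comap (retr C) := FC_le.2 fun i _ => by
    by_cases h : i ∈ C
    · simpa [Subgroup.mem_comap, retr_of_mem h] using of_mem_FC h
    · simp [Subgroup.mem_comap, retr_of_notMem h]
  exact this (by rw [FC_univ]; trivial)

theorem retr_eq_self {C : Set ℕ} {w : FreeGroup ℕ} (h : w ∈ FC C) : retr C w = w :=
  hom_eqOn (g := MonoidHom.id _) (fun _ hi => retr_of_mem hi) h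

theorem mem_FC_iff {C : Set ℕ} {w : FreeGroup ℕ} : w ∈ FC C ↔ retr C w = w :=
  ⟨retr_eq_self, fun h => h ▸ retr_mem C w⟩

theorem of_mem_FC_iff {C : Set ℕ} {i : ℕ} : of i ∈ FC C ↔ i ∈ C := by
  refine ⟨fun h => by_contra fun hi => ?_, of_mem_FC⟩
  have := retr_eq_self h
  rw [retr_of_notMem hi] at this
  exact FreeGroup.of_ne_one i this.symm

theorem FC_inf (C D : Set ℕ) : FC C ⊓ FC D = FC (C ∩ D) := by
  apply le_antisymm
  · rintro w ⟨hC, hD⟩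
    rw [mem_FC_iff]
    conv_rhs => rw [← retr_eq_self hC, ← retr_eq_self hD]
    have : retr (C ∩ D) = (retr C).comp (retr D) := by
      ext i
      by_cases h1 : i ∈ C <;> by_cases h2 : i ∈ D <;>
        simp [retr, h1, h2]
    rw [this, MonoidHom.comp_apply, retr_eq_self hD]
  · exact le_inf (FC_mono Set.inter_subset_left) (FC_mono Set.inter_subset_right)

theorem exists_mem_Fn (w : FreeGroup ℕ) : ∃ n, w ∈ Fn n := by
  induction w using FreeGroup.induction_on with
  | C1 => exact ⟨0, one_mem _⟩
  | of i => exact ⟨i + 1, of_mem_Fn (Nat.lt_succ_self i)⟩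
  | inv_of i h => exact ⟨i + 1, inv_mem (of_mem_Fn (Nat.lt_succ_self i))⟩
  | mul a b ha hb =>
    obtain ⟨n, hn⟩ := ha
    obtain ⟨m, hm⟩ := hb
    exact ⟨max n m, mul_mem (Fn_mono (le_max_left _ _) hn) (Fn_mono (le_max_right _ _) hm)⟩

theorem exists_Fn_of_finite {S : Set (FreeGroup ℕ)} (hS : S.Finite) (m : ℕ) :
    ∃ n ≥ m, ∀ w ∈ S, w ∈ Fn n := by
  choose N hN using exists_mem_Fn
  obtain ⟨B, hB⟩ := (hS.image N).bddAbove
  exact ⟨max m B, le_max_left _ _, fun w hw =>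
    Fn_mono (le_max_of_le_right (hB ⟨w, hw, rfl⟩)) (hN w)⟩

/-! ### Images of subgroups under automorphisms -/

theorem mem_smul_iff {g : MulAut (FreeGroup ℕ)} {S : Subgroup (FreeGroup ℕ)} {w : FreeGroup ℕ} :
    w ∈ g • S ↔ g⁻¹ w ∈ S := Subgroup.mem_pointwise_smul_iff_inv_smul_mem

theorem apply_mem_smul_iff {g : MulAut (FreeGroup ℕ)} {S : Subgroup (FreeGroup ℕ)}
    {w : FreeGroup ℕ} : g w ∈ g • S ↔ w ∈ S := by
  rw [mem_smul_iff, MulAut.inv_apply_self]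

theorem apply_mem_of_smul_eq {g : MulAut (FreeGroup ℕ)} {S T : Subgroup (FreeGroup ℕ)}
    (h : g • S = T) {w : FreeGroup ℕ} (hw : w ∈ S) : g w ∈ T :=
  h ▸ apply_mem_smul_iff.2 hw

theorem inv_apply_mem_of_smul_eq {g : MulAut (FreeGroup ℕ)} {S T : Subgroup (FreeGroup ℕ)}
    (h : g • S = T) {w : FreeGroup ℕ} (hw : w ∈ T) : g⁻¹ w ∈ S := by
  rw [← mem_smul_iff, h]; exact hw

theorem smul_le_iff {g : MulAut (FreeGroup ℕ)} {S T : Subgroup (FreeGroup ℕ)} :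
    g • S ≤ T ↔ ∀ w ∈ S, g w ∈ T :=
  ⟨fun h w hw => h (apply_mem_smul_iff.2 hw), fun h w hw => by
    have := h _ (mem_smul_iff.1 hw)
    rwa [MulAut.apply_inv_self] at this⟩

theorem smul_FC_le {g : MulAut (FreeGroup ℕ)} {C : Set ℕ} {T : Subgroup (FreeGroup ℕ)} :
    g • FC C ≤ T ↔ ∀ i ∈ C, g (of i) ∈ T := by
  refine ⟨fun h i hi => smul_le_iff.1 h _ (of_mem_FC hi), fun h => smul_le_iff.2 fun w hw => ?_⟩
  have : FC C ≤ T.comap g.toMonoidHom := FC_le.2 h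
  exact this hw

theorem smul_eq_of_mem_PS {g : MulAut (FreeGroup ℕ)} {S : Subgroup (FreeGroup ℕ)}
    (h : g ∈ PS S) : g • S = S := by
  ext w
  rw [mem_smul_iff]
  refine ⟨fun hw => ?_, fun hw => ?_⟩
  · have := h _ hw
    rw [MulAut.apply_inv_self] at this
    rwa [this]
  · rwa [(PS S).inv_mem h w hw]

theorem smul_eq_of_eqOn {g h : MulAut (FreeGroup ℕ)} {S : Subgroup (FreeGroup ℕ)}
    (e : ∀ w ∈ S, g w = h w) : g • S = h • S := by
  apply le_antisymm
  · exact smul_le_iff.2 fun w hw => e w hw ▸ apply_mem_smul_iff.2 hw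
  · exact smul_le_iff.2 fun w hw => e w hw ▸ apply_mem_smul_iff.2 hw

theorem inv_mul_mem_PS_iff {g h : MulAut (FreeGroup ℕ)} {S : Subgroup (FreeGroup ℕ)} :
    g⁻¹ * h ∈ PS S ↔ ∀ w ∈ S, h w = g w := by
  refine forall₂_congr fun w _ => ?_
  rw [MulAut.mul_apply]
  constructor
  · intro e
    conv_rhs => rw [← e]
    rw [MulAut.apply_inv_self]
  · intro e
    rw [e, MulAut.inv_apply_self]

theorem conj_mem_PS {g p : MulAut (FreeGroup ℕ)} {S : Subgroup (FreeGroup ℕ)} :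
    g * p * g⁻¹ ∈ PS (g • S) ↔ p ∈ PS S := by
  constructor
  · intro h w hw
    have := h (g w) (apply_mem_smul_iff.2 hw)
    simpa using this
  · intro h w hw
    have := h _ (mem_smul_iff.1 hw)
    rw [MulAut.mul_apply, MulAut.mul_apply, this, MulAut.apply_inv_self]

theorem exists_smul_Fn_le (L : List (MulAut (FreeGroup ℕ))) (n m : ℕ) :
    ∃ N ≥ m, ∀ g ∈ L, g • Fn n ≤ Fn N := by
  have hfin : (⋃ g ∈ {g | g ∈ L}, (fun i => g (of i)) '' Set.Iio n).Finite :=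
    Set.Finite.biUnion L.finite_toSet fun g _ => (Set.finite_Iio n).image _
  obtain ⟨N, hN, h⟩ := exists_Fn_of_finite hfin m
  refine ⟨N, hN, fun g hg => smul_FC_le.2 fun i hi => h _ ?_⟩
  exact Set.mem_biUnion (x := g) hg ⟨i, hi, rfl⟩

/-! ### Constructing automorphisms -/

/-- The automorphism given on letters by `f`, with inverse given by `g`. -/
def mkAut (f g : ℕ → FreeGroup ℕ) (h1 : ∀ i, FreeGroup.lift g (f i) = of i)
    (h2 : ∀ i, FreeGroup.lift f (g i) = of i) : MulAut (FreeGroup ℕ) :=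
  MonoidHom.toMulEquiv (FreeGroup.lift f) (FreeGroup.lift g)
    (FreeGroup.ext_hom _ _ fun i => by simp [h1])
    (FreeGroup.ext_hom _ _ fun i => by simp [h2])

@[simp] theorem mkAut_of (f g : ℕ → FreeGroup ℕ) (h1 h2) (i : ℕ) :
    mkAut f g h1 h2 (of i) = f i := by
  simp [mkAut]

/-- The automorphism permuting the letters. -/
def permAut (e : Equiv.Perm ℕ) : MulAut (FreeGroup ℕ) := FreeGroup.freeGroupCongr e

@[simp] theorem permAut_of (e : Equiv.Perm ℕ) (i : ℕ) : permAut e (of i) = of (e i) := by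
  simp [permAut]

theorem permAut_smul_FC (e : Equiv.Perm ℕ) (C : Set ℕ) : permAut e • FC C = FC (e '' C) := by
  apply le_antisymm
  · exact smul_FC_le.2 fun i hi => by simpa using of_mem_FC (Set.mem_image_of_mem e hi)
  · refine FC_le.2 ?_
    rintro _ ⟨i, hi, rfl⟩
    rw [← permAut_of, apply_mem_smul_iff]
    exact of_mem_FC hi

theorem permAut_mem_PS {e : Equiv.Perm ℕ} {C : Set ℕ} (h : ∀ i ∈ C, e i = i) :
    permAut e ∈ PS (FC C) := mem_PS_FC.2 fun i hi => by rw [permAut_of, h i hi]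

theorem exists_glue {C D : Set ℕ} {α β : MulAut (FreeGroup ℕ)} (hα : α • FC C = FC C)
    (hβ : β • FC D = FC D) (hαβ : α • FC (C ∩ D) = FC (C ∩ D))
    (h : ∀ w ∈ FC (C ∩ D), α w = β w) :
    ∃ ω : MulAut (FreeGroup ℕ), (∀ w ∈ FC C, ω w = α w) ∧ (∀ w ∈ FC D, ω w = β w) ∧
      ∀ i, i ∉ C → i ∉ D → ω (of i) = of i := by
  classical
  let φ : MulAut (FreeGroup ℕ) → MulAut (FreeGroup ℕ) → ℕ → FreeGroup ℕ := fun a b i =>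
    if i ∈ C then a (of i) else if i ∈ D then b (of i) else of i
  have key : ∀ a b : MulAut (FreeGroup ℕ), (∀ w ∈ FC (C ∩ D), a w = b w) →
      (∀ w ∈ FC C, FreeGroup.lift (φ a b) w = a w) ∧
      (∀ w ∈ FC D, FreeGroup.lift (φ a b) w = b w) := by
    intro a b hab
    constructor
    · intro w hw
      refine hom_eqOn (g := a.toMonoidHom) (fun i hi => ?_) hw
      simp [φ, hi]
    · intro w hw
      refine hom_eqOn (g := b.toMonoidHom) (fun i hi => ?_) hw
      by_cases hC : i ∈ C
      · simpa [φ, hC] using hab _ (of_mem_FC ⟨hC, hi⟩)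
      · simp [φ, hi, hC]
  have h' : ∀ w ∈ FC (C ∩ D), α⁻¹ w = β⁻¹ w := by
    intro w hw
    have h1 := inv_apply_mem_of_smul_eq hαβ hw
    apply β.injective
    rw [← h _ h1, MulAut.apply_inv_self, MulAut.apply_inv_self]
  have k1 := key α β h
  have k2 := key α⁻¹ β⁻¹ h'
  refine ⟨mkAut (φ α β) (φ α⁻¹ β⁻¹) ?_ ?_, ?_, ?_, ?_⟩
  · intro i
    by_cases hC : i ∈ C
    · have : φ α β i = α (of i) := by simp [φ, hC]
      rw [this, k2.1 _ (apply_mem_of_smul_eq hα (of_mem_FC hC)), MulAut.inv_apply_self]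
    · by_cases hD : i ∈ D
      · have : φ α β i = β (of i) := by simp [φ, hC, hD]
        rw [this, k2.2 _ (apply_mem_of_smul_eq hβ (of_mem_FC hD)), MulAut.inv_apply_self]
      · simp [φ, hC, hD]
  · intro i
    by_cases hC : i ∈ C
    · have : φ α⁻¹ β⁻¹ i = α⁻¹ (of i) := by simp [φ, hC]
      rw [this, k1.1 _ (inv_apply_mem_of_smul_eq hα (of_mem_FC hC)), MulAut.apply_inv_self]
    · by_cases hD : i ∈ D
      · have : φ α⁻¹ β⁻¹ i = β⁻¹ (of i) := by simp [φ, hC, hD]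
        rw [this, k1.2 _ (inv_apply_mem_of_smul_eq hβ (of_mem_FC hD)), MulAut.apply_inv_self]
      · simp [φ, hC, hD]
  · exact fun w hw => k1.1 w hw
  · exact fun w hw => k1.2 w hw
  · intro i hC hD
    simp [φ, hC, hD]

theorem exists_extend {C : Set ℕ} {α : MulAut (FreeGroup ℕ)} (hα : α • FC C = FC C) :
    ∃ ω : MulAut (FreeGroup ℕ), (∀ w ∈ FC C, ω w = α w) ∧ ∀ i ∉ C, ω (of i) = of i := by
  obtain ⟨ω, h1, -, h3⟩ := exists_glue (D := ∅) (β := 1) hα (one_smul _ _)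
    (by simp [FC, Subgroup.smul_bot]) (by simp [FC])
  exact ⟨ω, h1, fun i hi => h3 i hi (Set.notMem_empty i)⟩

theorem exists_limit (g : ℕ → MulAut (FreeGroup ℕ))
    (h1 : ∀ a, ∃ N, ∀ k ≥ N, g k a = g N a) (h2 : ∀ a, ∃ N, ∀ k ≥ N, (g k)⁻¹ a = (g N)⁻¹ a) :
    ∃ G : MulAut (FreeGroup ℕ), ∀ a, ∃ N, ∀ k ≥ N, g k a = G a ∧ (g k)⁻¹ a = G⁻¹ a := by
  choose N hN using h1
  choose M hM using h2
  have hN' : ∀ a k, N a ≤ k → g (N a) a = g k a := fun a k hk => (hN a k hk).symm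
  have hM' : ∀ a k, M a ≤ k → (g (M a))⁻¹ a = (g k)⁻¹ a := fun a k hk => (hM a k hk).symm
  let G : MulAut (FreeGroup ℕ) :=
    { toFun := fun a => g (N a) a
      invFun := fun a => (g (M a))⁻¹ a
      left_inv := fun a => by
        let k := max (N a) (M (g (N a) a))
        change (g (M (g (N a) a)))⁻¹ (g (N a) a) = a
        rw [hM' _ k (le_max_right _ _), hN' a k (le_max_left _ _), MulAut.inv_apply_self]
      right_inv := fun a => by
        let k := max (M a) (N ((g (M a))⁻¹ a))
        change g (N ((g (M a))⁻¹ a)) ((g (M a))⁻¹ a) = a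
        rw [hN' _ k (le_max_right _ _), hM' a k (le_max_left _ _), MulAut.apply_inv_self]
      map_mul' := fun a b => by
        let k := max (max (N a) (N b)) (N (a * b))
        change g (N (a * b)) (a * b) = g (N a) a * g (N b) b
        rw [hN' a k (by simp [k]), hN' b k (by simp [k]), hN' (a * b) k (by simp [k]), map_mul] }
  exact ⟨G, fun a => ⟨max (N a) (M a), fun k hk =>
    ⟨hN a k (le_of_max_le_left hk), hM a k (le_of_max_le_right hk)⟩⟩⟩

/-! ### Schreier transversals and bases adapted to an intersection -/

/-- A Schreier transversal of `H` whose representatives lie in `FC C` whenever possible. -/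
theorem exists_transversal (H : Subgroup (FreeGroup ℕ)) (C : Set ℕ) :
    ∃ (T : FreeGroup ℕ ⧸ H → FreeGroup ℕ) (ℓ : FreeGroup ℕ ⧸ H → ℕ),
      T ((1 : FreeGroup ℕ) : FreeGroup ℕ ⧸ H) = 1 ∧
      (∀ q, (T q : FreeGroup ℕ ⧸ H) = q) ∧
      (∀ q, T q = 1 ∨ ∃ (a : ℕ) (q' : FreeGroup ℕ ⧸ H), ℓ q' < ℓ q ∧
        ((q = of a • q' ∧ T q = of a * T q') ∨ (q' = of a • q ∧ T q' = of a * T q))) ∧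
      ∀ g ∈ FC C, T (g : FreeGroup ℕ ⧸ H) ∈ FC C := by
  classical
  let r : ℕ × Bool → ℕ × Bool → Prop := fun a b => Encodable.encode a < Encodable.encode b
  have rwf : WellFounded r := InvImage.wf Encodable.encode wellFounded_lt
  have : Std.Irrefl r := ⟨fun a => lt_irrefl (Encodable.encode a)⟩
  have : Std.Trichotomous r := ⟨fun a b h1 h2 =>
    Encodable.encode_injective (le_antisymm (not_lt.1 h2) (not_lt.1 h1))⟩
  let c : List (ℕ × Bool) → ℕ := fun L => L.countP (fun a => a.1 ∉ C)
  let R : List (ℕ × Bool) → List (ℕ × Bool) → Prop := fun L L' =>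
    Prod.Lex (· < ·) (List.Shortlex r) (c L, L) (c L', L')
  have Rwf : WellFounded R :=
    InvImage.wf (fun L => (c L, L)) (WellFounded.prod_lex wellFounded_lt (List.Shortlex.wf rwf))
  have Rtri : ∀ L L', ¬ R L L' → ¬ R L' L → L = L' := by
    intro L L' h1 h2
    simp only [R, Prod.lex_def, not_or, not_and, not_lt] at h1 h2
    have hc := le_antisymm h2.1 h1.1
    exact Std.Trichotomous.trichotomous _ _ (h1.2 hc) (h2.2 hc.symm)
  have Rcons : ∀ a L L', R L L' → R (a :: L) (a :: L') := by
    intro a L L' h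
    simp only [R, Prod.lex_def] at h ⊢
    rcases h with h | ⟨h1, h2⟩
    · left; simp only [c, List.countP_cons] at h ⊢; omega
    · right
      refine ⟨by simp only [c, List.countP_cons] at h1 ⊢; omega, List.shortlex_cons_iff.2 h2⟩
  have hne : ∀ q : FreeGroup ℕ ⧸ H, {L | ((FreeGroup.mk L : FreeGroup ℕ) : FreeGroup ℕ ⧸ H) = q}.Nonempty := by
    intro q
    obtain ⟨g, rfl⟩ := QuotientGroup.mk_surjective q
    exact ⟨g.toWord, by rw [Set.mem_ofPred_eq, FreeGroup.mk_toWord]⟩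
  let W : FreeGroup ℕ ⧸ H → List (ℕ × Bool) := fun q => Rwf.min _ (hne q)
  have hW : ∀ q, ((FreeGroup.mk (W q) : FreeGroup ℕ) : FreeGroup ℕ ⧸ H) = q := fun q => Rwf.min_mem _ (hne q)
  have hmin : ∀ q L, ((FreeGroup.mk L : FreeGroup ℕ) : FreeGroup ℕ ⧸ H) = q → ¬ R L (W q) := fun q L hL =>
    Rwf.not_lt_min _ hL
  have hcle : ∀ q L, ((FreeGroup.mk L : FreeGroup ℕ) : FreeGroup ℕ ⧸ H) = q → c (W q) ≤ c L := by
    intro q L hL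
    have := hmin q L hL
    simp only [R, Prod.lex_def, not_or, not_lt] at this
    exact this.1
  have hmk : ∀ L, (∀ a ∈ L, a.1 ∈ C) → FreeGroup.mk L ∈ FC C := by
    intro L
    induction L with
    | nil => intro _; exact one_mem (FC C)
    | cons a L ih =>
      intro h
      rw [← List.singleton_append, ← FreeGroup.mul_mk]
      refine mul_mem ?_ (ih fun b hb => h b (List.mem_cons_of_mem _ hb))
      have ha := h a List.mem_cons_self
      rcases a with ⟨a, _ | _⟩
      · exact inv_mem (of_mem_FC ha)
      · exact of_mem_FC ha
  have hword : ∀ g ∈ FC C, ∃ L, FreeGroup.mk L = g ∧ c L = 0 := by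
    intro g hg
    induction hg using Subgroup.closure_induction with
    | mem x hx =>
      obtain ⟨i, hi, rfl⟩ := hx
      exact ⟨[(i, true)], rfl, by simp [c, hi]⟩
    | one => exact ⟨[], rfl, by simp [c]⟩
    | mul x y _ _ hx hy =>
      obtain ⟨L, rfl, hL⟩ := hx
      obtain ⟨L', rfl, hL'⟩ := hy
      exact ⟨L ++ L', by rw [FreeGroup.mul_mk], by
        simp only [c, List.countP_append] at hL hL' ⊢; omega⟩
    | inv x _ hx =>
      obtain ⟨L, rfl, hL⟩ := hx
      refine ⟨FreeGroup.invRev L, by rw [FreeGroup.inv_mk], ?_⟩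
      simp only [c, List.countP_eq_zero] at hL ⊢
      intro a ha
      simp only [FreeGroup.invRev, List.mem_reverse, List.mem_map] at ha
      obtain ⟨b, hb, rfl⟩ := ha
      exact hL b hb
  have hc0 : ∀ L, c L = 0 → FreeGroup.mk L ∈ FC C := by
    intro L hL
    refine hmk L fun a ha => ?_
    simp only [c, List.countP_eq_zero] at hL
    simpa using hL a ha
  refine ⟨fun q => FreeGroup.mk (W q), fun q => (W q).length, ?_, hW, ?_, ?_⟩
  · have : W ((1 : FreeGroup ℕ) : FreeGroup ℕ ⧸ H) = [] := by
      by_contra hne'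
      refine hmin ((1 : FreeGroup ℕ) : FreeGroup ℕ ⧸ H) [] rfl ?_
      simp only [R, Prod.lex_def]
      rcases Nat.eq_zero_or_pos (c (W ((1 : FreeGroup ℕ) : FreeGroup ℕ ⧸ H))) with h0 | h0
      · right
        exact ⟨by rw [h0]; rfl, (List.shortlex_nil_or_eq_nil _).resolve_right hne'⟩
      · left; simpa [c] using h0
    simp only [this]
    rfl
  · intro q
    rcases hq : W q with _ | ⟨a, L⟩
    · left; simp only [hq]; rfl
    · right
      have hL : W ((FreeGroup.mk L : FreeGroup ℕ) : FreeGroup ℕ ⧸ H) = L := by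
        apply Rtri
        · intro hR
          refine hmin q (a :: W ((FreeGroup.mk L : FreeGroup ℕ) : FreeGroup ℕ ⧸ H)) ?_ ?_
          · rw [← List.singleton_append, ← FreeGroup.mul_mk, ← smul_eq_mul,
              ← MulAction.Quotient.smul_coe, hW]
            conv_rhs => rw [← hW q, hq, ← List.singleton_append, ← FreeGroup.mul_mk]
            rfl
          · rw [hq]; exact Rcons _ _ _ hR
        · exact hmin _ _ rfl
      have hq' : (FreeGroup.mk [a] * FreeGroup.mk L : FreeGroup ℕ) = FreeGroup.mk (W q) := by
        rw [hq, FreeGroup.mul_mk]; rfl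
      refine ⟨a.1, ((FreeGroup.mk L : FreeGroup ℕ) : FreeGroup ℕ ⧸ H), ?_, ?_⟩
      · simp only [hq, hL, List.length_cons]; omega
      · beta_reduce
        rw [hL, ← hq']
        have hqq : q = ((FreeGroup.mk [a] * FreeGroup.mk L : FreeGroup ℕ) : FreeGroup ℕ ⧸ H) := by
          rw [hq', hW]
        rcases a with ⟨a, _ | _⟩
        · right
          have e : (FreeGroup.mk [(a, false)] : FreeGroup ℕ) = (of a)⁻¹ := rfl
          rw [e] at hqq ⊢
          refine ⟨?_, by group⟩
          rw [hqq, MulAction.Quotient.smul_coe, smul_eq_mul, mul_inv_cancel_left]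
        · left
          exact ⟨hqq, rfl⟩
  · intro g hg
    obtain ⟨L, hL, hL0⟩ := hword g hg
    apply hc0
    have := hcle _ L (by rw [hL])
    omega

/-- A subgroup `H` of a free group has a basis containing a basis of `H ⊓ FC C`. -/
theorem exists_basis_inf (H : Subgroup (FreeGroup ℕ)) (C : Set ℕ) :
    ∃ (ι : Type) (b : FreeGroupBasis ι H) (I : Set ι),
      (Subgroup.closure (b '' I)).map H.subtype = H ⊓ FC C := by
  classical
  obtain ⟨T, ℓ, hT1, hTq, hpred, hTC⟩ := exists_transversal H C
  let q0 : FreeGroup ℕ ⧸ H := ((1 : FreeGroup ℕ) : FreeGroup ℕ ⧸ H)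
  have hT1' : T q0 = 1 := hT1
  have hmem : ∀ (g : FreeGroup ℕ) (q : FreeGroup ℕ ⧸ H), (T (g • q))⁻¹ * g * T q ∈ H := by
    intro g q
    rw [mul_assoc, ← QuotientGroup.eq, hTq]
    conv_lhs => rw [← hTq q]
    rfl
  let s : FreeGroup ℕ ⧸ H → ℕ → H := fun q a => ⟨(T (of a • q))⁻¹ * of a * T q, hmem _ _⟩
  have hs : ∀ q a, (s q a : FreeGroup ℕ) = (T (of a • q))⁻¹ * of a * T q := fun _ _ => rfl
  -- words rewritten as products of Schreier generators
  have hgen : ∀ (D : Set ℕ) (M : Set (FreeGroup ℕ ⧸ H)), (∀ q ∈ M, ∀ a ∈ D, of a • q ∈ M) →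
      (∀ q ∈ M, ∀ a ∈ D, (of a)⁻¹ • q ∈ M) → ∀ g ∈ FC D, ∀ q ∈ M, g • q ∈ M ∧
      (⟨(T (g • q))⁻¹ * g * T q, hmem g q⟩ : H) ∈
        Subgroup.closure {x | ∃ q ∈ M, ∃ a ∈ D, s q a = x} := by
    intro D M hM hM' g hg
    induction hg using Subgroup.closure_induction'' with
    | one =>
      intro q hq
      refine ⟨by rwa [one_smul], ?_⟩
      have : (⟨(T ((1 : FreeGroup ℕ) • q))⁻¹ * 1 * T q, hmem 1 q⟩ : H) = 1 := by
        ext; simp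
      rw [this]; exact one_mem _
    | mem x hx =>
      obtain ⟨a, ha, rfl⟩ := hx
      exact fun q hq => ⟨hM q hq a ha, Subgroup.subset_closure ⟨q, hq, a, ha, rfl⟩⟩
    | inv_mem x hx =>
      obtain ⟨a, ha, rfl⟩ := hx
      intro q hq
      refine ⟨hM' q hq a ha, ?_⟩
      have h1 : s ((of a)⁻¹ • q) a ∈ Subgroup.closure {x | ∃ q ∈ M, ∃ a ∈ D, s q a = x} :=
        Subgroup.subset_closure ⟨_, hM' q hq a ha, a, ha, rfl⟩
      convert inv_mem h1 using 1
      ext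
      rw [Subgroup.coe_inv, hs, smul_inv_smul]
      simp [mul_assoc]
    | mul x y _ _ hx hy =>
      intro q hq
      obtain ⟨hy1, hy2⟩ := hy q hq
      obtain ⟨hx1, hx2⟩ := hx _ hy1
      refine ⟨by rwa [mul_smul], ?_⟩
      convert mul_mem hx2 hy2 using 1
      ext
      rw [Subgroup.coe_mul]
      simp [mul_assoc, mul_smul]
  let ι : Type := {p : (FreeGroup ℕ ⧸ H) × ℕ // s p.1 p.2 ≠ 1}
  let b0 : ι → H := fun p => s p.1.1 p.1.2
  have hclos : Subgroup.closure (Set.range b0) = ⊤ := by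
    rw [eq_top_iff]
    intro h _
    have := (hgen Set.univ Set.univ (fun _ _ _ _ => trivial) (fun _ _ _ _ => trivial) h
      (by rw [FC_univ]; trivial) q0 trivial).2
    have hq : (h : FreeGroup ℕ) • q0 = q0 := by
      change ((h : FreeGroup ℕ) • ((1 : FreeGroup ℕ) : FreeGroup ℕ ⧸ H)) = _
      rw [MulAction.Quotient.smul_coe, smul_eq_mul, mul_one]
      exact ((QuotientGroup.eq (s := H)).2 (by simp)).symm
    have e : (⟨(T ((h : FreeGroup ℕ) • q0))⁻¹ * h * T q0, hmem h q0⟩ : H) = h := by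
      ext; simp [hq, hT1']
    rw [e] at this
    refine (Subgroup.closure_le _).2 ?_ this
    rintro _ ⟨q, -, a, -, rfl⟩
    by_cases h1 : s q a = 1
    · rw [h1]; exact one_mem _
    · exact Subgroup.subset_closure ⟨⟨(q, a), h1⟩, rfl⟩
  have huniv : ∀ {X : Type} [Group X] (f : ι → X), ∃! φ : H →* X, ∀ p, φ (b0 p) = f p := by
    intro X _ f
    let f' : FreeGroup ℕ ⧸ H → ℕ → X := fun q a =>
      if h : s q a ≠ 1 then f ⟨(q, a), h⟩ else 1
    let act : FreeGroup ℕ →* Equiv.Perm ((FreeGroup ℕ ⧸ H) × X) := FreeGroup.lift fun a =>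
      { toFun := fun p => (of a • p.1, f' p.1 a * p.2)
        invFun := fun p => ((of a)⁻¹ • p.1, (f' ((of a)⁻¹ • p.1) a)⁻¹ * p.2)
        left_inv := fun p => by simp
        right_inv := fun p => by simp }
    have hact : ∀ a p, act (of a) p = (of a • p.1, f' p.1 a * p.2) := fun a p => by
      simp [act]
    let cc : FreeGroup ℕ → FreeGroup ℕ ⧸ H → X := fun g q => (act g (q, 1)).2
    have hcc : ∀ g q x, act g (q, x) = (g • q, cc g q * x) := by
      intro g
      induction g using FreeGroup.induction_on with
      | C1 => intro q x; simp [cc]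
      | of a => intro q x; simp [cc, hact]
      | inv_of a h =>
        intro q x
        have h2 : ∀ q x, act (of a)⁻¹ (q, x) =
            ((of a)⁻¹ • q, (f' ((of a)⁻¹ • q) a)⁻¹ * x) := fun q x => by
          rw [map_inv, Equiv.Perm.inv_eq_iff_eq, hact]; simp
        simp only [cc]
        rw [h2, h2, mul_one]
      | mul g h hg hh =>
        intro q x
        simp only [cc, map_mul, Equiv.Perm.mul_apply]
        rw [hh q x, hh q 1, hg _ (cc h q * x), hg _ (cc h q * 1), mul_smul]
        simp [mul_assoc]
    have hmul : ∀ g h q, cc (g * h) q = cc g (h • q) * cc h q := by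
      intro g h q
      simp only [cc, map_mul, Equiv.Perm.mul_apply]
      rw [hcc h q 1, hcc g]
    have hone : ∀ q, cc 1 q = 1 := fun q => by simp [cc]
    have hof : ∀ a q, cc (of a) q = f' q a := fun a q => by simp [cc, hact]
    have hTq0 : ∀ q, T q • q0 = q := by
      intro q
      change T q • ((1 : FreeGroup ℕ) : FreeGroup ℕ ⧸ H) = q
      rw [MulAction.Quotient.smul_coe, smul_eq_mul, mul_one, hTq]
    have hfree : ∀ a q, T (of a • q) = of a * T q → f' q a = 1 := by
      intro a q h
      have : s q a = 1 := by ext; rw [hs, h]; simp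
      simp [f', this]
    have hT : ∀ n q, ℓ q ≤ n → cc (T q) q0 = 1 := by
      intro n
      induction n with
      | zero =>
        intro q hq
        rcases hpred q with h | ⟨a, q', hl, -⟩
        · rw [h, hone]
        · omega
      | succ n ih =>
        intro q hq
        rcases hpred q with h | ⟨a, q', hl, ⟨h1, h2⟩ | ⟨h1, h2⟩⟩
        · rw [h, hone]
        · rw [h2, hmul, hTq0, hof, ih q' (by omega), mul_one]
          exact hfree _ _ (by rw [← h1, h2])
        · have := ih q' (by omega)
          rw [h2, hmul, hTq0, hof, hfree _ _ (by rw [← h1, h2]), one_mul] at this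
          exact this
    have hHq : ∀ h : H, (h : FreeGroup ℕ) • q0 = q0 := by
      intro h
      change ((h : FreeGroup ℕ) • ((1 : FreeGroup ℕ) : FreeGroup ℕ ⧸ H)) = _
      rw [MulAction.Quotient.smul_coe, smul_eq_mul, mul_one]
      exact ((QuotientGroup.eq (s := H)).2 (by simp)).symm
    let φ : H →* X :=
      { toFun := fun h => cc h q0
        map_one' := hone _
        map_mul' := fun g h => by rw [Subgroup.coe_mul, hmul, hHq] }
    have hφ : ∀ p, φ (b0 p) = f p := by
      intro p
      have h1 : T (of p.1.2 • p.1.1) * (b0 p : FreeGroup ℕ) = of p.1.2 * T p.1.1 := by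
        rw [hs]; group
      have h2 := congrArg (fun g => cc g q0) h1
      simp only [hmul, hTq0, hof, hHq, hT _ _ le_rfl, one_mul, mul_one] at h2
      change cc (b0 p) q0 = _
      rw [h2]
      have := p.2
      simp [f', this]
    refine ⟨φ, hφ, ?_⟩
    · intro ψ hψ
      have : ∀ h : H, ψ h = φ h := by
        intro h
        have hh : h ∈ Subgroup.closure (Set.range b0) := by rw [hclos]; trivial
        have hle : Subgroup.closure (Set.range b0) ≤ ψ.eqLocus φ := by
          rw [Subgroup.closure_le]
          rintro _ ⟨p, rfl⟩
          exact (hψ p).trans (hφ p).symm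
        exact hle hh
      exact MonoidHom.ext this
  refine ⟨ι, FreeGroupBasis.ofUniqueLift ι b0 huniv, {p | p.1.2 ∈ C ∧ ∃ g ∈ FC C, (g : FreeGroup ℕ ⧸ H) = p.1.1}, ?_⟩
  have hb : ∀ p, FreeGroupBasis.ofUniqueLift ι b0 huniv p = b0 p := by
    intro p
    change FreeGroup.lift b0 (of p) = b0 p
    simp
  apply le_antisymm
  · rw [Subgroup.map_le_iff_le_comap, Subgroup.closure_le]
    rintro _ ⟨p, ⟨hp, g, hg, hgp⟩, rfl⟩
    rw [hb]
    refine ⟨(b0 p).2, ?_⟩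
    have h1 : T p.1.1 ∈ FC C := hgp ▸ hTC g hg
    have h2 : T (of p.1.2 • p.1.1) ∈ FC C := by
      rw [← hgp, MulAction.Quotient.smul_coe, smul_eq_mul]
      exact hTC _ (mul_mem (of_mem_FC hp) hg)
    exact (FC C).mul_mem ((FC C).mul_mem ((FC C).inv_mem h2) (of_mem_FC hp)) h1
  · rintro h ⟨hH, hC⟩
    let M : Set (FreeGroup ℕ ⧸ H) := {q | ∃ g ∈ FC C, (g : FreeGroup ℕ ⧸ H) = q}
    have := (hgen C M ?_ ?_ h hC q0 ⟨1, one_mem _, rfl⟩).2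
    · refine ⟨⟨h, hH⟩, ?_, rfl⟩
      have hq : h • q0 = q0 := by
        change h • ((1 : FreeGroup ℕ) : FreeGroup ℕ ⧸ H) = _
        rw [MulAction.Quotient.smul_coe, smul_eq_mul, mul_one]
        exact ((QuotientGroup.eq (s := H)).2 (by simpa using hH)).symm
      have e : (⟨(T (h • q0))⁻¹ * h * T q0, hmem h q0⟩ : H) = ⟨h, hH⟩ := by
        ext; simp [hq, hT1']
      rw [e] at this
      refine (Subgroup.closure_le _).2 ?_ this
      rintro _ ⟨q, hq, a, ha, rfl⟩
      by_cases h1 : s q a = 1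
      · rw [h1]; exact one_mem _
      · exact Subgroup.subset_closure ⟨⟨(q, a), h1⟩, ⟨ha, hq⟩, hb _⟩
    · rintro _ ⟨g, hg, rfl⟩ a ha
      exact ⟨of a * g, mul_mem (of_mem_FC ha) hg, rfl⟩
    · rintro _ ⟨g, hg, rfl⟩ a ha
      exact ⟨(of a)⁻¹ * g, mul_mem (inv_mem (of_mem_FC ha)) hg, rfl⟩

/-! ### Free factors of finite rank -/

/-- A free factor of finite rank of the free group of countable rank. -/
def IsFF (B : Subgroup (FreeGroup ℕ)) : Prop := ∃ (σ : MulAut (FreeGroup ℕ)) (n : ℕ), B = σ • Fn n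

theorem isFF_Fn (n : ℕ) : IsFF (Fn n) := ⟨1, n, (one_smul _ _).symm⟩

theorem IsFF.smul {B : Subgroup (FreeGroup ℕ)} (h : IsFF B) (g : MulAut (FreeGroup ℕ)) :
    IsFF (g • B) := by
  obtain ⟨σ, n, rfl⟩ := h
  exact ⟨g * σ, n, by rw [mul_smul]⟩

theorem map_val_range (C : Set ℕ) :
    (FreeGroup.map (Subtype.val : C → ℕ)).range = FC C := by
  apply le_antisymm
  · rintro _ ⟨w, rfl⟩
    induction w using FreeGroup.induction_on with
    | C1 => simp
    | of i => simpa using of_mem_FC i.2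
    | inv_of i h => simpa using of_mem_FC i.2
    | mul a b ha hb => rw [map_mul]; exact mul_mem ha hb
  · exact FC_le.2 fun i hi => ⟨of ⟨i, hi⟩, by simp⟩

/-- `FC C` is free on `C`. -/
noncomputable def fcEquiv (C : Set ℕ) : FreeGroup C ≃* FC C :=
  (MonoidHom.ofInjective (FreeGroup.map_injective Subtype.val_injective)).trans
    (MulEquiv.subgroupCongr (map_val_range C))

theorem fcEquiv_of {C : Set ℕ} (i : C) : (fcEquiv C (of i) : FreeGroup ℕ) = of (i : ℕ) := by
  change FreeGroup.map Subtype.val (of i) = _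
  simp

theorem fcEquiv_symm_of {C : Set ℕ} {i : ℕ} (hi : i ∈ C) :
    (fcEquiv C).symm ⟨of i, of_mem_FC hi⟩ = of ⟨i, hi⟩ := by
  rw [MulEquiv.symm_apply_eq]
  ext
  rw [fcEquiv_of]

/-- The restriction of an automorphism to an isomorphism between subgroups. -/
def restr (g : MulAut (FreeGroup ℕ)) (S : Subgroup (FreeGroup ℕ)) : S ≃* (g • S : Subgroup _) :=
  Subgroup.equivSMul g S

theorem restr_apply (g : MulAut (FreeGroup ℕ)) (S : Subgroup (FreeGroup ℕ)) (w : S) :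
    (restr g S w : FreeGroup ℕ) = g w := rfl

theorem rank_eq {g : MulAut (FreeGroup ℕ)} {m n : ℕ} (h : g • Fn m = Fn n) : m = n := by
  have e : Set.Iio m ≃ Set.Iio n := Equiv.ofFreeGroupEquiv
    ((fcEquiv _).trans ((restr g _).trans ((MulEquiv.subgroupCongr h).trans (fcEquiv _).symm)))
  simpa using Fintype.card_congr e

theorem exists_extend_iso {C : Set ℕ} (θ : FC C ≃* FC C) :
    ∃ ω : MulAut (FreeGroup ℕ), (∀ w : FC C, ω w = θ w) ∧ ∀ i ∉ C, ω (of i) = of i := by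
  classical
  let φ : (FC C ≃* FC C) → ℕ → FreeGroup ℕ := fun θ i =>
    if h : i ∈ C then θ ⟨of i, of_mem_FC h⟩ else of i
  have key : ∀ (θ : FC C ≃* FC C) (w : FC C), FreeGroup.lift (φ θ) w = θ w := by
    intro θ w
    have : (FreeGroup.lift (φ θ)).comp ((FC C).subtype.comp (fcEquiv C).toMonoidHom) =
        (FC C).subtype.comp (θ.toMonoidHom.comp (fcEquiv C).toMonoidHom) := by
      ext i
      have : (⟨of (i : ℕ), of_mem_FC i.2⟩ : FC C) = fcEquiv C (of i) := by
        ext; rw [fcEquiv_of]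
      simp [fcEquiv_of, φ, this]
    have h2 := DFunLike.congr_fun this ((fcEquiv C).symm w)
    simpa using h2
  refine ⟨mkAut (φ θ) (φ θ.symm) ?_ ?_, fun w => key θ w, fun i hi => ?_⟩
  · intro i
    by_cases h : i ∈ C
    · have : φ θ i = θ ⟨of i, of_mem_FC h⟩ := by simp [φ, h]
      rw [this, key]; simp
    · simp [φ, h]
  · intro i
    by_cases h : i ∈ C
    · have : φ θ.symm i = θ.symm ⟨of i, of_mem_FC h⟩ := by simp [φ, h]
      rw [this, key]; simp
    · simp [φ, h]
  · rw [mkAut_of]; simp [φ, hi]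

/-- A finite rank free factor `B` has a basis containing a basis of `B ⊓ FC C`. -/
theorem IsFF.exists_adapted_inf {B : Subgroup (FreeGroup ℕ)} (hB : IsFF B) (C : Set ℕ) :
    ∃ (σ : MulAut (FreeGroup ℕ)) (M j : ℕ), j ≤ M ∧ σ • Fn M = B ∧ σ • Fn j = B ⊓ FC C := by
  classical
  obtain ⟨τ, M, rfl⟩ := hB
  obtain ⟨ι, b, I, hI⟩ := exists_basis_inf (τ • Fn M) C
  let e0 : ι ≃ Set.Iio M := Equiv.ofFreeGroupEquiv
    (b.repr.symm.trans ((restr τ _).symm.trans (fcEquiv _).symm))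
  have : Fintype ι := Fintype.ofEquiv _ e0.symm
  have hcard : Fintype.card I + Fintype.card (Iᶜ : Set ι) = M := by
    rw [← Fintype.card_sum, Fintype.card_congr (Equiv.Set.sumCompl I), Fintype.card_congr e0]
    simp
  let e : ι ≃ Set.Iio M := (Equiv.Set.sumCompl I).symm.trans
    ((Equiv.sumCongr (Fintype.equivFin I) (Fintype.equivFin (Iᶜ : Set ι))).trans
      (finSumFinEquiv.trans ((finCongr hcard).trans Fin.equivSubtype)))
  have he : ∀ p, p ∈ I ↔ (e p : ℕ) < Fintype.card I := by
    intro p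
    by_cases hp : p ∈ I
    · have : (e p : ℕ) = Fintype.equivFin I ⟨p, hp⟩ := by
        simp only [e, Equiv.trans_apply, Equiv.Set.sumCompl_symm_apply_of_mem hp]
        rfl
      simp only [hp, this, true_iff]
      exact (Fintype.equivFin I ⟨p, hp⟩).2
    · have : (e p : ℕ) = Fintype.card I + Fintype.equivFin (Iᶜ : Set ι) ⟨p, hp⟩ := by
        simp only [e, Equiv.trans_apply, Equiv.Set.sumCompl_symm_apply_of_notMem hp]
        rfl
      simp only [hp, this, false_iff]
      omega
  let θ : FC (Set.Iio M) ≃* FC (Set.Iio M) :=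
    (fcEquiv _).symm.trans ((FreeGroup.freeGroupCongr e.symm).trans
      (b.repr.symm.trans (restr τ _).symm))
  obtain ⟨ω, hω, -⟩ := exists_extend_iso θ
  have hωM : ω • Fn M = Fn M := by
    apply le_antisymm
    · exact smul_le_iff.2 fun w hw => by rw [hω ⟨w, hw⟩]; exact (θ _).2
    · intro w hw
      rw [mem_smul_iff]
      have := hω (θ.symm ⟨w, hw⟩)
      rw [MulEquiv.apply_symm_apply] at this
      change _ = w at this
      rw [← this, MulAut.inv_apply_self]
      exact (θ.symm ⟨w, hw⟩).2
  have hb : ∀ p, (τ * ω) (of (e p : ℕ)) = b p := by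
    intro p
    have h1 : ω (of (e p : ℕ)) = θ ⟨of (e p : ℕ), of_mem_FC (e p).2⟩ :=
      hω ⟨of (e p : ℕ), of_mem_FC (e p).2⟩
    rw [MulAut.mul_apply, h1, ← restr_apply]
    simp only [θ, MulEquiv.trans_apply, fcEquiv_symm_of (e p).2, MulEquiv.apply_symm_apply]
    simp
    rfl
  refine ⟨τ * ω, M, Fintype.card I, by omega, by rw [mul_smul, hωM], ?_⟩
  rw [← hI]
  apply le_antisymm
  · refine smul_FC_le.2 fun i hi => ?_
    have hiM : i < M := lt_of_lt_of_le hi (by omega)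
    have h1 : (e (e.symm ⟨i, hiM⟩) : ℕ) = i := by rw [Equiv.apply_symm_apply]
    have h2 : e.symm ⟨i, hiM⟩ ∈ I := by rw [he, h1]; exact hi
    rw [← h1, hb]
    exact ⟨_, Subgroup.subset_closure ⟨_, h2, rfl⟩, rfl⟩
  · rw [Subgroup.map_le_iff_le_comap, Subgroup.closure_le]
    rintro _ ⟨p, hp, rfl⟩
    rw [SetLike.mem_coe, Subgroup.mem_comap, Subgroup.subtype_apply, ← hb, apply_mem_smul_iff]
    exact of_mem_FC ((he p).1 hp)

theorem IsFF.inf {B B' : Subgroup (FreeGroup ℕ)} (hB : IsFF B) (hB' : IsFF B') :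
    IsFF (B ⊓ B') := by
  obtain ⟨τ, n, rfl⟩ := hB'
  obtain ⟨σ, M, j, -, -, h⟩ := (hB.smul τ⁻¹).exists_adapted_inf (Set.Iio n)
  refine ⟨τ * σ, j, ?_⟩
  rw [mul_smul, h, Subgroup.smul_inf, smul_inv_smul]

/-- A basis of a free factor contained in `B` extends to a basis of `B`. -/
theorem IsFF.exists_adapted {B : Subgroup (FreeGroup ℕ)} (hB : IsFF B)
    {σ : MulAut (FreeGroup ℕ)} {k : ℕ} (h : σ • Fn k ≤ B) :
    ∃ (σ' : MulAut (FreeGroup ℕ)) (M : ℕ), k ≤ M ∧ (∀ w ∈ Fn k, σ' w = σ w) ∧ σ' • Fn M = B := by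
  obtain ⟨τ, M, j, hj, h1, h2⟩ := (hB.smul σ⁻¹).exists_adapted_inf (Set.Iio k)
  have h3 : Fn k ≤ σ⁻¹ • B := by rwa [← Subgroup.pointwise_smul_subset_iff]
  rw [inf_eq_right.2 h3] at h2
  obtain rfl := rank_eq h2
  obtain ⟨ρ, hρ, hρ'⟩ := exists_extend h2
  have hρM : ρ • Fn M = Fn M := by
    apply le_antisymm
    · refine smul_FC_le.2 fun i hi => ?_
      by_cases hij : i < j
      · rw [hρ _ (of_mem_Fn hij)]
        exact Fn_mono hj (apply_mem_of_smul_eq h2 (of_mem_Fn hij))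
      · rw [hρ' i (by simpa using hij)]; exact of_mem_Fn hi
    · refine FC_le.2 fun i hi => ?_
      by_cases hij : i < j
      · have h5 := inv_apply_mem_of_smul_eq h2 (of_mem_Fn hij)
        have h6 := hρ _ h5
        rw [MulAut.apply_inv_self] at h6
        rw [← h6, apply_mem_smul_iff]
        exact Fn_mono hj h5
      · rw [← hρ' i (by simpa using hij), apply_mem_smul_iff]; exact of_mem_Fn hi
  refine ⟨σ * τ * ρ⁻¹, M, hj, fun w hw => ?_, ?_⟩
  · have h4 : τ (ρ⁻¹ w) = w := by
      have h5 : ρ • Fn j = Fn j := by rw [smul_eq_of_eqOn hρ, h2]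
      rw [← hρ _ (inv_apply_mem_of_smul_eq h5 hw), MulAut.apply_inv_self]
    rw [MulAut.mul_apply, MulAut.mul_apply, h4]
  · have h4 : ρ⁻¹ • Fn M = Fn M := by rw [inv_smul_eq_iff, hρM]
    rw [mul_smul, mul_smul, h4, h1, smul_inv_smul]

/-- Every automorphism agrees on `Fn m` with a finitely supported one. -/
theorem exists_finitary (g : MulAut (FreeGroup ℕ)) (m : ℕ) :
    ∃ (N : ℕ) (q : MulAut (FreeGroup ℕ)), m ≤ N ∧ (∀ w ∈ Fn m, q w = g w) ∧ q • Fn N = Fn N ∧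
      ∀ i, N ≤ i → q (of i) = of i := by
  obtain ⟨N, hN, h⟩ := exists_smul_Fn_le [g] m m
  obtain ⟨σ, M, hM, h1, h2⟩ := (isFF_Fn N).exists_adapted (h g (by simp))
  obtain rfl := rank_eq h2
  obtain ⟨ω, hω, hω'⟩ := exists_extend h2
  refine ⟨M, ω, hN, fun w hw => ?_, ?_, fun i hi => hω' i (by simpa using hi)⟩
  · rw [hω w (Fn_mono hN hw), h1 w hw]
  · rw [smul_eq_of_eqOn hω, h2]

theorem IsFF.exists_le_Fn {B : Subgroup (FreeGroup ℕ)} (hB : IsFF B) (m : ℕ) :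
    ∃ n ≥ m, B ≤ Fn n := by
  obtain ⟨σ, k, rfl⟩ := hB
  obtain ⟨N, hN, h⟩ := exists_smul_Fn_le [σ] k m
  exact ⟨N, hN, h σ (by simp)⟩

/-! ### Elements fixed by a pointwise stabilizer -/

open Classical in
/-- The automorphism `x ↦ d x` fixing all other letters; here `d` is first retracted to the
subgroup generated by the other letters. -/
noncomputable def lmul (x : ℕ) (d : FreeGroup ℕ) : MulAut (FreeGroup ℕ) :=
  mkAut (fun i => if i = x then retr {x}ᶜ d * of x else of i)
    (fun i => if i = x then (retr {x}ᶜ d)⁻¹ * of x else of i)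
    (fun i => by
      have h : ∀ w ∈ FC {x}ᶜ, FreeGroup.lift
          (fun i => if i = x then (retr {x}ᶜ d)⁻¹ * of x else of i) w = w := fun w hw =>
        hom_eqOn (g := MonoidHom.id _) (fun i hi => by
          rw [FreeGroup.lift_apply_of, if_neg (by simpa using hi)]; rfl) hw
      by_cases hi : i = x
      · subst hi
        rw [if_pos rfl, map_mul, h _ (retr_mem _ _)]
        simp
      · simp [hi])
    (fun i => by
      have h : ∀ w ∈ FC {x}ᶜ, FreeGroup.lift
          (fun i => if i = x then (retr {x}ᶜ d) * of x else of i) w = w := fun w hw =>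
        hom_eqOn (g := MonoidHom.id _) (fun i hi => by
          rw [FreeGroup.lift_apply_of, if_neg (by simpa using hi)]; rfl) hw
      by_cases hi : i = x
      · subst hi
        rw [if_pos rfl, map_mul, map_inv, h _ (retr_mem _ _)]
        simp
      · simp [hi])

theorem lmul_self {x : ℕ} {d : FreeGroup ℕ} (hd : d ∈ FC {x}ᶜ) : lmul x d (of x) = d * of x := by
  simp [lmul, retr_eq_self hd]

theorem lmul_of_ne {x i : ℕ} (d : FreeGroup ℕ) (h : i ≠ x) : lmul x d (of i) = of i := by
  simp [lmul, h]

theorem lmul_mem_PS (x : ℕ) (d : FreeGroup ℕ) : lmul x d ∈ PS (FC {x}ᶜ) :=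
  mem_PS_FC.2 fun _ hi => lmul_of_ne d hi

theorem mem_FC_of_forall {C : Set ℕ} {w : FreeGroup ℕ} (h : ∀ x ∉ C, w ∈ FC {x}ᶜ) :
    w ∈ FC C := by
  obtain ⟨n, hn⟩ := exists_mem_Fn w
  have : ∀ m, w ∈ FC (Set.Iio n ∩ (C ∪ Set.Ici m)) := by
    intro m
    induction m with
    | zero => simpa using hn
    | succ m ih =>
      by_cases hm : m ∈ C
      · refine FC_mono ?_ ih
        rintro i ⟨h1, h2 | h2⟩
        · exact ⟨h1, Or.inl h2⟩
        · rcases eq_or_lt_of_le (Set.mem_Ici.1 h2) with rfl | h3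
          · exact ⟨h1, Or.inl hm⟩
          · exact ⟨h1, Or.inr h3⟩
      · have h4 : w ∈ FC _ ⊓ FC _ := ⟨ih, h m hm⟩
        rw [FC_inf] at h4
        refine FC_mono ?_ h4
        rintro i ⟨⟨h1, h2 | h2⟩, h3⟩
        · exact ⟨h1, Or.inl h2⟩
        · exact ⟨h1, Or.inr (lt_of_le_of_ne h2 (Ne.symm h3))⟩
  refine FC_mono ?_ (this n)
  rintro i ⟨h1, h2 | h2⟩
  · exact h2
  · exact absurd (Set.mem_Iio.1 h1) (not_lt.2 (Set.mem_Ici.1 h2))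

theorem mem_FC_compl_of_lmul {x s : ℕ} (hs : s ≠ x) {w : FreeGroup ℕ} (hw : w ∈ FC {s}ᶜ)
    (h : lmul x (of s) w = w) : w ∈ FC {x}ᶜ := by
  classical
  let κ : FreeGroup ℕ →* FreeGroup ℕ := FreeGroup.lift fun i => if i = s then (of x)⁻¹ else of i
  have h1 : κ w = w := hom_eqOn (g := MonoidHom.id _)
    (fun i hi => by simp [κ, show i ≠ s from hi]) hw
  have h2 : κ (lmul x (of s) w) = retr {x}ᶜ w := by
    refine hom_eqOn (f := κ.comp (lmul x (of s)).toMonoidHom) (C := {s}ᶜ) (fun i hi => ?_) hw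
    have his : i ≠ s := hi
    by_cases hix : i = x
    · subst hix
      rw [retr_of_notMem (by simp)]
      simp [lmul_self (of_mem_FC (show s ∈ ({i}ᶜ : Set ℕ) from hs)), κ, hs.symm]
    · rw [retr_of_mem (by simpa using hix)]
      simp [lmul_of_ne _ hix, κ, his]
  rw [mem_FC_iff, ← h2, h, h1]

theorem Fix_PS_FC (C : Set ℕ) : Fix (PS (FC C)) = FC C := by
  apply le_antisymm
  · intro w hw
    refine mem_FC_of_forall fun x hx => ?_
    obtain ⟨n, hn⟩ := exists_mem_Fn w
    refine mem_FC_compl_of_lmul (s := n + x + 1) (by omega) (FC_mono ?_ hn)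
      (hw _ (PS_anti (FC_mono ?_) (lmul_mem_PS x _)))
    · intro i hi h
      simp only [Set.mem_Iio, Set.mem_singleton_iff] at hi h
      omega
    · rintro i hi rfl; exact hx hi
  · exact le_PS_iff.1 le_rfl

/-! ### Limits of chains of automorphisms -/

theorem exists_limit_chain (B : ℕ → Subgroup (FreeGroup ℕ)) (θ : ℕ → MulAut (FreeGroup ℕ))
    (hB : ∀ n, B n ≤ B (n + 1)) (hθ : ∀ n, ∀ w ∈ B n, θ (n + 1) w = θ n w)
    (h1 : ∀ n, Fn n ≤ B n) (h2 : ∀ n, Fn n ≤ θ n • B n) :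
    ∃ G : MulAut (FreeGroup ℕ), ∀ n, ∀ w ∈ B n, G w = θ n w := by
  have hmono : Monotone B := monotone_nat_of_le_succ hB
  have hst : ∀ n k, n ≤ k → ∀ w ∈ B n, θ k w = θ n w := by
    intro n k hk w hw
    induction k, hk using Nat.le_induction with
    | base => rfl
    | succ k hk ih => rw [hθ k w (hmono hk hw), ih]
  have hst' : ∀ n k, n ≤ k → ∀ w ∈ θ n • B n, (θ k)⁻¹ w = (θ n)⁻¹ w := by
    intro n k hk w hw
    have h3 := hst n k hk _ (mem_smul_iff.1 hw)
    rw [MulAut.apply_inv_self] at h3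
    conv_lhs => rw [← h3]
    rw [MulAut.inv_apply_self]
  obtain ⟨G, hG⟩ := exists_limit θ
    (fun a => by
      obtain ⟨n, hn⟩ := exists_mem_Fn a
      exact ⟨n, fun k hk => hst n k hk a (h1 n hn)⟩)
    (fun a => by
      obtain ⟨n, hn⟩ := exists_mem_Fn a
      exact ⟨n, fun k hk => hst' n k hk a (h2 n hn)⟩)
  refine ⟨G, fun n w hw => ?_⟩
  obtain ⟨N, hN⟩ := hG w
  rw [← (hN (max n N) (le_max_right _ _)).1, hst n _ (le_max_left _ _) w hw]

/-! ### Generic tuples -/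

/-- The tuple `z 0, …, z (k - 1)` is locally finite and absorbs all finite extensions. -/
structure Gen (k : ℕ) (z : ℕ → MulAut (FreeGroup ℕ)) : Prop where
  cof : ∀ n, ∃ B, IsFF B ∧ Fn n ≤ B ∧ ∀ i < k, z i • B = B
  ext : ∀ B B₁, IsFF B → IsFF B₁ → B ≤ B₁ → (∀ i < k, z i • B = B) →
    ∀ h : ℕ → MulAut (FreeGroup ℕ), (∀ i < k, h i • B₁ = B₁) → (∀ i < k, ∀ w ∈ B, h i w = z i w) →
    ∃ σ ∈ PS B, ∀ i < k, ∀ w ∈ B₁, z i (σ w) = σ (h i w)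

theorem gen_zero (z : ℕ → MulAut (FreeGroup ℕ)) : Gen 0 z where
  cof n := ⟨Fn n, isFF_Fn n, le_rfl, fun i hi => absurd hi (Nat.not_lt_zero i)⟩
  ext _ _ _ _ _ _ _ _ _ := ⟨1, one_mem _, fun i hi => absurd hi (Nat.not_lt_zero i)⟩

/-- A partial conjugacy between the tuples `z` and `z'`. -/
structure PConj (k : ℕ) (z z' : ℕ → MulAut (FreeGroup ℕ)) (B : Subgroup (FreeGroup ℕ))
    (θ : MulAut (FreeGroup ℕ)) : Prop where
  ff : IsFF B
  inv : ∀ i < k, z i • B = B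
  comm : ∀ i < k, ∀ w ∈ B, θ (z i w) = z' i (θ w)

theorem PConj.smul_inv {k : ℕ} {z z' : ℕ → MulAut (FreeGroup ℕ)} {B : Subgroup (FreeGroup ℕ)}
    {θ : MulAut (FreeGroup ℕ)} (h : PConj k z z' B θ) : ∀ i < k, z' i • θ • B = θ • B := by
  intro i hi
  rw [← mul_smul, ← smul_eq_of_eqOn (g := θ * z i) (fun w hw => ?_), mul_smul, h.inv i hi]
  exact h.comm i hi w hw

theorem PConj.symm {k : ℕ} {z z' : ℕ → MulAut (FreeGroup ℕ)} {B : Subgroup (FreeGroup ℕ)}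
    {θ : MulAut (FreeGroup ℕ)} (h : PConj k z z' B θ) : PConj k z' z (θ • B) θ⁻¹ where
  ff := h.ff.smul θ
  inv := h.smul_inv
  comm i hi w hw := by
    have := h.comm i hi _ (mem_smul_iff.1 hw)
    rw [MulAut.apply_inv_self] at this
    rw [← this, MulAut.inv_apply_self]

theorem PConj.forth {k : ℕ} {z z' : ℕ → MulAut (FreeGroup ℕ)} {B : Subgroup (FreeGroup ℕ)}
    {θ : MulAut (FreeGroup ℕ)} (h : PConj k z z' B θ) (hz : Gen k z) (hz' : Gen k z') (n : ℕ) :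
    ∃ B' θ', PConj k z z' B' θ' ∧ B ≤ B' ∧ Fn n ≤ B' ∧ ∀ w ∈ B, θ' w = θ w := by
  obtain ⟨m, hm, hBm⟩ := h.ff.exists_le_Fn n
  obtain ⟨B', hB', hmB', hinv⟩ := hz.cof m
  have hle : B ≤ B' := hBm.trans hmB'
  obtain ⟨σ, hσ, hσz⟩ := hz'.ext (θ • B) (θ • B') (h.ff.smul θ) (hB'.smul θ)
    (Subgroup.pointwise_smul_le_pointwise_smul_iff.2 hle) h.smul_inv (fun i => θ * z i * θ⁻¹)
    (fun i hi => by rw [mul_smul, mul_smul, inv_smul_smul, hinv i hi])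
    (fun i hi w hw => by
      have := h.comm i hi _ (mem_smul_iff.1 hw)
      rw [MulAut.apply_inv_self] at this
      rw [MulAut.mul_apply, MulAut.mul_apply, this])
  refine ⟨B', σ * θ, ⟨hB', hinv, fun i hi w hw => ?_⟩, hle, (Fn_mono hm).trans hmB', fun w hw => ?_⟩
  · have := hσz i hi (θ w) (apply_mem_smul_iff.2 hw)
    rw [MulAut.mul_apply, MulAut.mul_apply, this, MulAut.mul_apply, MulAut.mul_apply,
      MulAut.inv_apply_self]
  · exact hσ _ (apply_mem_smul_iff.2 hw)

theorem PConj.step {k : ℕ} {z z' : ℕ → MulAut (FreeGroup ℕ)} {B : Subgroup (FreeGroup ℕ)}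
    {θ : MulAut (FreeGroup ℕ)} (h : PConj k z z' B θ) (hz : Gen k z) (hz' : Gen k z') (n : ℕ) :
    ∃ B' θ', PConj k z z' B' θ' ∧ B ≤ B' ∧ Fn n ≤ B' ∧ Fn n ≤ θ' • B' ∧ ∀ w ∈ B, θ' w = θ w := by
  obtain ⟨B₁, θ₁, h₁, hB₁, hn₁, e₁⟩ := h.forth hz hz' n
  obtain ⟨B₂, φ, h₂, hB₂, hn₂, e₂⟩ := h₁.symm.forth hz' hz n
  have e3 : ∀ w ∈ B₁, φ⁻¹ w = θ₁ w := by
    intro w hw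
    have := e₂ (θ₁ w) (apply_mem_smul_iff.2 hw)
    rw [MulAut.inv_apply_self] at this
    conv_lhs => rw [← this]
    rw [MulAut.inv_apply_self]
  have hle : B₁ ≤ φ • B₂ := by
    intro w hw
    rw [mem_smul_iff, e3 w hw]
    exact hB₂ (apply_mem_smul_iff.2 hw)
  exact ⟨φ • B₂, φ⁻¹, h₂.symm, hB₁.trans hle, hn₁.trans hle, by rwa [inv_smul_smul],
    fun w hw => by rw [e3 w (hB₁ hw), e₁ w hw]⟩

/-- Two generic tuples agreeing on an invariant free factor are conjugate over it. -/
theorem Gen.exists_conj {k : ℕ} {z z' : ℕ → MulAut (FreeGroup ℕ)} (hz : Gen k z) (hz' : Gen k z')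
    {A : Subgroup (FreeGroup ℕ)} (hA : IsFF A) (hinv : ∀ i < k, z i • A = A)
    (hag : ∀ i < k, ∀ w ∈ A, z i w = z' i w) :
    ∃ κ ∈ PS A, ∀ i < k, κ * z i = z' i * κ := by
  let St := {p : Subgroup (FreeGroup ℕ) × MulAut (FreeGroup ℕ) // PConj k z z' p.1 p.2}
  have hstep : ∀ (n : ℕ) (p : St), ∃ p' : St, p.1.1 ≤ p'.1.1 ∧ Fn n ≤ p'.1.1 ∧
      Fn n ≤ p'.1.2 • p'.1.1 ∧ ∀ w ∈ p.1.1, p'.1.2 w = p.1.2 w := by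
    rintro n ⟨⟨B, θ⟩, h⟩
    obtain ⟨B', θ', h', h1⟩ := h.step hz hz' n
    exact ⟨⟨(B', θ'), h'⟩, h1⟩
  choose f hf using hstep
  let p0 : St := ⟨(A, 1), hA, hinv, hag⟩
  let s : ℕ → St := fun n => Nat.rec p0 f n
  have hs : ∀ n, s (n + 1) = f n (s n) := fun n => rfl
  obtain ⟨G, hG⟩ := exists_limit_chain (fun n => (s (n + 1)).1.1) (fun n => (s (n + 1)).1.2)
    (fun n => by rw [hs (n + 1)]; exact (hf _ _).1)
    (fun n => by rw [hs (n + 1)]; exact (hf _ _).2.2.2)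
    (fun n => by rw [hs n]; exact (hf _ _).2.1)
    (fun n => by rw [hs n]; exact (hf _ _).2.2.1)
  refine ⟨G, fun a ha => ?_, fun i hi => ?_⟩
  · rw [hG 0 a ((hf 0 p0).1 ha)]
    exact (hf 0 p0).2.2.2 a ha
  · ext w
    obtain ⟨n, hn⟩ := exists_mem_Fn w
    have hw : w ∈ (s (n + 1)).1.1 := (hf n (s n)).2.1 hn
    have hzw : z i w ∈ (s (n + 1)).1.1 := apply_mem_of_smul_eq ((s (n + 1)).2.inv i hi) hw
    rw [MulAut.mul_apply, MulAut.mul_apply, hG n _ hw, hG n _ hzw]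
    exact (s (n + 1)).2.comm i hi w hw

/-! ### Comeager sets in pointwise stabilizers -/

/-- `U` is relatively open in `PS A`. -/
def OpenIn (A : Subgroup (FreeGroup ℕ)) (U : Set (MulAut (FreeGroup ℕ))) : Prop :=
  ∀ x ∈ PS A, x ∈ U → ∃ m, ∀ x' ∈ PS A, (∀ w ∈ Fn m, x' w = x w) → x' ∈ U

/-- `U` is dense in `PS A`. -/
def DenseIn (A : Subgroup (FreeGroup ℕ)) (U : Set (MulAut (FreeGroup ℕ))) : Prop :=
  ∀ x ∈ PS A, ∀ m, ∃ x' ∈ PS A, x' ∈ U ∧ ∀ w ∈ Fn m, x' w = x w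

/-- `S` is comeager in `PS A`. -/
def Cmg (A : Subgroup (FreeGroup ℕ)) (S : Set (MulAut (FreeGroup ℕ))) : Prop :=
  ∃ U : ℕ → Set (MulAut (FreeGroup ℕ)), (∀ j, OpenIn A (U j) ∧ DenseIn A (U j)) ∧
    ∀ x ∈ PS A, (∀ j, x ∈ U j) → x ∈ S

variable {A : Subgroup (FreeGroup ℕ)}

theorem Cmg.of_open_dense {U : Set (MulAut (FreeGroup ℕ))} (h1 : OpenIn A U) (h2 : DenseIn A U) :
    Cmg A U := ⟨fun _ => U, fun _ => ⟨h1, h2⟩, fun _ _ h => h 0⟩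

theorem Cmg.mono {S T : Set (MulAut (FreeGroup ℕ))} (h : Cmg A S)
    (hST : ∀ x ∈ PS A, x ∈ S → x ∈ T) : Cmg A T := by
  obtain ⟨U, hU, hS⟩ := h
  exact ⟨U, hU, fun x hx hxU => hST x hx (hS x hx hxU)⟩

theorem Cmg.univ : Cmg A Set.univ := Cmg.of_open_dense (fun _ _ _ => ⟨0, fun _ _ _ => trivial⟩)
  (fun x hx _ => ⟨x, hx, trivial, fun _ _ => rfl⟩)

theorem Cmg.forall {ι : Type*} [Countable ι] {S : ι → Set (MulAut (FreeGroup ℕ))}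
    (h : ∀ i, Cmg A (S i)) : Cmg A {x | ∀ i, x ∈ S i} := by
  rcases isEmpty_or_nonempty ι with hι | hι
  · exact Cmg.univ.mono fun x _ _ i => isEmptyElim i
  obtain ⟨f, hf⟩ := exists_surjective_nat ι
  choose U hU hS using h
  refine ⟨fun j => U (f j.unpair.1) j.unpair.2, fun j => hU _ _, fun x hx hxU i => ?_⟩
  obtain ⟨a, rfl⟩ := hf i
  refine hS _ x hx fun j => ?_
  have := hxU (Nat.pair a j)
  beta_reduce at this
  rwa [Nat.unpair_pair] at this

theorem Cmg.and {S T : Set (MulAut (FreeGroup ℕ))} (hS : Cmg A S) (hT : Cmg A T) :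
    Cmg A {x | x ∈ S ∧ x ∈ T} := by
  refine (Cmg.forall (ι := Bool) (S := fun b => if b then S else T) fun b => ?_).mono
    fun x _ hx => ⟨by simpa using hx true, by simpa using hx false⟩
  cases b
  · simpa using hT
  · simpa using hS

theorem Cmg.translate {S : Set (MulAut (FreeGroup ℕ))} (hS : Cmg A S)
    {γ : MulAut (FreeGroup ℕ)} (hγ : γ ∈ PS A) : Cmg A {x | γ * x ∈ S} := by
  obtain ⟨U, hU, h⟩ := hS
  refine ⟨fun j => {x | γ * x ∈ U j}, fun j => ⟨?_, ?_⟩, fun x hx hxU => h _ (mul_mem hγ hx) hxU⟩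
  · intro x hx hxU
    obtain ⟨m, hm⟩ := (hU j).1 _ (mul_mem hγ hx) hxU
    exact ⟨m, fun x' hx' e => hm _ (mul_mem hγ hx') fun w hw => by
      rw [MulAut.mul_apply, MulAut.mul_apply, e w hw]⟩
  · intro x hx m
    obtain ⟨y, hy, hyU, e⟩ := (hU j).2 _ (mul_mem hγ hx) m
    refine ⟨γ⁻¹ * y, mul_mem (inv_mem hγ) hy, by simpa using hyU, fun w hw => ?_⟩
    rw [MulAut.mul_apply, e w hw, MulAut.mul_apply, MulAut.inv_apply_self]

/-- Baire category for `PS A`. -/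
theorem Cmg.nonempty {S : Set (MulAut (FreeGroup ℕ))} (hS : Cmg A S) : ∃ x ∈ PS A, x ∈ S := by
  obtain ⟨U, hU, h⟩ := hS
  have hstep : ∀ (n : ℕ) (p : PS A × ℕ), ∃ p' : PS A × ℕ, p.2 ≤ p'.2 ∧ n ≤ p'.2 ∧
      Fn n ≤ (p'.1 : MulAut (FreeGroup ℕ)) • Fn p'.2 ∧
      (∀ w ∈ Fn p.2, (p'.1 : MulAut (FreeGroup ℕ)) w = (p.1 : MulAut (FreeGroup ℕ)) w) ∧
      ∀ x' ∈ PS A, (∀ w ∈ Fn p'.2, x' w = (p'.1 : MulAut (FreeGroup ℕ)) w) → x' ∈ U n := by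
    rintro n ⟨⟨x, hx⟩, m⟩
    obtain ⟨x', hx', hx'U, e⟩ := (hU n).2 x hx m
    obtain ⟨m', hm'⟩ := (hU n).1 x' hx' hx'U
    obtain ⟨N, hN, hN'⟩ := exists_smul_Fn_le [x'⁻¹] n (max (max m m') n)
    refine ⟨⟨⟨x', hx'⟩, N⟩, by simp at hN ⊢; omega, by simp at hN ⊢; omega, ?_, e, ?_⟩
    · intro w hw
      rw [mem_smul_iff]
      exact smul_le_iff.1 (hN' _ (by simp)) w hw
    · intro y hy hyx
      exact hm' y hy fun w hw => hyx w (Fn_mono (by simp at hN ⊢; omega) hw)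
  choose f hf using hstep
  let s : ℕ → PS A × ℕ := fun n => Nat.rec (1, 0) f n
  have hs : ∀ n, s (n + 1) = f n (s n) := fun n => rfl
  obtain ⟨G, hG⟩ := exists_limit_chain (fun n => Fn (s (n + 1)).2)
    (fun n => ((s (n + 1)).1 : MulAut (FreeGroup ℕ)))
    (fun n => by rw [hs (n + 1)]; exact Fn_mono (hf _ _).1)
    (fun n => by rw [hs (n + 1)]; exact (hf _ _).2.2.2.1)
    (fun n => by rw [hs n]; exact Fn_mono (hf _ _).2.1)
    (fun n => by rw [hs n]; exact (hf _ _).2.2.1)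
  have hGA : G ∈ PS A := by
    intro a ha
    obtain ⟨n, hn⟩ := exists_mem_Fn a
    rw [hG n a (Fn_mono (hf n (s n)).2.1 hn)]
    exact (s (n + 1)).1.2 a ha
  exact ⟨G, hGA, h G hGA fun j => (hf j (s j)).2.2.2.2 G hGA (hG j)⟩

theorem Cmg.exists_mem_coset {S : Set (MulAut (FreeGroup ℕ))} (hS : Cmg A S)
    {H : Subgroup (MulAut (FreeGroup ℕ))} (hH : Countable (MulAut (FreeGroup ℕ) ⧸ H))
    {γ : MulAut (FreeGroup ℕ)} (hγ : γ ∈ PS A) : ∃ h ∈ H, h ∈ PS A ∧ γ * h ∈ S := by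
  classical
  let c : MulAut (FreeGroup ℕ) ⧸ H → PS A := fun q =>
    if h : ∃ c : PS A, ((c : MulAut (FreeGroup ℕ)) : MulAut (FreeGroup ℕ) ⧸ H) = q
      then h.choose else 1
  obtain ⟨x, hx, hxS⟩ := (Cmg.forall fun q => hS.translate
    (mul_mem hγ (inv_mem (c q).2))).nonempty
  refine ⟨(c x)⁻¹ * x, ?_, mul_mem (inv_mem (c x).2) hx, ?_⟩
  · have h : ∃ c : PS A, ((c : MulAut (FreeGroup ℕ)) : MulAut (FreeGroup ℕ) ⧸ H) = x :=
      ⟨⟨x, hx⟩, rfl⟩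
    have hc : (((c x : PS A) : MulAut (FreeGroup ℕ)) : MulAut (FreeGroup ℕ) ⧸ H) = x := by
      simp only [c, dif_pos h]; exact h.choose_spec
    exact QuotientGroup.eq.1 hc
  · have := hxS x
    rw [Set.mem_ofPred_eq, mul_assoc] at this
    exact this

/-! ### Amalgamation of free factors -/

theorem exists_shift_perm (k m t : ℕ) (h : m ≤ t) : ∃ e : Equiv.Perm ℕ,
    (∀ i < k, e i = i) ∧ (∀ i, k ≤ i → i < m → e i = i + t) ∧
      ∀ i, m ≤ i → i < k + t → e i = i := by
  let f : ℕ → ℕ := fun i => if k ≤ i ∧ i < m then i + t else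
    if k + t ≤ i ∧ i < m + t then i - t else i
  have hf : Function.Involutive f := by
    intro i
    simp only [f]
    split_ifs <;> omega
  refine ⟨hf.toPerm, fun i hi => ?_, fun i h1 h2 => ?_, fun i h1 h2 => ?_⟩
  · simp only [Function.Involutive.coe_toPerm, f]
    split_ifs <;> omega
  · simp only [Function.Involutive.coe_toPerm, f]
    rw [if_pos ⟨h1, h2⟩]
  · simp only [Function.Involutive.coe_toPerm, f]
    split_ifs <;> omega

theorem exists_amalgam {B B₁ B₂ : Subgroup (FreeGroup ℕ)} (hB : IsFF B) (hB₁ : IsFF B₁)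
    (hB₂ : IsFF B₂) (h1 : B ≤ B₁) (h2 : B ≤ B₂) :
    ∃ τ ∈ PS B, ∃ B₃, IsFF B₃ ∧ B₂ ≤ B₃ ∧ τ • B₁ ≤ B₃ ∧
      ∀ α β : MulAut (FreeGroup ℕ), α • B₂ = B₂ → β • B₁ = B₁ → α • B = B →
        (∀ w ∈ B, α w = β w) → ∃ ω : MulAut (FreeGroup ℕ), ω • B₃ = B₃ ∧ (∀ w ∈ B₂, ω w = α w) ∧
          ∀ w ∈ B₁, ω (τ w) = τ (β w) := by
  obtain ⟨τ₀, k, rfl⟩ := hB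
  obtain ⟨σ₁, m₁, hk₁, e₁, rfl⟩ := hB₁.exists_adapted h1
  obtain ⟨σ₂, m₂, hk₂, e₂, rfl⟩ := hB₂.exists_adapted h2
  rw [← smul_eq_of_eqOn e₁] at h1 h2 ⊢
  have e12 : ∀ w ∈ Fn k, σ₂ w = σ₁ w := fun w hw => by rw [e₁ w hw, e₂ w hw]
  clear e₁ e₂ τ₀
  obtain ⟨e, he1, he2, -⟩ := exists_shift_perm k m₁ (m₁ + m₂) (by omega)
  have hCD : Set.Iio m₂ ∩ e '' Set.Iio m₁ = Set.Iio k := by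
    ext i
    simp only [Set.mem_inter_iff, Set.mem_Iio, Set.mem_image]
    constructor
    · rintro ⟨hi, j, hj, rfl⟩
      by_contra hc
      by_cases hjk : j < k
      · rw [he1 j hjk] at hc; omega
      · rw [he2 j (by omega) hj] at hi; omega
    · intro hi
      exact ⟨by omega, i, by omega, he1 i hi⟩
  have hD : e '' Set.Iio m₁ ⊆ Set.Iio (m₁ + (m₁ + m₂)) := by
    rintro _ ⟨j, hj, rfl⟩
    have hj := Set.mem_Iio.1 hj
    refine Set.mem_Iio.2 ?_
    by_cases hjk : j < k
    · rw [he1 j hjk]; omega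
    · rw [he2 j (by omega) hj]; omega
  have hp : permAut e ∈ PS (Fn k) := permAut_mem_PS fun i hi => he1 i hi
  refine ⟨σ₂ * permAut e * σ₁⁻¹, ?_, σ₂ • Fn (m₁ + (m₁ + m₂)), (isFF_Fn _).smul _,
    Subgroup.pointwise_smul_le_pointwise_smul_iff.2 (Fn_mono (by omega)), ?_, ?_⟩
  · intro w hw
    rw [MulAut.mul_apply, MulAut.mul_apply, hp _ (mem_smul_iff.1 hw), e12 _ (mem_smul_iff.1 hw),
      MulAut.apply_inv_self]
  · rw [mul_smul, mul_smul, inv_smul_smul, permAut_smul_FC]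
    exact Subgroup.pointwise_smul_le_pointwise_smul_iff.2 (FC_mono hD)
  intro α β hα hβ hαB hαβ
  have hα' : (σ₂⁻¹ * α * σ₂) • Fn m₂ = Fn m₂ := by
    rw [mul_smul, mul_smul, hα, inv_smul_smul]
  have hβ' : (permAut e * σ₁⁻¹ * β * σ₁ * (permAut e)⁻¹) • FC (e '' Set.Iio m₁) =
      FC (e '' Set.Iio m₁) := by
    rw [← permAut_smul_FC, mul_smul, inv_smul_smul, mul_smul, mul_smul, hβ, mul_smul, inv_smul_smul]
  obtain ⟨ω, hω1, hω2, hω3⟩ := exists_glue hα' hβ' (by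
      rw [hCD, mul_smul, mul_smul, smul_eq_of_eqOn e12, hαB, ← smul_eq_of_eqOn e12, inv_smul_smul])
    (by
      rw [hCD]
      intro w hw
      have hw1 : σ₁ w ∈ σ₁ • Fn k := apply_mem_smul_iff.2 hw
      have hv : σ₁⁻¹ (β (σ₁ w)) ∈ Fn k := by
        rw [← hαβ _ hw1]
        exact mem_smul_iff.1 (apply_mem_of_smul_eq hαB hw1)
      have hpw : (permAut e)⁻¹ w = w := inv_mem hp w hw
      simp only [MulAut.mul_apply]
      rw [hpw, e12 w hw, hp _ hv, hαβ _ hw1]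
      have := e12 _ hv
      rw [MulAut.apply_inv_self] at this
      conv_lhs => rw [← this]
      rw [MulAut.inv_apply_self])
  have hC : ω • Fn m₂ = Fn m₂ := by rw [smul_eq_of_eqOn hω1, hα']
  have hD' : ω • FC (e '' Set.Iio m₁) = FC (e '' Set.Iio m₁) := by rw [smul_eq_of_eqOn hω2, hβ']
  have hCle : Fn m₂ ≤ Fn (m₁ + (m₁ + m₂)) := Fn_mono (by omega)
  have hωB : ω • Fn (m₁ + (m₁ + m₂)) = Fn (m₁ + (m₁ + m₂)) := by
    apply le_antisymm
    · refine smul_FC_le.2 fun i hi => ?_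
      by_cases h1 : i ∈ Set.Iio m₂
      · exact hCle (apply_mem_of_smul_eq hC (of_mem_FC h1))
      by_cases h2 : i ∈ e '' Set.Iio m₁
      · exact FC_mono hD (apply_mem_of_smul_eq hD' (of_mem_FC h2))
      rw [hω3 i h1 h2]; exact of_mem_FC hi
    · refine FC_le.2 fun i hi => mem_smul_iff.2 ?_
      by_cases h1 : i ∈ Set.Iio m₂
      · exact hCle (inv_apply_mem_of_smul_eq hC (of_mem_FC h1))
      by_cases h2 : i ∈ e '' Set.Iio m₁
      · exact FC_mono hD (inv_apply_mem_of_smul_eq hD' (of_mem_FC h2))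
      have : ω⁻¹ (of i) = of i := by
        conv_lhs => rw [← hω3 i h1 h2]
        rw [MulAut.inv_apply_self]
      rw [this]; exact of_mem_FC hi
  refine ⟨σ₂ * ω * σ₂⁻¹, ?_, fun w hw => ?_, fun w hw => ?_⟩
  · rw [mul_smul, inv_smul_smul, mul_smul, hωB]
  · rw [MulAut.mul_apply, MulAut.mul_apply, hω1 _ (mem_smul_iff.1 hw), MulAut.mul_apply,
      MulAut.mul_apply, MulAut.apply_inv_self, MulAut.apply_inv_self]
  · have hv : permAut e (σ₁⁻¹ w) ∈ FC (e '' Set.Iio m₁) := by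
      rw [← permAut_smul_FC]
      exact apply_mem_smul_iff.2 (mem_smul_iff.1 hw)
    simp only [MulAut.mul_apply, MulAut.inv_apply_self]
    rw [hω2 _ hv]
    simp only [MulAut.mul_apply, MulAut.inv_apply_self, MulAut.apply_inv_self]

/-- Approximation of an automorphism by one preserving a free factor invariant under a
generic tuple. -/
theorem Gen.exists_approx {k : ℕ} {z : ℕ → MulAut (FreeGroup ℕ)} (hz : Gen k z)
    (x : MulAut (FreeGroup ℕ)) (m : ℕ) : ∃ B, IsFF B ∧ Fn m ≤ B ∧ (∀ i < k, z i • B = B) ∧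
      ∃ x' : MulAut (FreeGroup ℕ), x' • B = B ∧ ∀ w ∈ Fn m, x' w = x w := by
  obtain ⟨N, hN, hxN⟩ := exists_smul_Fn_le [x] m m
  obtain ⟨B, hB, hNB, hinv⟩ := hz.cof N
  have hmB : Fn m ≤ B := (Fn_mono hN).trans hNB
  obtain ⟨σ₁, M₁, -, e₁, h₁⟩ := hB.exists_adapted (σ := 1) (k := m) (by rwa [one_smul])
  obtain ⟨σ₂, M₂, -, e₂, h₂⟩ := hB.exists_adapted (σ := x) (k := m)
    ((hxN x (by simp)).trans hNB)
  have hM : M₁ = M₂ := rank_eq (g := σ₂⁻¹ * σ₁) (by rw [mul_smul, h₁, ← h₂, inv_smul_smul])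
  subst hM
  refine ⟨B, hB, hmB, hinv, σ₂ * σ₁⁻¹, ?_, fun w hw => ?_⟩
  · rw [mul_smul]
    conv_lhs => rw [← h₁]
    rw [inv_smul_smul, h₂]
  · have : σ₁ w = w := e₁ w hw
    rw [MulAut.mul_apply, ← e₂ w hw]
    conv_lhs => rw [← this]
    rw [MulAut.inv_apply_self]

/-! ### Generic one-point extensions of generic tuples -/

theorem countable_isFF : Countable {B : Subgroup (FreeGroup ℕ) // IsFF B} := by
  have : {B : Subgroup (FreeGroup ℕ) | IsFF B} ⊆
      Set.range fun s : Finset (FreeGroup ℕ) => Subgroup.closure (s : Set (FreeGroup ℕ)) := by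
    rintro _ ⟨σ, n, rfl⟩
    refine ⟨(Finset.range n).image fun i => σ (of i), ?_⟩
    apply le_antisymm
    · rw [Subgroup.closure_le]
      intro w hw
      simp only [Finset.coe_image, Finset.coe_range, Set.mem_image, Set.mem_Iio] at hw
      obtain ⟨i, hi, rfl⟩ := hw
      exact apply_mem_smul_iff.2 (of_mem_Fn hi)
    · refine smul_FC_le.2 fun i hi => Subgroup.subset_closure ?_
      simp only [Finset.coe_image, Finset.coe_range]
      exact ⟨i, hi, rfl⟩
  exact ((Set.countable_range _).mono this).to_subtype

variable {k : ℕ} {z : ℕ → MulAut (FreeGroup ℕ)} {A : Subgroup (FreeGroup ℕ)}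

theorem Gen.cmg_cof (hz : Gen k z) (hA : IsFF A) (n : ℕ) :
    Cmg A {x | ∃ B, IsFF B ∧ Fn n ≤ B ∧ (∀ i < k, z i • B = B) ∧ x • B = B} := by
  refine Cmg.of_open_dense ?_ ?_
  · rintro x - ⟨B, hB, hn, hinv, hxB⟩
    obtain ⟨m, -, hm⟩ := hB.exists_le_Fn 0
    exact ⟨m, fun x' _ e => ⟨B, hB, hn, hinv,
      by rw [smul_eq_of_eqOn fun w hw => e w (hm hw), hxB]⟩⟩
  · intro x hx m
    obtain ⟨m', hm', hAm⟩ := hA.exists_le_Fn (max m n)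
    obtain ⟨B, hB, hmB, hinv, x', hx'B, e⟩ := hz.exists_approx x m'
    exact ⟨x', fun a ha => by rw [e a (hAm ha), hx a ha],
      ⟨B, hB, (Fn_mono (le_of_max_le_right hm')).trans hmB, hinv, hx'B⟩,
      fun w hw => e w (Fn_mono (le_of_max_le_left hm') hw)⟩

theorem Gen.cmg_ext (hz : Gen k z) (hA : IsFF A) {B B₁ : Subgroup (FreeGroup ℕ)} (hB : IsFF B)
    (hB₁ : IsFF B₁) (hle : B ≤ B₁) (hinv : ∀ i < k, z i • B = B) {h : ℕ → MulAut (FreeGroup ℕ)}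
    (hB₁h : ∀ i < k, h i • B₁ = B₁) (hkB₁ : h k • B₁ = B₁) (hkB : h k • B = B)
    (hhz : ∀ i < k, ∀ w ∈ B, h i w = z i w) :
    Cmg A {x | (∀ w ∈ B, x w = h k w) → ∃ σ ∈ PS B,
      (∀ i < k, ∀ w ∈ B₁, z i (σ w) = σ (h i w)) ∧ ∀ w ∈ B₁, x (σ w) = σ (h k w)} := by
  refine Cmg.of_open_dense ?_ ?_
  · intro x _ hxU
    rw [Set.mem_ofPred_eq] at hxU
    by_cases hQ : ∀ w ∈ B, x w = h k w
    · obtain ⟨σ, hσ, h1, h2⟩ := hxU hQ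
      obtain ⟨m, -, hm⟩ := (hB₁.smul σ).exists_le_Fn 0
      exact ⟨m, fun x' _ e _ => ⟨σ, hσ, h1, fun w hw => by
        rw [e _ (hm (apply_mem_smul_iff.2 hw)), h2 w hw]⟩⟩
    · obtain ⟨m, -, hm⟩ := hB.exists_le_Fn 0
      exact ⟨m, fun x' _ e hx' => absurd (fun w hw => by rw [← e w (hm hw), hx' w hw]) hQ⟩
  · intro x₀ hx₀ m
    by_cases hQ : ∀ w ∈ B, x₀ w = h k w
    swap
    · exact ⟨x₀, hx₀, fun hc => absurd hc hQ, fun _ _ => rfl⟩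
    obtain ⟨m₁, hm₁, hAm⟩ := hA.exists_le_Fn m
    obtain ⟨m', hm', hBm⟩ := hB.exists_le_Fn m₁
    replace hAm := hAm.trans (Fn_mono hm')
    obtain ⟨B₂, hB₂, hmB, hinv₂, x', hx'B, e⟩ := hz.exists_approx x₀ m'
    obtain ⟨τ, hτ, B₃, hB₃, h23, h13, hω⟩ := exists_amalgam hB hB₁ hB₂ hle (hBm.trans hmB)
    have hx'B' : ∀ w ∈ B, x' w = h k w := fun w hw => by rw [e w (hBm hw), hQ w hw]
    obtain ⟨ωx, hωx, hωx2, hωx1⟩ := hω x' (h k) hx'B hkB₁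
      (by rw [smul_eq_of_eqOn hx'B', hkB]) hx'B'
    have hωi : ∀ i, ∃ ω : MulAut (FreeGroup ℕ), i < k → ω • B₃ = B₃ ∧ (∀ w ∈ B₂, ω w = z i w) ∧
          ∀ w ∈ B₁, ω (τ w) = τ (h i w) := by
      intro i
      by_cases hi : i < k
      · obtain ⟨ω, hh⟩ := hω (z i) (h i) (hinv₂ i hi) (hB₁h i hi) (hinv i hi)
          fun w hw => (hhz i hi w hw).symm
        exact ⟨ω, fun _ => hh⟩
      · exact ⟨1, fun hc => absurd hc hi⟩
    choose ω hω using hωi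
    obtain ⟨σ, hσ, hσz⟩ := hz.ext B₂ B₃ hB₂ hB₃ h23 hinv₂ ω (fun i hi => (hω i hi).1)
      (fun i hi => (hω i hi).2.1)
    have hxm : ∀ w ∈ Fn m', (σ * ωx * σ⁻¹) w = x₀ w := by
      intro w hw
      have h3 := inv_mem hσ w (hmB hw)
      rw [MulAut.mul_apply, MulAut.mul_apply, h3, hωx2 w (hmB hw),
        hσ _ (apply_mem_of_smul_eq hx'B (hmB hw)), e w hw]
    refine ⟨σ * ωx * σ⁻¹, fun a ha => by rw [hxm a (hAm ha), hx₀ a ha], fun _ =>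
      ⟨σ * τ, mul_mem (PS_anti (hBm.trans hmB) hσ) hτ, fun i hi w hw => ?_, fun w hw => ?_⟩,
      fun w hw => hxm w (Fn_mono (hm₁.trans hm') hw)⟩
    · rw [MulAut.mul_apply, hσz i hi _ (h13 (apply_mem_smul_iff.2 hw)), (hω i hi).2.2 w hw,
        MulAut.mul_apply]
    · rw [MulAut.mul_apply, MulAut.mul_apply, MulAut.mul_apply, MulAut.inv_apply_self,
        hωx1 w hw, MulAut.mul_apply]

theorem Gen.cmg_extend (hz : Gen k z) (hA : IsFF A) :
    Cmg A {x | Gen (k + 1) (Function.update z k x)} := by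
  have hlt : ∀ (x : MulAut (FreeGroup ℕ)) (i : ℕ), i < k → Function.update z k x i = z i :=
    fun x i hi => Function.update_of_ne hi.ne _ _
  have hself : ∀ x : MulAut (FreeGroup ℕ), Function.update z k x k = x :=
    fun x => Function.update_self _ _ _
  have := countable_isFF
  have key : Cmg A {x | ∀ q : {B : Subgroup (FreeGroup ℕ) // IsFF B} ×
      {B : Subgroup (FreeGroup ℕ) // IsFF B}, x ∈ {x | q.1.1 ≤ q.2.1 →
      (∀ i < k, z i • q.1.1 = q.1.1) → x • q.1.1 = q.1.1 → ∀ h : ℕ → MulAut (FreeGroup ℕ),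
      (∀ i < k, h i • q.2.1 = q.2.1) → h k • q.2.1 = q.2.1 →
      (∀ i < k, ∀ w ∈ q.1.1, h i w = z i w) → (∀ w ∈ q.1.1, x w = h k w) →
      ∃ σ ∈ PS q.1.1, (∀ i < k, ∀ w ∈ q.2.1, z i (σ w) = σ (h i w)) ∧
        ∀ w ∈ q.2.1, x (σ w) = σ (h k w)}} := by
    refine Cmg.forall ?_
    rintro ⟨⟨B, hB⟩, ⟨B₁, hB₁⟩⟩
    have hB₁' := hB₁
    obtain ⟨ρ, n, rfl⟩ := hB₁'
    let r : (ℕ → MulAut (FreeGroup ℕ)) → (Fin (k + 1) → Fin n → FreeGroup ℕ) :=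
      fun h i j => h i (ρ (of j))
    refine (Cmg.forall (ι := Set.range r) (S := fun c => {x | B ≤ ρ • Fn n →
      (∀ i < k, z i • B = B) →
      (∀ i < k, Set.rangeSplitting r c i • ρ • Fn n = ρ • Fn n) →
      Set.rangeSplitting r c k • ρ • Fn n = ρ • Fn n → Set.rangeSplitting r c k • B = B →
      (∀ i < k, ∀ w ∈ B, Set.rangeSplitting r c i w = z i w) →
      (∀ w ∈ B, x w = Set.rangeSplitting r c k w) → ∃ σ ∈ PS B,
      (∀ i < k, ∀ w ∈ ρ • Fn n, z i (σ w) = σ (Set.rangeSplitting r c i w)) ∧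
      ∀ w ∈ ρ • Fn n, x (σ w) = σ (Set.rangeSplitting r c k w)}) fun c => ?_).mono ?_
    · by_cases hst : B ≤ ρ • Fn n ∧ (∀ i < k, z i • B = B) ∧
        (∀ i < k, Set.rangeSplitting r c i • ρ • Fn n = ρ • Fn n) ∧
        Set.rangeSplitting r c k • ρ • Fn n = ρ • Fn n ∧ Set.rangeSplitting r c k • B = B ∧
        ∀ i < k, ∀ w ∈ B, Set.rangeSplitting r c i w = z i w
      · obtain ⟨h1, h2, h3, h4, h5, h6⟩ := hst
        exact (hz.cmg_ext hA hB hB₁ h1 h2 h3 h4 h5 h6).mono fun x _ hx _ _ _ _ _ _ => hx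
      · exact Cmg.univ.mono fun x _ _ h1 h2 h3 h4 h5 h6 => absurd ⟨h1, h2, h3, h4, h5, h6⟩ hst
    · intro x _ hx hle hinv hxB h h3 h4 h6 h7
      have e : ∀ i < k + 1, ∀ w ∈ ρ • Fn n,
          Set.rangeSplitting r ⟨r h, h, rfl⟩ i w = h i w := by
        intro i hi w hw
        have hr := Set.apply_rangeSplitting r ⟨r h, h, rfl⟩
        have := aut_eqOn (f := Set.rangeSplitting r ⟨r h, h, rfl⟩ i * ρ) (g := h i * ρ)
          (C := Set.Iio n) (fun j hj => congrFun (congrFun hr ⟨i, hi⟩) ⟨j, hj⟩) (mem_smul_iff.1 hw)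
        rwa [MulAut.mul_apply, MulAut.mul_apply, MulAut.apply_inv_self] at this
      have ek := e k (by omega)
      have ei : ∀ i < k, ∀ w ∈ ρ • Fn n, Set.rangeSplitting r ⟨r h, h, rfl⟩ i w = h i w :=
        fun i hi => e i (by omega)
      obtain ⟨σ, hσ, h8, h9⟩ := hx ⟨r h, h, rfl⟩ hle hinv
        (fun i hi => by rw [smul_eq_of_eqOn (ei i hi), h3 i hi])
        (by rw [smul_eq_of_eqOn ek, h4])
        (by rw [smul_eq_of_eqOn fun w hw => (ek w (hle hw)).trans (h7 w hw).symm, hxB])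
        (fun i hi w hw => by rw [ei i hi w (hle hw), h6 i hi w hw])
        (fun w hw => by rw [ek w (hle hw), h7 w hw])
      exact ⟨σ, hσ, fun i hi w hw => by rw [h8 i hi w hw, ei i hi w hw],
        fun w hw => by rw [h9 w hw, ek w hw]⟩
  refine ((Cmg.forall fun n => hz.cmg_cof hA n).and key).mono ?_
  rintro x - ⟨hx1, hx2⟩
  refine ⟨fun n => ?_, fun B B₁ hB hB₁ hle hinv h h1 h2 => ?_⟩
  · obtain ⟨B, hB, hn, hinv, hxB⟩ := hx1 n
    refine ⟨B, hB, hn, fun i hi => ?_⟩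
    rcases Nat.lt_succ_iff_lt_or_eq.1 hi with hi | rfl
    · rw [hlt x i hi, hinv i hi]
    · rw [hself, hxB]
  · have hk := hinv k (by omega)
    have h2k := h2 k (by omega)
    rw [hself] at hk
    simp only [hself] at h2k
    obtain ⟨σ, hσ, h3, h4⟩ := hx2 ⟨⟨B, hB⟩, ⟨B₁, hB₁⟩⟩ hle
      (fun i hi => by rw [← hlt x i hi]; exact hinv i (by omega)) hk h
      (fun i hi => h1 i (by omega)) (h1 k (by omega))
      (fun i hi w hw => by rw [h2 i (by omega) w hw, hlt x i hi])
      (fun w hw => (h2k w hw).symm)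
    refine ⟨σ, hσ, fun i hi w hw => ?_⟩
    rcases Nat.lt_succ_iff_lt_or_eq.1 hi with hi | rfl
    · rw [hlt x i hi]; exact h3 i hi w hw
    · rw [hself]; exact h4 w hw

/-! ### The small index property -/

theorem exists_tree_step {H : Subgroup (MulAut (FreeGroup ℕ))}
    (hH : Countable (MulAut (FreeGroup ℕ) ⧸ H)) (hn : ∀ n, ¬ PS (Fn n) ≤ H) (n : ℕ)
    {k : ℕ} {z : ℕ → MulAut (FreeGroup ℕ)} (hz : Gen k z) {A : Subgroup (FreeGroup ℕ)}
    (hA : IsFF A) (L : List (MulAut (FreeGroup ℕ))) :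
    ∃ (A' : Subgroup (FreeGroup ℕ)) (x y κ : MulAut (FreeGroup ℕ)), IsFF A' ∧ A ≤ A' ∧
      Fn n ≤ A' ∧ (∀ p ∈ L, p⁻¹ • Fn n ≤ A') ∧ x ∈ H ∧ y ∉ H ∧ κ ∈ PS A' ∧ κ * x = y * κ ∧
      (∀ i < k, κ * z i = z i * κ) ∧
      Gen (k + 2) (Function.update (Function.update z k x) (k + 1) y) := by
  obtain ⟨m₁, hm₁, hAm⟩ := hA.exists_le_Fn n
  obtain ⟨N, hN, hLN⟩ := exists_smul_Fn_le (L.map (·⁻¹)) n m₁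
  obtain ⟨A', hA', hNA', hinv⟩ := hz.cof N
  obtain ⟨M, -, hM⟩ := hA'.exists_le_Fn 0
  obtain ⟨y₀, hy₀, hy₀H⟩ := Set.not_subset.1 (hn M)
  obtain ⟨x, hxH, hxA, hx⟩ := (hz.cmg_extend hA').exists_mem_coset hH (one_mem _)
  rw [one_mul] at hx
  obtain ⟨h, hhH, hhA, hy⟩ := ((hz.cmg_extend hA').and (hx.cmg_extend hA')).exists_mem_coset hH
    (PS_anti hM hy₀)
  have hyA : y₀ * h ∈ PS A' := mul_mem (PS_anti hM hy₀) hhA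
  have hlt : ∀ (x : MulAut (FreeGroup ℕ)) (i : ℕ), i < k → Function.update z k x i = z i :=
    fun x i hi => Function.update_of_ne hi.ne _ _
  obtain ⟨κ, hκA, hκ⟩ := hx.exists_conj hy.1 hA'
    (fun i hi => by
      rcases Nat.lt_succ_iff_lt_or_eq.1 hi with hi | rfl
      · rw [hlt _ i hi, hinv i hi]
      · rw [Function.update_self, smul_eq_of_mem_PS hxA])
    (fun i hi w hw => by
      rcases Nat.lt_succ_iff_lt_or_eq.1 hi with hi | rfl
      · rw [hlt _ i hi, hlt _ i hi]
      · rw [Function.update_self, Function.update_self, hxA w hw, hyA w hw])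
  refine ⟨A', x, y₀ * h, κ, hA', (hAm.trans (Fn_mono hN)).trans hNA',
    (Fn_mono (hm₁.trans hN)).trans hNA', fun p hp => (hLN _ (List.mem_map_of_mem hp)).trans hNA',
    hxH, fun hc => hy₀H ((Subgroup.mul_mem_cancel_right H hhH).1 hc), hκA, ?_, fun i hi => ?_, hy.2⟩
  · simpa only [Function.update_self] using hκ k (by omega)
  · simpa only [hlt _ i hi] using hκ i (by omega)

theorem exists_tree {H : Subgroup (MulAut (FreeGroup ℕ))}
    (hH : Countable (MulAut (FreeGroup ℕ) ⧸ H)) (hn : ∀ n, ¬ PS (Fn n) ≤ H) :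
    ∃ (A : ℕ → Subgroup (FreeGroup ℕ)) (x y κ : ℕ → MulAut (FreeGroup ℕ))
      (L : ℕ → List (MulAut (FreeGroup ℕ))), (∀ n, A n ≤ A (n + 1)) ∧ (∀ n, Fn n ≤ A n) ∧
      (∀ n, ∀ p ∈ L n, p⁻¹ • Fn n ≤ A n) ∧ (∀ n, x n ∈ H) ∧ (∀ n, y n ∉ H) ∧
      (∀ n, κ n ∈ PS (A n)) ∧ (∀ n, κ n * x n = y n * κ n) ∧
      (∀ n, ∀ j < n, κ n * x j = x j * κ n ∧ κ n * y j = y j * κ n) ∧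
      1 ∈ L 0 ∧ ∀ n, ∀ p ∈ L n, p ∈ L (n + 1) ∧ p * κ n ∈ L (n + 1) := by
  have hstep : ∀ (n : ℕ) (z : ℕ → MulAut (FreeGroup ℕ)) (A : Subgroup (FreeGroup ℕ))
      (L : List (MulAut (FreeGroup ℕ))), ∃ (A' : Subgroup (FreeGroup ℕ))
      (x y κ : MulAut (FreeGroup ℕ)), Gen (2 * n) z → IsFF A → IsFF A' ∧ A ≤ A' ∧
      Fn n ≤ A' ∧ (∀ p ∈ L, p⁻¹ • Fn n ≤ A') ∧ x ∈ H ∧ y ∉ H ∧ κ ∈ PS A' ∧ κ * x = y * κ ∧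
      (∀ i < 2 * n, κ * z i = z i * κ) ∧
      Gen (2 * n + 2) (Function.update (Function.update z (2 * n) x) (2 * n + 1) y) := by
    intro n z A L
    by_cases h : Gen (2 * n) z ∧ IsFF A
    · obtain ⟨A', x, y, κ, hh⟩ := exists_tree_step hH hn n h.1 h.2 L
      exact ⟨A', x, y, κ, fun _ _ => hh⟩
    · exact ⟨A, 1, 1, 1, fun h1 h2 => absurd ⟨h1, h2⟩ h⟩
  choose fA fx fy fκ hf using hstep
  let St := (ℕ → MulAut (FreeGroup ℕ)) × Subgroup (FreeGroup ℕ) × List (MulAut (FreeGroup ℕ))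
  let nx : ℕ → St → St := fun n s =>
    (Function.update (Function.update s.1 (2 * n) (fx n s.1 s.2.1 s.2.2)) (2 * n + 1)
      (fy n s.1 s.2.1 s.2.2), fA n s.1 s.2.1 s.2.2,
      s.2.2 ++ s.2.2.map (· * fκ n s.1 s.2.1 s.2.2))
  let s : ℕ → St := fun n => Nat.rec (1, Fn 0, [1]) nx n
  have hs : ∀ n, s (n + 1) = nx n (s n) := fun n => rfl
  have hgen : ∀ n, Gen (2 * n) (s n).1 ∧ IsFF (s n).2.1 := by
    intro n
    induction n with
    | zero => exact ⟨gen_zero _, isFF_Fn 0⟩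
    | succ n ih =>
      have := hf n _ _ (s n).2.2 ih.1 ih.2
      exact ⟨this.2.2.2.2.2.2.2.2.2, this.1⟩
  have hF := fun n => hf n (s n).1 (s n).2.1 (s n).2.2 (hgen n).1 (hgen n).2
  have hz : ∀ j n, j < n → (s n).1 (2 * j) = fx j (s j).1 (s j).2.1 (s j).2.2 ∧
      (s n).1 (2 * j + 1) = fy j (s j).1 (s j).2.1 (s j).2.2 := by
    intro j n hjn
    induction n, hjn using Nat.le_induction with
    | base =>
      rw [hs]
      simp only [nx]
      rw [Function.update_of_ne (by omega), Function.update_self, Function.update_self]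
      exact ⟨rfl, rfl⟩
    | succ n hn ih =>
      rw [hs]
      simp only [nx]
      rw [Function.update_of_ne (by omega), Function.update_of_ne (by omega),
        Function.update_of_ne (by omega), Function.update_of_ne (by omega)]
      exact ih
  refine ⟨fun n => fA n (s n).1 (s n).2.1 (s n).2.2, fun n => fx n (s n).1 (s n).2.1 (s n).2.2,
    fun n => fy n (s n).1 (s n).2.1 (s n).2.2, fun n => fκ n (s n).1 (s n).2.1 (s n).2.2,
    fun n => (s n).2.2, fun n => (hF (n + 1)).2.1, fun n => (hF n).2.2.1, fun n => (hF n).2.2.2.1,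
    fun n => (hF n).2.2.2.2.1, fun n => (hF n).2.2.2.2.2.1, fun n => (hF n).2.2.2.2.2.2.1,
    fun n => (hF n).2.2.2.2.2.2.2.1, fun n j hj => ?_, by simp [s], fun n p hp => ?_⟩
  · have h := (hF n).2.2.2.2.2.2.2.2.1
    have h1 := h (2 * j) (by omega)
    have h2 := h (2 * j + 1) (by omega)
    rw [(hz j n hj).1] at h1
    rw [(hz j n hj).2] at h2
    exact ⟨h1, h2⟩
  · constructor
    · exact List.mem_append_left _ hp
    · exact List.mem_append_right _ (List.mem_map.2 ⟨p, hp, rfl⟩)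

/-- The small index property of `Aut F`. -/
theorem exists_PS_le {H : Subgroup (MulAut (FreeGroup ℕ))}
    (hH : Countable (MulAut (FreeGroup ℕ) ⧸ H)) : ∃ n, PS (Fn n) ≤ H := by
  classical
  by_contra! hn
  obtain ⟨A, x, y, κ, L, hA, hFA, hLA, hx, hy, hκ, hκxy, hcomm, hL0, hL⟩ := exists_tree hH hn
  let p : Set ℕ → ℕ → MulAut (FreeGroup ℕ) := fun α n =>
    Nat.rec 1 (fun i q => if i ∈ α then q * κ i else q) n
  have hp : ∀ α n, p α (n + 1) = if n ∈ α then p α n * κ n else p α n := fun α n => rfl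
  have hpL : ∀ α n, p α n ∈ L n := by
    intro α n
    induction n with
    | zero => exact hL0
    | succ n ih =>
      rw [hp]
      split_ifs
      · exact (hL n _ ih).2
      · exact (hL n _ ih).1
  have hG : ∀ α, ∃ G : MulAut (FreeGroup ℕ), ∀ n, ∀ w ∈ A n, G w = p α n w := by
    intro α
    refine exists_limit_chain A (p α) hA (fun n w hw => ?_) hFA (fun n w hw => ?_)
    · rw [hp]
      split_ifs
      · rw [MulAut.mul_apply, hκ n w hw]
      · rfl
    · exact mem_smul_iff.2 (hLA n _ (hpL α n) (apply_mem_smul_iff.2 hw))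
  choose G hG using hG
  have hq : ∀ α n j, n < j → ∀ g, (∀ i, n < i → κ i * g = g * κ i) →
      (p α (n + 1))⁻¹ * p α j * g = g * ((p α (n + 1))⁻¹ * p α j) := by
    intro α n j hj g hg
    induction j, hj using Nat.le_induction with
    | base => simp
    | succ j hj ih =>
      rw [hp α j]
      split_ifs
      · rw [← mul_assoc, mul_assoc _ (κ j), hg j (by omega), ← mul_assoc, ih, mul_assoc g]
      · exact ih
  have ht : ∀ α n g, (∀ i, n < i → κ i * g = g * κ i) →
      (p α (n + 1))⁻¹ * G α * g = g * ((p α (n + 1))⁻¹ * G α) := by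
    intro α n g hg
    ext w
    obtain ⟨j, hj, hw⟩ := exists_Fn_of_finite (S := {w, g w}) (by simp) (n + 1)
    have h1 := hG α j w (hFA j (hw w (by simp)))
    have h2 := hG α j (g w) (hFA j (hw _ (by simp)))
    have := DFunLike.congr_fun (hq α n j hj g hg) w
    simp only [MulAut.mul_apply] at this ⊢
    rw [h1, h2, this]
  have key : ∀ α β n, (∀ i < n, i ∈ α ↔ i ∈ β) → n ∉ α → n ∈ β →
      ¬ (G α)⁻¹ * G β ∈ H := by
    intro α β n hlt hα hβ hmem
    have hpe : ∀ m ≤ n, p α m = p β m := by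
      intro m hm
      induction m with
      | zero => rfl
      | succ m ih => rw [hp, hp, ih (by omega)]; simp only [hlt m (by omega)]
    have hα' : p α (n + 1) = p α n := by rw [hp, if_neg hα]
    have hβ' : p β (n + 1) = p α n * κ n := by rw [hp, if_pos hβ, hpe n le_rfl]
    have htα := ht α n (y n) fun i hi => (hcomm i n hi).2
    have htβ := ht β n (x n) fun i hi => (hcomm i n hi).1
    have e1 : (G α)⁻¹ * G β = ((p α (n + 1))⁻¹ * G α)⁻¹ * κ n * ((p β (n + 1))⁻¹ * G β) := by
      rw [hα', hβ']; group
    have e2 : ((G α)⁻¹ * G β) * x n * ((G α)⁻¹ * G β)⁻¹ = y n := by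
      rw [e1]
      generalize (p α (n + 1))⁻¹ * G α = a at htα ⊢
      generalize (p β (n + 1))⁻¹ * G β = b at htβ ⊢
      calc a⁻¹ * κ n * b * x n * (a⁻¹ * κ n * b)⁻¹
          = a⁻¹ * κ n * (b * x n) * (a⁻¹ * κ n * b)⁻¹ := by group
        _ = a⁻¹ * (κ n * x n) * (κ n)⁻¹ * a := by rw [htβ]; group
        _ = a⁻¹ * (y n * a) := by rw [hκxy]; group
        _ = y n := by rw [← htα]; group
    apply hy n
    rw [← e2]
    exact mul_mem (mul_mem hmem (hx n)) (inv_mem hmem)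
  have hinj : Function.Injective fun α : Set ℕ => (G α : MulAut (FreeGroup ℕ) ⧸ H) := by
    intro α β hαβ
    have hmem : (G α)⁻¹ * G β ∈ H := QuotientGroup.eq.1 hαβ
    by_contra hne
    have hex : ∃ n, ¬ (n ∈ α ↔ n ∈ β) := by
      by_contra! hc
      exact hne (Set.ext hc)
    have h1 := Nat.find_spec hex
    have h2 : ∀ i < Nat.find hex, (i ∈ α ↔ i ∈ β) := fun i hi => not_not.1 (Nat.find_min hex hi)
    by_cases hα : Nat.find hex ∈ α
    · refine key β α _ (fun i hi => (h2 i hi).symm) (fun hβ => h1 ⟨fun _ => hβ, fun _ => hα⟩) hα ?_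
      have := inv_mem hmem
      rwa [mul_inv_rev, inv_inv] at this
    · exact key α β _ h2 hα (not_not.1 fun hβ => h1 ⟨fun h => absurd h hα, fun h => absurd h hβ⟩) hmem
  have : Countable (Set ℕ) := hinj.countable
  obtain ⟨f, hf⟩ := exists_injective_nat (Set ℕ)
  exact Function.cantor_injective f hf

/-! ### Commuting elements of free groups -/

theorem exists_zpow_of_commute {α : Type*} {i : α} {z : FreeGroup α} (h : Commute z (of i)) :
    z ∈ Subgroup.zpowers (of i) := by
  classical
  induction hn : z.norm using Nat.strong_induction_on generalizing z with
  | _ n ih =>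
  rcases hw : z.toWord with _ | ⟨⟨j, b⟩, L⟩
  · rw [FreeGroup.toWord_eq_nil_iff] at hw
    rw [hw]; exact one_mem _
  have hred : FreeGroup.IsReduced ((j, b) :: L) := hw ▸ FreeGroup.isReduced_toWord
  have hz : z = FreeGroup.mk [(j, b)] * FreeGroup.mk L := by
    rw [FreeGroup.mul_mk, List.singleton_append, ← hw, FreeGroup.mk_toWord]
  have hL : (FreeGroup.mk L).toWord = L := by
    rw [FreeGroup.toWord_mk]
    exact FreeGroup.IsReduced.reduce_eq (List.IsChain.tail hred)
  have hnL : n = L.length + 1 := by rw [← hn, FreeGroup.norm, hw, List.length_cons]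
  have hji : j = i := by
    by_contra hji
    have h1 : (of i * z).toWord = (i, true) :: (j, b) :: L := by
      rw [FreeGroup.toWord_mul, hw, FreeGroup.toWord_of]
      refine FreeGroup.IsReduced.reduce_eq ?_
      simp only [List.singleton_append]
      exact List.IsChain.cons_cons (fun e => absurd e.symm hji) hred
    have h2 : List.Sublist (z * of i).toWord ((j, b) :: (L ++ [(i, true)])) := by
      have := FreeGroup.toWord_mul_sublist z (of i)
      rwa [hw, FreeGroup.toWord_of] at this
    rw [h.eq, h1] at h2
    have h3 := h2.eq_of_length (by simp)
    exact hji (congrArg Prod.fst (List.cons.inj h3).1).symm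
  have hji' : FreeGroup.mk [(j, b)] ∈ Subgroup.zpowers (of i) := by
    rw [hji]
    cases b
    · exact inv_mem (Subgroup.mem_zpowers (of i))
    · exact Subgroup.mem_zpowers (of i)
  have hcomm : Commute (FreeGroup.mk [(j, b)]) (of i) := by
    obtain ⟨m, hm⟩ := hji'
    simp only at hm
    rw [← hm]
    exact Commute.zpow_self _ m
  rw [hz]
  refine mul_mem hji' (ih L.length (by omega) ?_ (by rw [FreeGroup.norm, hL]))
  have : FreeGroup.mk L = (FreeGroup.mk [(j, b)])⁻¹ * z := by rw [hz]; group
  rw [this]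
  exact (hcomm.inv_left).mul_left h

theorem zpowers_inf_zpowers {α : Type*} {i j : α} (hij : i ≠ j) {z : FreeGroup α}
    (hi : z ∈ Subgroup.zpowers (of i)) (hj : z ∈ Subgroup.zpowers (of j)) : z = 1 := by
  classical
  obtain ⟨m, rfl⟩ := hi
  obtain ⟨n, hn⟩ := hj
  simp only at hn ⊢
  have := congrArg (FreeGroup.lift fun a => if a = i then (of i : FreeGroup α) else 1) hn
  simpa [hij.symm] using this.symm

theorem commute_of_commute {k a b : FreeGroup ℕ} (hk : k ≠ 1) (ha : Commute k a)
    (hb : Commute k b) : Commute a b := by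
  let C := Subgroup.centralizer {k}
  let e := IsFreeGroup.toFreeGroup C
  have hkC : k ∈ C := Subgroup.mem_centralizer_singleton_iff.2 rfl
  have haC : a ∈ C := Subgroup.mem_centralizer_singleton_iff.2 ha.symm.eq
  have hbC : b ∈ C := Subgroup.mem_centralizer_singleton_iff.2 hb.symm.eq
  have hcen : ∀ c, Commute (e ⟨k, hkC⟩) c := by
    intro c
    obtain ⟨c, rfl⟩ := e.surjective c
    refine Commute.map (f := e) ?_
    exact Subtype.ext (Subgroup.mem_centralizer_singleton_iff.1 c.2).symm
  have hsub : Subsingleton (IsFreeGroup.Generators C) := by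
    refine ⟨fun i j => ?_⟩
    by_contra hij
    have h1 := zpowers_inf_zpowers hij (exists_zpow_of_commute (hcen (of i)))
      (exists_zpow_of_commute (hcen (of j)))
    rw [map_eq_one_iff e e.injective] at h1
    exact hk (congrArg Subtype.val h1)
  have hab : Commute (e ⟨a, haC⟩) (e ⟨b, hbC⟩) := by
    have hpow : ∀ c : FreeGroup (IsFreeGroup.Generators C), ∀ i, Commute c (of i) := by
      intro c i
      induction c using FreeGroup.induction_on with
      | C1 => exact Commute.one_left _
      | of j => rw [Subsingleton.elim j i]
      | inv_of j h => exact h.inv_left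
      | mul x y hx hy => exact hx.mul_left hy
    generalize e ⟨b, hbC⟩ = b'
    induction b' using FreeGroup.induction_on with
    | C1 => exact Commute.one_right _
    | of j => exact hpow _ j
    | inv_of j h => exact h.inv_right
    | mul x y hx hy => exact hx.mul_right hy
  have := congrArg e.symm hab.eq
  rw [map_mul, map_mul, MulEquiv.symm_apply_apply, MulEquiv.symm_apply_apply] at this
  exact congrArg Subtype.val this

/-! ### Normal forms with respect to one letter -/

theorem mem_FC_compl_iff {x : ℕ} {w : FreeGroup ℕ} :
    w ∈ FC {x}ᶜ ↔ ∀ p ∈ w.toWord, p.1 ≠ x := by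
  constructor
  · intro hw
    induction hw using Subgroup.closure_induction with
    | mem y hy =>
      obtain ⟨i, hi, rfl⟩ := hy
      simpa using hi
    | one => simp
    | mul a b _ _ ha hb =>
      intro p hp
      rcases List.mem_append.1 ((FreeGroup.toWord_mul_sublist a b).subset hp) with h | h
      · exact ha p h
      · exact hb p h
    | inv a _ ha =>
      intro p hp
      rw [FreeGroup.toWord_inv, FreeGroup.invRev] at hp
      simp only [List.mem_reverse, List.mem_map] at hp
      obtain ⟨q, hq, rfl⟩ := hp
      exact ha q hq
  · intro h
    have : ∀ L : List (ℕ × Bool), (∀ p ∈ L, p.1 ≠ x) → FreeGroup.mk L ∈ FC {x}ᶜ := by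
      intro L
      induction L with
      | nil => intro _; exact one_mem _
      | cons p L ih =>
        intro hL
        have h1 : FreeGroup.mk (p :: L) = FreeGroup.mk [p] * FreeGroup.mk L := by
          rw [FreeGroup.mul_mk, List.singleton_append]
        rw [h1]
        refine mul_mem ?_ (ih fun q hq => hL q (List.mem_cons_of_mem _ hq))
        obtain ⟨i, b⟩ := p
        have hi : of i ∈ FC {x}ᶜ := of_mem_FC (hL (i, b) (by simp))
        cases b
        · exact inv_mem hi
        · exact hi
    rw [← FreeGroup.mk_toWord (x := w)]
    exact this _ h

section

/-- The reduced word `k₀ x^{e₁} k₁ x^{e₂} k₂ ⋯` coded by `k₀` and the list of pairs `(eᵢ, kᵢ)`. -/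
def sylWord (x : ℕ) (k : FreeGroup ℕ) (l : List (Bool × FreeGroup ℕ)) : List (ℕ × Bool) :=
  k.toWord ++ l.flatMap fun p => (x, p.1) :: p.2.toWord

/-- The codes of reduced words: the `kᵢ` avoid `x` and no cancellation occurs. -/
structure Syl (x : ℕ) (k : FreeGroup ℕ) (l : List (Bool × FreeGroup ℕ)) : Prop where
  head : k ∈ FC {x}ᶜ
  mem : ∀ p ∈ l, p.2 ∈ FC {x}ᶜ
  chain : l.IsChain fun p q => p.2 = 1 → p.1 = q.1

variable {x : ℕ}

theorem sylWord_cons (k : FreeGroup ℕ) (e : Bool) (k' : FreeGroup ℕ)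
    (l : List (Bool × FreeGroup ℕ)) :
    sylWord x k ((e, k') :: l) = k.toWord ++ (x, e) :: sylWord x k' l := by
  simp [sylWord]

theorem Syl.tail {k k' : FreeGroup ℕ} {e : Bool} {l : List (Bool × FreeGroup ℕ)}
    (h : Syl x k ((e, k') :: l)) : Syl x k' l :=
  ⟨h.mem (e, k') (by simp), fun p hp => h.mem p (List.mem_cons_of_mem _ hp), h.chain.tail⟩

theorem isReduced_append_of_ne {L L' : List (ℕ × Bool)} (h : FreeGroup.IsReduced L)
    (h' : FreeGroup.IsReduced L')
    (hne : ∀ a ∈ L.getLast?, ∀ b ∈ L'.head?, a.1 ≠ b.1) : FreeGroup.IsReduced (L ++ L') :=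
  List.isChain_append.2 ⟨h, h', fun a ha b hb e => absurd e (hne a ha b hb)⟩

theorem Syl.isReduced {k : FreeGroup ℕ} {l : List (Bool × FreeGroup ℕ)} (h : Syl x k l) :
    FreeGroup.IsReduced (sylWord x k l) := by
  induction l generalizing k with
  | nil => simpa [sylWord] using FreeGroup.isReduced_toWord
  | cons p l ih =>
    obtain ⟨e, k'⟩ := p
    rw [sylWord_cons]
    refine isReduced_append_of_ne FreeGroup.isReduced_toWord ?_ ?_
    · refine List.isChain_cons.2 ⟨?_, ih h.tail⟩
      intro a ha hax
      rcases hk' : k'.toWord with _ | ⟨b, L⟩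
      · rcases l with _ | ⟨⟨e', k''⟩, l⟩
        · simp [sylWord, hk'] at ha
        · rw [sylWord_cons, hk'] at ha
          simp only [List.nil_append, List.head?_cons, Option.mem_some_iff] at ha
          rw [← ha]
          exact (List.isChain_cons.1 h.chain).1 (e', k'') (by simp)
            (FreeGroup.toWord_eq_nil_iff.1 hk')
      · rw [sylWord, hk'] at ha
        simp only [List.cons_append, List.head?_cons, Option.mem_some_iff] at ha
        have := mem_FC_compl_iff.1 h.tail.head b (by rw [hk']; simp)
        rw [ha] at this
        exact absurd hax.symm this
    · intro a ha b hb
      simp only [List.head?_cons, Option.mem_some_iff] at hb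
      rw [← hb]
      exact mem_FC_compl_iff.1 h.head a (List.mem_of_mem_getLast? ha)

theorem append_cons_inj {L₁ L₂ R₁ R₂ : List (ℕ × Bool)} {e₁ e₂ : Bool} (h₁ : ∀ p ∈ L₁, p.1 ≠ x)
    (h₂ : ∀ p ∈ L₂, p.1 ≠ x) (h : L₁ ++ (x, e₁) :: R₁ = L₂ ++ (x, e₂) :: R₂) :
    L₁ = L₂ ∧ e₁ = e₂ ∧ R₁ = R₂ := by
  induction L₁ generalizing L₂ with
  | nil =>
    rcases L₂ with _ | ⟨b, L₂⟩
    · simpa using h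
    · simp only [List.nil_append, List.cons_append, List.cons.injEq] at h
      exact absurd (by rw [← h.1]) (h₂ b (by simp))
  | cons a L₁ ih =>
    rcases L₂ with _ | ⟨b, L₂⟩
    · simp only [List.nil_append, List.cons_append, List.cons.injEq] at h
      exact absurd (by rw [h.1]) (h₁ a (by simp))
    · simp only [List.cons_append, List.cons.injEq] at h
      obtain ⟨rfl, h⟩ := h
      obtain ⟨rfl, h3⟩ := ih (fun p hp => h₁ p (List.mem_cons_of_mem _ hp))
        (fun p hp => h₂ p (List.mem_cons_of_mem _ hp)) h
      exact ⟨rfl, h3⟩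

theorem Syl.inj {k k' : FreeGroup ℕ} {l l' : List (Bool × FreeGroup ℕ)} (h : Syl x k l)
    (h' : Syl x k' l') (e : sylWord x k l = sylWord x k' l') : k = k' ∧ l = l' := by
  induction l generalizing k k' l' with
  | nil =>
    rcases l' with _ | ⟨⟨e', j'⟩, l'⟩
    · simpa [sylWord] using e
    · rw [sylWord_cons] at e
      have : (x, e') ∈ sylWord x k [] := by rw [e]; simp
      simp only [sylWord, List.flatMap_nil, List.append_nil] at this
      exact absurd rfl (mem_FC_compl_iff.1 h.head _ this)
  | cons p l ih =>
    obtain ⟨a, j⟩ := p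
    rcases l' with _ | ⟨⟨a', j'⟩, l'⟩
    · rw [sylWord_cons] at e
      have : (x, a) ∈ sylWord x k' [] := by rw [← e]; simp
      simp only [sylWord, List.flatMap_nil, List.append_nil] at this
      exact absurd rfl (mem_FC_compl_iff.1 h'.head _ this)
    · rw [sylWord_cons, sylWord_cons] at e
      obtain ⟨e1, rfl, e2⟩ := append_cons_inj (mem_FC_compl_iff.1 h.head)
        (mem_FC_compl_iff.1 h'.head) e
      obtain ⟨rfl, rfl⟩ := ih h.tail h'.tail e2
      exact ⟨FreeGroup.toWord_injective e1, rfl⟩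

theorem exists_syl_word {L : List (ℕ × Bool)} (hL : FreeGroup.IsReduced L) :
    ∃ k l, Syl x k l ∧ sylWord x k l = L := by
  induction L with
  | nil => exact ⟨1, [], ⟨one_mem _, by simp, List.IsChain.nil⟩, by simp [sylWord]⟩
  | cons a L ih =>
    obtain ⟨k, l, h, rfl⟩ := ih hL.tail
    by_cases ha : a.1 = x
    · refine ⟨1, (a.2, k) :: l, ⟨one_mem _, ?_, ?_⟩, ?_⟩
      · intro p hp
        rcases List.mem_cons.1 hp with rfl | hp
        · exact h.head
        · exact h.mem p hp
      · refine List.isChain_cons.2 ⟨?_, h.chain⟩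
        rintro ⟨e', k'⟩ hq rfl
        rcases l with _ | ⟨⟨e'', k''⟩, l⟩
        · simp at hq
        · simp only [List.head?_cons, Option.mem_some_iff, Prod.mk.injEq] at hq
          obtain ⟨rfl, rfl⟩ := hq
          rw [sylWord_cons] at hL
          simp only [FreeGroup.toWord_one, List.nil_append] at hL
          exact (List.isChain_cons_cons.1 hL).1 ha
      · rw [sylWord_cons]
        simp [← ha]
    · have hr : FreeGroup.IsReduced (a :: k.toWord) := by
        rw [sylWord] at hL
        exact List.IsChain.left_of_append
          (l₂ := l.flatMap fun p => (x, p.1) :: p.2.toWord) (by simpa [FreeGroup.IsReduced] using hL)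
      have hw : (FreeGroup.mk (a :: k.toWord)).toWord = a :: k.toWord := by
        rw [FreeGroup.toWord_mk, hr.reduce_eq]
      refine ⟨FreeGroup.mk (a :: k.toWord), l, ⟨?_, h.mem, h.chain⟩, ?_⟩
      · rw [mem_FC_compl_iff, hw]
        intro p hp
        rcases List.mem_cons.1 hp with rfl | hp
        · exact ha
        · exact mem_FC_compl_iff.1 h.head p hp
      · rw [sylWord, hw, sylWord]; rfl

theorem exists_syl (x : ℕ) (w : FreeGroup ℕ) :
    ∃ k l, Syl x k l ∧ FreeGroup.mk (sylWord x k l) = w := by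
  obtain ⟨k, l, h, e⟩ := exists_syl_word (x := x) (FreeGroup.isReduced_toWord (x := w))
  exact ⟨k, l, h, by rw [e, FreeGroup.mk_toWord]⟩

theorem Syl.eq_of_mk_eq {k k' : FreeGroup ℕ} {l l' : List (Bool × FreeGroup ℕ)} (h : Syl x k l)
    (h' : Syl x k' l') (e : FreeGroup.mk (sylWord x k l) = FreeGroup.mk (sylWord x k' l')) :
    k = k' ∧ l = l' := by
  refine h.inj h' ?_
  have := congrArg FreeGroup.toWord e
  rwa [FreeGroup.toWord_mk, FreeGroup.toWord_mk, h.isReduced.reduce_eq, h'.isReduced.reduce_eq]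
    at this

theorem mk_sylWord_nil (k : FreeGroup ℕ) : FreeGroup.mk (sylWord x k []) = k := by
  simp [sylWord, FreeGroup.mk_toWord]

theorem mk_sylWord_cons (k : FreeGroup ℕ) (e : Bool) (k' : FreeGroup ℕ)
    (l : List (Bool × FreeGroup ℕ)) : FreeGroup.mk (sylWord x k ((e, k') :: l)) =
      k * FreeGroup.mk [(x, e)] * FreeGroup.mk (sylWord x k' l) := by
  rw [sylWord_cons]
  conv_rhs => rw [← FreeGroup.mk_toWord (x := k)]
  rw [FreeGroup.mul_mk, FreeGroup.mul_mk]
  simp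

/-- The effect of `x ↦ c x` on codes. -/
def sylMul (c : FreeGroup ℕ) : FreeGroup ℕ → List (Bool × FreeGroup ℕ) →
    FreeGroup ℕ × List (Bool × FreeGroup ℕ)
  | k, [] => (k, [])
  | k, (e, k') :: l => (k * cond e c 1,
      (e, (sylMul c (cond e 1 c⁻¹ * k') l).1) :: (sylMul c (cond e 1 c⁻¹ * k') l).2)

theorem mk_sylMul {c : FreeGroup ℕ} (hc : c ∈ FC {x}ᶜ) {k : FreeGroup ℕ}
    {l : List (Bool × FreeGroup ℕ)} (hk : k ∈ FC {x}ᶜ) (hl : ∀ p ∈ l, p.2 ∈ FC {x}ᶜ) :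
    FreeGroup.mk (sylWord x (sylMul c k l).1 (sylMul c k l).2) =
      lmul x c (FreeGroup.mk (sylWord x k l)) := by
  induction l generalizing k with
  | nil => simp only [sylMul, mk_sylWord_nil]; exact (lmul_mem_PS x c k hk).symm
  | cons p l ih =>
    obtain ⟨e, k'⟩ := p
    have hk' : k' ∈ FC {x}ᶜ := hl (e, k') (by simp)
    simp only [sylMul, mk_sylWord_cons, map_mul]
    rw [ih (mul_mem (by cases e; exacts [inv_mem hc, one_mem _]) hk')
      fun p hp => hl p (List.mem_cons_of_mem _ hp)]
    have hmul : ∀ a ∈ FC {x}ᶜ, FreeGroup.mk (sylWord x (a * k') l) =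
        a * FreeGroup.mk (sylWord x k' l) := by
      intro a _
      rcases l with _ | ⟨⟨e', j⟩, l⟩
      · simp only [mk_sylWord_nil]
      · simp only [mk_sylWord_cons, mul_assoc]
    rw [hmul _ (by cases e; exacts [inv_mem hc, one_mem _]), map_mul, lmul_mem_PS x c k hk]
    cases e
    · have h1 : FreeGroup.mk [(x, false)] = (of x)⁻¹ := rfl
      have h2 : lmul x c c⁻¹ = c⁻¹ := lmul_mem_PS x c _ (inv_mem hc)
      simp only [cond_false, h1, h2, map_inv, lmul_self hc]
      group
    · have h1 : FreeGroup.mk [(x, true)] = of x := rfl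
      simp only [cond_true, h1, lmul_self hc]
      simp [mul_assoc]

theorem syl_sylMul {c : FreeGroup ℕ} (hc : c ∈ FC {x}ᶜ) {k : FreeGroup ℕ}
    {l : List (Bool × FreeGroup ℕ)} (h : Syl x k l) {a : FreeGroup ℕ} (ha : a ∈ FC {x}ᶜ) :
    Syl x (sylMul c (a * k) l).1 (sylMul c (a * k) l).2 := by
  induction l generalizing k a with
  | nil => exact ⟨mul_mem ha h.head, by simp [sylMul], by simp [sylMul]⟩
  | cons p l ih =>
    obtain ⟨e, k'⟩ := p
    have hce : cond e 1 c⁻¹ ∈ FC {x}ᶜ := by cases e; exacts [inv_mem hc, one_mem _]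
    have IH := ih h.tail hce
    refine ⟨mul_mem (mul_mem ha h.head) (by cases e; exacts [one_mem _, hc]), ?_, ?_⟩
    · intro p hp
      simp only [sylMul, List.mem_cons] at hp
      rcases hp with rfl | hp
      · exact IH.head
      · exact IH.mem p hp
    · simp only [sylMul]
      refine List.isChain_cons.2 ⟨?_, IH.chain⟩
      rintro ⟨e', j⟩ hq h1
      rcases l with _ | ⟨⟨e'', k''⟩, l⟩
      · simp [sylMul] at hq
      · have hch := (List.isChain_cons_cons.1 h.chain).1
        simp only [sylMul, List.head?_cons, Option.mem_some_iff, Prod.mk.injEq] at hq h1 hch ⊢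
        obtain ⟨rfl, -⟩ := hq
        cases e <;> cases e'' <;> simp_all [mul_assoc]
        rw [inv_mul_eq_one] at h1
        exact hch (mul_eq_right.1 h1.symm)

/-- If `x ↦ c x` acts on `w` as a left multiplication by an element avoiding `x`, for two
non-commuting choices of `c`, then `x` occurs at most once in `w`. -/
theorem normal_form {w c₁ c₂ d₁ d₂ : FreeGroup ℕ} (hc₁ : c₁ ∈ FC {x}ᶜ) (hc₂ : c₂ ∈ FC {x}ᶜ)
    (hc : ¬ Commute c₁ c₂) (hd₁ : d₁ ∈ FC {x}ᶜ) (hd₂ : d₂ ∈ FC {x}ᶜ)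
    (h₁ : lmul x c₁ w = d₁ * w) (h₂ : lmul x c₂ w = d₂ * w) :
    w ∈ FC {x}ᶜ ∨ ∃ u ∈ FC {x}ᶜ, ∃ v ∈ FC {x}ᶜ, w = u * of x * v := by
  obtain ⟨k, l, h, rfl⟩ := exists_syl x w
  have step : ∀ c ∈ FC {x}ᶜ, ∀ d ∈ FC {x}ᶜ, lmul x c (FreeGroup.mk (sylWord x k l)) =
      d * FreeGroup.mk (sylWord x k l) → (sylMul c k l).2 = l := by
    intro c hc d hd hcd
    have e1 : d * FreeGroup.mk (sylWord x k l) = FreeGroup.mk (sylWord x (d * k) l) := by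
      rcases l with _ | ⟨⟨e', j⟩, l⟩
      · simp only [mk_sylWord_nil]
      · simp only [mk_sylWord_cons, mul_assoc]
    rw [← mk_sylMul hc h.head h.mem, e1] at hcd
    have hs := syl_sylMul hc h (one_mem _)
    rw [one_mul] at hs
    exact (hs.eq_of_mk_eq ⟨mul_mem hd h.head, h.mem, h.chain⟩ hcd).2
  have e₁ := step c₁ hc₁ d₁ hd₁ h₁
  have e₂ := step c₂ hc₂ d₂ hd₂ h₂
  have hne₁ : c₁ ≠ 1 := by rintro rfl; exact hc (Commute.one_left _)
  have key : ∀ (l : List (Bool × FreeGroup ℕ)) (e : Bool) (k : FreeGroup ℕ),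
      ((e, k) :: l).IsChain (fun p q : Bool × FreeGroup ℕ => p.2 = 1 → p.1 = q.1) →
      sylMul c₁ (cond e 1 c₁⁻¹ * k) l = (k, l) → sylMul c₂ (cond e 1 c₂⁻¹ * k) l = (k, l) →
      e = true ∧ l = [] := by
    intro l
    induction l with
    | nil =>
      intro e k _ h1 _
      cases e <;> simp_all [sylMul]
    | cons p l ih =>
      intro e k hch h1 h2
      obtain ⟨e', k'⟩ := p
      simp only [sylMul, Prod.mk.injEq, List.cons.injEq, true_and] at h1 h2
      obtain ⟨rfl, rfl⟩ := ih e' k' hch.tail (Prod.ext h1.2.1 h1.2.2) (Prod.ext h2.2.1 h2.2.2)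
      exfalso
      cases e
      · have hk : k ≠ 1 := by
          rintro rfl
          simpa using (List.isChain_cons_cons.1 hch).1
        simp only [cond_false, cond_true] at h1 h2
        refine hc (commute_of_commute hk ?_ ?_)
        · have := h1.1
          rw [mul_assoc, inv_mul_eq_iff_eq_mul] at this
          exact this
        · have := h2.1
          rw [mul_assoc, inv_mul_eq_iff_eq_mul] at this
          exact this
      · simp only [cond_true, one_mul, mul_eq_left] at h1
        exact hne₁ h1.1
  rcases l with _ | ⟨⟨e, k'⟩, l⟩
  · left; rw [mk_sylWord_nil]; exact h.head
  · simp only [sylMul, List.cons.injEq, Prod.mk.injEq, true_and] at e₁ e₂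
    obtain ⟨rfl, rfl⟩ := key l e k' h.chain (Prod.ext e₁.1 e₁.2) (Prod.ext e₂.1 e₂.2)
    right
    refine ⟨k, h.head, k', h.tail.head, ?_⟩
    rw [mk_sylWord_cons, mk_sylWord_nil]
    rfl

end

section

variable {x : ℕ}

/-- A word of length at least `m` whose first and last letters are `x` or `x⁻¹`. -/
structure Bordered (x m : ℕ) (L : List (ℕ × Bool)) : Prop where
  head : ∀ a ∈ L.head?, a.1 = x
  last : ∀ a ∈ L.getLast?, a.1 = x
  length : m ≤ L.length

theorem Bordered.invRev {m : ℕ} {L : List (ℕ × Bool)} (h : Bordered x m L) :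
    Bordered x m (FreeGroup.invRev L) := by
  refine ⟨?_, ?_, by simpa using h.length⟩
  · intro a ha
    simp only [FreeGroup.invRev, List.head?_reverse, List.getLast?_map, Option.mem_def,
      Option.map_eq_some_iff] at ha
    obtain ⟨b, hb, rfl⟩ := ha
    exact h.last b hb
  · intro a ha
    simp only [FreeGroup.invRev, List.getLast?_reverse, List.head?_map, Option.mem_def,
      Option.map_eq_some_iff] at ha
    obtain ⟨b, hb, rfl⟩ := ha
    exact h.head b hb

theorem Bordered.append {m : ℕ} (hm : m ≠ 0) {L M R : List (ℕ × Bool)} (hL : Bordered x m L)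
    (hR : Bordered x m R) : Bordered x m (L ++ M ++ R) := by
  have hL0 : L ≠ [] := by rintro rfl; exact hm (by simpa using hL.length)
  have hR0 : R ≠ [] := by rintro rfl; exact hm (by simpa using hR.length)
  refine ⟨?_, ?_, ?_⟩
  · rw [List.append_assoc, List.head?_append_of_ne_nil _ hL0]
    exact hL.head
  · rw [List.getLast?_append_of_ne_nil _ hR0]
    exact hR.last
  · have := hL.length
    simp only [List.length_append]
    omega

theorem bordered_pow {w : FreeGroup ℕ} {m : ℕ} (hm : m ≠ 0) (hw : Bordered x m w.toWord) (n : ℕ) :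
    Bordered x m (w ^ (n + 1)).toWord := by
  rw [FreeGroup.toWord_pow,
    FreeGroup.reduceCyclically.reduce_flatten_replicate_succ FreeGroup.isReduced_toWord]
  have e := FreeGroup.reduceCyclically.conj_conjugator_reduceCyclically w.toWord
  set a := FreeGroup.reduceCyclically.conjugator w.toWord
  set c := FreeGroup.reduceCyclically w.toWord
  have hac : a ++ c ≠ [] := by
    intro h0
    obtain ⟨ha, hc⟩ := List.append_eq_nil_iff.1 h0
    rw [ha, hc] at e
    have := hw.length
    rw [← e] at this
    simp at this
    omega
  have hac' : c ++ FreeGroup.invRev a ≠ [] := by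
    intro h0
    obtain ⟨hc, ha⟩ := List.append_eq_nil_iff.1 h0
    rw [FreeGroup.invRev, List.reverse_eq_nil_iff, List.map_eq_nil_iff] at ha
    exact hac (by rw [ha, hc]; rfl)
  refine ⟨?_, ?_, ?_⟩
  · have h1 := hw.head
    rw [← e, List.head?_append_of_ne_nil _ hac] at h1
    rw [List.replicate_succ, List.flatten_cons, ← List.append_assoc, List.append_assoc,
      List.head?_append_of_ne_nil _ hac]
    exact h1
  · have h1 := hw.last
    rw [← e, List.append_assoc, List.getLast?_append_of_ne_nil _ hac'] at h1
    rw [List.replicate_succ', List.flatten_concat, ← List.append_assoc, List.append_assoc,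
      List.getLast?_append_of_ne_nil _ hac']
    exact h1
  · have h1 := hw.length
    rw [← e] at h1
    rw [List.replicate_succ, List.flatten_cons]
    simp only [List.length_append, FreeGroup.invRev_length] at h1 ⊢
    omega

theorem bordered_zpow {w : FreeGroup ℕ} {m : ℕ} (hm : m ≠ 0) (hw : Bordered x m w.toWord) {n : ℤ}
    (hn : n ≠ 0) : Bordered x m (w ^ n).toWord := by
  rcases n with n | n
  · rcases n with _ | n
    · exact absurd rfl hn
    · rw [Int.ofNat_eq_natCast, zpow_natCast]
      exact bordered_pow hm hw n
  · rw [zpow_negSucc, FreeGroup.toWord_inv]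
    exact (bordered_pow hm hw n).invRev

/-- Alternating products of non-trivial powers of `w` and non-trivial elements avoiding `x`,
starting and ending with a power of `w`. -/
inductive Alternating (x : ℕ) (w : FreeGroup ℕ) : FreeGroup ℕ → Prop
  | pow (n : ℤ) (hn : n ≠ 0) : Alternating x w (w ^ n)
  | cons (n : ℤ) (hn : n ≠ 0) (d : FreeGroup ℕ) (hd : d ∈ FC {x}ᶜ) (hd1 : d ≠ 1)
      (g : FreeGroup ℕ) (hg : Alternating x w g) : Alternating x w (w ^ n * d * g)

theorem toWord_mul_of_isReduced {a b : FreeGroup ℕ}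
    (h : FreeGroup.IsReduced (a.toWord ++ b.toWord)) : (a * b).toWord = a.toWord ++ b.toWord := by
  rw [FreeGroup.toWord_mul, h.reduce_eq]

theorem Alternating.bordered {w : FreeGroup ℕ} {m : ℕ} (hm : m ≠ 0) (hw : Bordered x m w.toWord)
    {g : FreeGroup ℕ} (hg : Alternating x w g) : Bordered x m g.toWord := by
  induction hg with
  | pow n hn => exact bordered_zpow hm hw hn
  | cons n hn d hd hd1 g hg ih =>
    have hE := bordered_zpow hm hw hn
    have hd' := mem_FC_compl_iff.1 hd
    have r1 : FreeGroup.IsReduced ((w ^ n).toWord ++ d.toWord) :=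
      isReduced_append_of_ne FreeGroup.isReduced_toWord FreeGroup.isReduced_toWord
        fun a ha b hb e => hd' b (List.mem_of_mem_head? hb) (e ▸ hE.last a ha)
    have hd0 : d.toWord ≠ [] := fun h => hd1 (FreeGroup.toWord_eq_nil_iff.1 h)
    have r2 : FreeGroup.IsReduced ((w ^ n * d).toWord ++ g.toWord) := by
      refine isReduced_append_of_ne FreeGroup.isReduced_toWord FreeGroup.isReduced_toWord ?_
      intro a ha b hb e
      rw [toWord_mul_of_isReduced r1, List.getLast?_append_of_ne_nil _ hd0] at ha
      exact hd' a (List.mem_of_mem_getLast? ha) (e ▸ ih.head b hb)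
    rw [toWord_mul_of_isReduced r2, toWord_mul_of_isReduced r1]
    exact hE.append hm ih

theorem Alternating.zpow_mul {w g : FreeGroup ℕ} (hg : Alternating x w g) {n : ℤ} (hn : n ≠ 0)
    {d : FreeGroup ℕ} (hd : d ∈ FC {x}ᶜ) : w ^ n * (d * g) ∈ FC {x}ᶜ ∨
      ∃ a ∈ FC {x}ᶜ, ∃ g', Alternating x w g' ∧ w ^ n * (d * g) = a * g' := by
  by_cases hd1 : d = 1
  · subst hd1
    rw [one_mul]
    cases hg with
    | pow m hm =>
      rw [← zpow_add]
      by_cases hnm : n + m = 0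
      · left; rw [hnm, zpow_zero]; exact one_mem _
      · exact Or.inr ⟨1, one_mem _, _, .pow _ hnm, by simp⟩
    | cons m hm a ha ha1 g hg =>
      rw [mul_assoc, ← mul_assoc, ← zpow_add]
      by_cases hnm : n + m = 0
      · exact Or.inr ⟨a, ha, g, hg, by simp [hnm]⟩
      · exact Or.inr ⟨1, one_mem _, _, .cons _ hnm a ha ha1 g hg, by simp [mul_assoc]⟩
  · exact Or.inr ⟨1, one_mem _, _, .cons n hn d hd hd1 g hg, by simp [mul_assoc]⟩

/-- Every element generated by `w` and the letters other than `x` is alternating up to factors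
avoiding `x`. -/
theorem exists_alternating {w v : FreeGroup ℕ}
    (hv : v ∈ Subgroup.closure (insert w (FC {x}ᶜ : Set (FreeGroup ℕ)))) :
    v ∈ FC {x}ᶜ ∨ ∃ d ∈ FC {x}ᶜ, ∃ d' ∈ FC {x}ᶜ, ∃ g, Alternating x w g ∧ v = d * g * d' := by
  have hpow : ∀ n : ℤ, n ≠ 0 → ∀ v, (v ∈ FC {x}ᶜ ∨ ∃ d ∈ FC {x}ᶜ, ∃ d' ∈ FC {x}ᶜ, ∃ g,
      Alternating x w g ∧ v = d * g * d') → (w ^ n * v ∈ FC {x}ᶜ ∨ ∃ d ∈ FC {x}ᶜ,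
        ∃ d' ∈ FC {x}ᶜ, ∃ g, Alternating x w g ∧ w ^ n * v = d * g * d') := by
    rintro n hn v (hv | ⟨d, hd, d', hd', g, hg, rfl⟩)
    · exact Or.inr ⟨1, one_mem _, v, hv, _, .pow n hn, by simp⟩
    · rw [← mul_assoc]
      rcases hg.zpow_mul hn hd with h | ⟨a, ha, g', hg', e⟩
      · exact Or.inl (mul_mem h hd')
      · exact Or.inr ⟨a, ha, d', hd', g', hg', by rw [e]⟩
  have hD : ∀ a ∈ FC {x}ᶜ, ∀ v, (v ∈ FC {x}ᶜ ∨ ∃ d ∈ FC {x}ᶜ, ∃ d' ∈ FC {x}ᶜ, ∃ g,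
      Alternating x w g ∧ v = d * g * d') → (a * v ∈ FC {x}ᶜ ∨ ∃ d ∈ FC {x}ᶜ,
        ∃ d' ∈ FC {x}ᶜ, ∃ g, Alternating x w g ∧ a * v = d * g * d') := by
    rintro a ha v (hv | ⟨d, hd, d', hd', g, hg, rfl⟩)
    · exact Or.inl (mul_mem ha hv)
    · exact Or.inr ⟨a * d, mul_mem ha hd, d', hd', g, hg, by simp [mul_assoc]⟩
  induction hv using Subgroup.closure_induction_left with
  | one => exact Or.inl (one_mem _)
  | mul_left a ha v _ ih =>
    rcases ha with rfl | ha
    · simpa using hpow 1 one_ne_zero v ih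
    · exact hD a ha v ih
  | inv_mul_cancel a ha v _ ih =>
    rcases ha with rfl | ha
    · simpa using hpow (-1) (by decide) v ih
    · exact hD _ (inv_mem ha) v ih

theorem exists_bordered {y : FreeGroup ℕ} (hy : y ∉ FC {x}ᶜ) :
    ∃ u ∈ FC {x}ᶜ, ∃ v ∈ FC {x}ᶜ, ∃ w, Bordered x 1 w.toWord ∧ y = u * w * v := by
  obtain ⟨k, l, h, rfl⟩ := exists_syl x y
  rcases List.eq_nil_or_concat l with rfl | ⟨l', ⟨e, k'⟩, rfl⟩
  · rw [mk_sylWord_nil] at hy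
    exact absurd h.head hy
  set V := (l'.flatMap fun p => (x, p.1) :: p.2.toWord) ++ [(x, e)] with hV
  have hs : sylWord x k (l' ++ [(e, k')]) = k.toWord ++ V ++ k'.toWord := by
    simp [sylWord, hV]
  have hr : FreeGroup.IsReduced V := by
    have := h.isReduced
    rw [List.concat_eq_append, hs] at this
    exact List.IsChain.right_of_append (List.IsChain.left_of_append this)
  refine ⟨k, h.head, k', h.mem (e, k') (by simp), FreeGroup.mk V, ?_, ?_⟩
  · rw [FreeGroup.toWord_mk, hr.reduce_eq]
    refine ⟨?_, ?_, by simp [hV]⟩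
    · rcases l' with _ | ⟨p, l'⟩ <;> simp [hV]
    · simp [hV]
  · rw [List.concat_eq_append, hs, ← FreeGroup.mul_mk, ← FreeGroup.mul_mk, FreeGroup.mk_toWord,
      FreeGroup.mk_toWord]

/-- An automorphism fixing all letters but `x` maps `x` to `u x v` or to `u x⁻¹ v`. -/
theorem exists_apply_eq {h : MulAut (FreeGroup ℕ)} (hh : h ∈ PS (FC {x}ᶜ)) :
    ∃ u ∈ FC {x}ᶜ, ∃ v ∈ FC {x}ᶜ, h (of x) = u * of x * v ∨ h (of x) = u * (of x)⁻¹ * v := by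
  have hy : h (of x) ∉ FC {x}ᶜ := by
    intro h1
    have h2 : h (h (of x)) = h (of x) := hh _ h1
    rw [h.injective h2] at h1
    exact (of_mem_FC_iff.1 h1) rfl
  obtain ⟨u, hu, v, hv, w, hw, e⟩ := exists_bordered hy
  have hgen : of x ∈ Subgroup.closure (insert w (FC {x}ᶜ : Set (FreeGroup ℕ))) := by
    have hle : ∀ g, h g ∈ Subgroup.closure (insert w (FC {x}ᶜ : Set (FreeGroup ℕ))) := by
      intro g
      have hD : ∀ d ∈ FC {x}ᶜ, d ∈ Subgroup.closure (insert w (FC {x}ᶜ : Set (FreeGroup ℕ))) :=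
        fun d hd => Subgroup.subset_closure (Set.mem_insert_of_mem _ hd)
      have hlet : ∀ i, h (of i) ∈ Subgroup.closure (insert w (FC {x}ᶜ : Set (FreeGroup ℕ))) := by
        intro i
        by_cases hi : i = x
        · rw [hi, e]
          exact mul_mem (mul_mem (hD u hu) (Subgroup.subset_closure (Set.mem_insert _ _))) (hD v hv)
        · have : of i ∈ FC {x}ᶜ := of_mem_FC hi
          have h3 : h (of i) = of i := hh _ this
          rw [h3]
          exact hD _ this
      induction g using FreeGroup.induction_on with
      | C1 => rw [map_one]; exact one_mem _
      | of i => exact hlet i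
      | inv_of i _ => rw [map_inv]; exact inv_mem (hlet i)
      | mul a b ha hb => rw [map_mul]; exact mul_mem ha hb
    have := hle (h⁻¹ (of x))
    rwa [MulAut.apply_inv_self] at this
  have hwm : Bordered x w.toWord.length w.toWord := ⟨hw.head, hw.last, le_rfl⟩
  have hm : w.toWord.length ≠ 0 := by have := hw.length; omega
  rcases exists_alternating hgen with h1 | ⟨d, hd, d', hd', g, hg, e'⟩
  · exact absurd rfl (of_mem_FC_iff.1 h1)
  have hB := hg.bordered hm hwm
  have hgs : g = FreeGroup.mk (sylWord x d⁻¹ [(true, d'⁻¹)]) := by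
    rw [mk_sylWord_cons, mk_sylWord_nil]
    change g = d⁻¹ * of x * d'⁻¹
    rw [e']; group
  have hsyl : Syl x d⁻¹ [(true, d'⁻¹)] :=
    ⟨inv_mem hd, by simpa using hd', List.isChain_singleton _⟩
  have hgw : g.toWord = d⁻¹.toWord ++ (x, true) :: d'⁻¹.toWord := by
    rw [hgs, FreeGroup.toWord_mk, hsyl.isReduced.reduce_eq]
    simp [sylWord]
  have h1 : d⁻¹.toWord = [] := by
    rcases hL : d⁻¹.toWord with _ | ⟨a, L⟩
    · rfl
    · have h2 := hB.head a (by rw [hgw, hL]; simp)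
      exact absurd h2 (mem_FC_compl_iff.1 (inv_mem hd) a (by rw [hL]; simp))
  have h2 : d'⁻¹.toWord = [] := by
    rcases List.eq_nil_or_concat d'⁻¹.toWord with hL | ⟨L, a, hL⟩
    · exact hL
    · rw [List.concat_eq_append] at hL
      have h2 := hB.last a (by rw [hgw, hL, ← List.cons_append, ← List.append_assoc,
        List.getLast?_concat]; rfl)
      exact absurd h2 (mem_FC_compl_iff.1 (inv_mem hd') a (by rw [hL]; simp))
  have hlen : w.toWord.length = 1 := by
    have h3 := hB.length
    have h4 := hw.length
    rw [hgw, h1, h2] at h3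
    simp only [List.nil_append, List.length_singleton] at h3
    omega
  obtain ⟨⟨i, b⟩, hb⟩ := List.length_eq_one_iff.1 hlen
  have hi : i = x := hw.head (i, b) (by rw [hb]; simp)
  subst hi
  have hwx : w = FreeGroup.mk [(i, b)] := by rw [← hb, FreeGroup.mk_toWord]
  refine ⟨u, hu, v, hv, ?_⟩
  rw [e, hwx]
  cases b
  · right; rfl
  · left; rfl

/-- If `h` fixes the letters in `C` and preserves the span of `C` and one more letter `x`, then
it maps `x` to `u x v` or to `u x⁻¹ v`, with `u` and `v` in the span of `C`. -/
theorem exists_apply_eq_of_insert {C : Set ℕ} {h : MulAut (FreeGroup ℕ)}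
    (hh : h ∈ PS (FC C)) (hS : h • FC (insert x C) = FC (insert x C)) :
    ∃ u ∈ FC C, ∃ v ∈ FC C, h (of x) = u * of x * v ∨ h (of x) = u * (of x)⁻¹ * v := by
  obtain ⟨ω, h1, h2⟩ := exists_extend hS
  have hω : ω ∈ PS (FC {x}ᶜ) := by
    refine mem_PS_FC.2 fun i hi => ?_
    by_cases hiC : i ∈ C
    · rw [h1 _ (of_mem_FC (Set.mem_insert_of_mem _ hiC))]
      exact hh _ (of_mem_FC hiC)
    · exact h2 i (by simpa [hiC] using hi)
  have hxm : of x ∈ FC (insert x C) := of_mem_FC (Set.mem_insert _ _)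
  have hret : ∀ w ∈ FC {x}ᶜ, retr (insert x C) w = retr C w := fun w hw => by
    refine hom_eqOn (fun i hi => ?_) hw
    by_cases hiC : i ∈ C
    · rw [retr_of_mem hiC, retr_of_mem (Set.mem_insert_of_mem _ hiC)]
    · rw [retr_of_notMem hiC, retr_of_notMem]
      simpa [hiC] using hi
  have hhx : retr (insert x C) (h (of x)) = h (of x) :=
    retr_eq_self (apply_mem_of_smul_eq hS hxm)
  obtain ⟨u, hu, v, hv, e⟩ := exists_apply_eq hω
  rw [h1 _ hxm] at e
  refine ⟨retr C u, retr_mem C u, retr C v, retr_mem C v, e.imp ?_ ?_⟩ <;>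
  · intro e
    rw [← hret u hu, ← hret v hv]
    conv_rhs => rw [← retr_eq_self hxm]
    rw [← hhx, e]
    simp only [map_mul, map_inv]

end

section

variable {x : ℕ}

/-! ### Sign changes, and automorphisms commuting with transvections -/

theorem letter_inj {u v u' v' : FreeGroup ℕ} {e e' : Bool} (hu : u ∈ FC {x}ᶜ) (hv : v ∈ FC {x}ᶜ)
    (hu' : u' ∈ FC {x}ᶜ) (hv' : v' ∈ FC {x}ᶜ)
    (h : u * FreeGroup.mk [(x, e)] * v = u' * FreeGroup.mk [(x, e')] * v') :
    u = u' ∧ e = e' ∧ v = v' := by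
  have h1 : Syl x u [(e, v)] := ⟨hu, by simpa using hv, List.isChain_singleton _⟩
  have h2 : Syl x u' [(e', v')] := ⟨hu', by simpa using hv', List.isChain_singleton _⟩
  have := h1.eq_of_mk_eq h2 (by
    rw [mk_sylWord_cons, mk_sylWord_cons, mk_sylWord_nil, mk_sylWord_nil, h])
  simpa using this

theorem of_inj {u v u' v' : FreeGroup ℕ} (hu : u ∈ FC {x}ᶜ) (hv : v ∈ FC {x}ᶜ)
    (hu' : u' ∈ FC {x}ᶜ) (hv' : v' ∈ FC {x}ᶜ) (h : u * of x * v = u' * of x * v') :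
    u = u' ∧ v = v' := by
  obtain ⟨h1, -, h2⟩ := letter_inj (e := true) (e' := true) hu hv hu' hv' h
  exact ⟨h1, h2⟩

theorem of_inv_inj {u v u' v' : FreeGroup ℕ} (hu : u ∈ FC {x}ᶜ) (hv : v ∈ FC {x}ᶜ)
    (hu' : u' ∈ FC {x}ᶜ) (hv' : v' ∈ FC {x}ᶜ) (h : u * (of x)⁻¹ * v = u' * (of x)⁻¹ * v') :
    u = u' ∧ v = v' := by
  obtain ⟨h1, -, h2⟩ := letter_inj (e := false) (e' := false) hu hv hu' hv' h
  exact ⟨h1, h2⟩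

theorem of_ne_of_inv {u v u' v' : FreeGroup ℕ} (hu : u ∈ FC {x}ᶜ) (hv : v ∈ FC {x}ᶜ)
    (hu' : u' ∈ FC {x}ᶜ) (hv' : v' ∈ FC {x}ᶜ) : u * of x * v ≠ u' * (of x)⁻¹ * v' := fun h => by
  obtain ⟨-, h1, -⟩ := letter_inj (e := true) (e' := false) hu hv hu' hv' h
  exact absurd h1 (by decide)

open Classical in
/-- The automorphism inverting the letter `x` and fixing all other letters. -/
noncomputable def eps (x : ℕ) : MulAut (FreeGroup ℕ) :=
  mkAut (fun i => if i = x then (of x)⁻¹ else of i) (fun i => if i = x then (of x)⁻¹ else of i)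
    (fun i => by by_cases hi : i = x <;> simp [hi])
    (fun i => by by_cases hi : i = x <;> simp [hi])

theorem eps_self (x : ℕ) : eps x (of x) = (of x)⁻¹ := by simp [eps]

theorem eps_of_ne {i : ℕ} (h : i ≠ x) : eps x (of i) = of i := by simp [eps, h]

theorem eps_mem_PS (x : ℕ) : eps x ∈ PS (FC {x}ᶜ) :=
  mem_PS_FC.2 fun _ hi => eps_of_ne hi

theorem eps_mul_self (x : ℕ) : eps x * eps x = 1 := aut_ext fun i => by
  by_cases hi : i = x
  · subst hi
    simp [MulAut.mul_apply, eps_self]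
  · simp [MulAut.mul_apply, eps_of_ne hi]

theorem lmul_one (x : ℕ) : lmul x 1 = 1 := aut_ext fun i => by
  by_cases hi : i = x
  · subst hi
    simp [lmul_self (one_mem _)]
  · simp [lmul_of_ne _ hi]

theorem lmul_mul {a b : FreeGroup ℕ} (ha : a ∈ FC {x}ᶜ) (hb : b ∈ FC {x}ᶜ) :
    lmul x a * lmul x b = lmul x (b * a) := aut_ext fun i => by
  by_cases hi : i = x
  · subst hi
    rw [MulAut.mul_apply, lmul_self hb, lmul_self (mul_mem hb ha), map_mul, lmul_self ha,
      lmul_mem_PS i a b hb, mul_assoc]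
  · rw [MulAut.mul_apply, lmul_of_ne _ hi, lmul_of_ne _ hi, lmul_of_ne _ hi]

theorem conj_lmul {k : MulAut (FreeGroup ℕ)} {y : ℕ} (hy : k (of x) = of y)
    (hk : k • FC {x}ᶜ = FC {y}ᶜ) {d : FreeGroup ℕ} (hd : d ∈ FC {x}ᶜ) :
    k * lmul x d * k⁻¹ = lmul y (k d) := by
  have hkd : k d ∈ FC {y}ᶜ := apply_mem_of_smul_eq hk hd
  refine aut_ext fun i => ?_
  rw [MulAut.mul_apply, MulAut.mul_apply]
  by_cases hi : i = y
  · subst hi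
    rw [lmul_self hkd, ← hy, MulAut.inv_apply_self, lmul_self hd, map_mul]
  · rw [lmul_of_ne _ hi, lmul_mem_PS x d _ (inv_apply_mem_of_smul_eq hk (of_mem_FC hi)),
      MulAut.apply_inv_self]

theorem conj_eps {k : MulAut (FreeGroup ℕ)} {y : ℕ} (hy : k (of x) = of y)
    (hk : k • FC {x}ᶜ = FC {y}ᶜ) : k * eps x * k⁻¹ = eps y := by
  refine aut_ext fun i => ?_
  rw [MulAut.mul_apply, MulAut.mul_apply]
  by_cases hi : i = y
  · subst hi
    rw [eps_self, ← hy, MulAut.inv_apply_self, eps_self, map_inv]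
  · rw [eps_of_ne hi, eps_mem_PS x _ (inv_apply_mem_of_smul_eq hk (of_mem_FC hi)),
      MulAut.apply_inv_self]

/-- A non-trivial element `w` inverted by `x ↦ x⁻¹`, and acted upon by two independent
transvections as by left multiplications, is a conjugate of `x`. -/
theorem exists_conj_form {w c₁ c₂ d₁ d₂ : FreeGroup ℕ} (hc₁ : c₁ ∈ FC {x}ᶜ) (hc₂ : c₂ ∈ FC {x}ᶜ)
    (hc : ¬ Commute c₁ c₂) (hd₁ : d₁ ∈ FC {x}ᶜ) (hd₂ : d₂ ∈ FC {x}ᶜ)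
    (h₁ : lmul x c₁ w = d₁ * w) (h₂ : lmul x c₂ w = d₂ * w) (hw : w ≠ 1)
    (he : eps x w = w⁻¹) : ∃ u ∈ FC {x}ᶜ, w = u * of x * u⁻¹ := by
  rcases normal_form hc₁ hc₂ hc hd₁ hd₂ h₁ h₂ with h | ⟨u, hu, v, hv, rfl⟩
  · rw [eps_mem_PS x w h, eq_inv_iff_mul_eq_one, ← pow_two] at he
    exact absurd ((pow_eq_one_iff_left (two_ne_zero)).1 he) hw
  · rw [map_mul, map_mul, eps_mem_PS x u hu, eps_mem_PS x v hv, eps_self, mul_inv_rev, mul_inv_rev,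
      ← mul_assoc] at he
    obtain ⟨-, h2⟩ := of_inv_inj hu hv (inv_mem hv) (inv_mem hu) he
    exact ⟨u, hu, by rw [h2]⟩

theorem not_commute_of {i j : ℕ} (hij : i ≠ j) : ¬ Commute (of i : FreeGroup ℕ) (of j) := fun h =>
  FreeGroup.of_ne_one i
    (zpowers_inf_zpowers hij (Subgroup.mem_zpowers _) (exists_zpow_of_commute h))

/-- An automorphism `k` commuting with `x ↦ x⁻¹` and with the transvections `x ↦ d x` for `d` in
the span of `S` acts on `x` and on this span as a conjugation. -/
theorem exists_conj_of_commute {k : MulAut (FreeGroup ℕ)} {S : Set ℕ} (hxS : x ∉ S)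
    (hS : S.Nontrivial) (hkS : ∀ d ∈ FC S, k d ∈ FC {x}ᶜ)
    (hl : ∀ d ∈ FC S, k * lmul x d = lmul x d * k) (he : k * eps x = eps x * k) :
    ∃ u ∈ FC {x}ᶜ, k (of x) = u * of x * u⁻¹ ∧ ∀ d ∈ FC S, k d = u * d * u⁻¹ := by
  have hSx : FC S ≤ FC {x}ᶜ := FC_mono fun i hi h => hxS (h ▸ hi)
  obtain ⟨i, hi, j, hj, hij⟩ := hS
  have hlk : ∀ d ∈ FC S, lmul x d (k (of x)) = k d * k (of x) := fun d hd => by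
    rw [← MulAut.mul_apply, ← hl d hd, MulAut.mul_apply, lmul_self (hSx hd), map_mul]
  have hne : k (of x) ≠ 1 := fun h => FreeGroup.of_ne_one x
    (k.injective (h.trans (map_one k).symm))
  obtain ⟨u, hu, hux⟩ := exists_conj_form (hSx (of_mem_FC hi)) (hSx (of_mem_FC hj))
    (not_commute_of hij) (hkS _ (of_mem_FC hi)) (hkS _ (of_mem_FC hj)) (hlk _ (of_mem_FC hi)) (hlk _ (of_mem_FC hj)) hne
    (by rw [← MulAut.mul_apply, ← he, MulAut.mul_apply, eps_self, map_inv])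
  refine ⟨u, hu, hux, fun d hd => ?_⟩
  have h1 := hlk d hd
  rw [hux, map_mul, map_mul, map_inv, lmul_mem_PS x d u hu, lmul_self (hSx hd), ← mul_assoc,
    ← mul_assoc, ← mul_assoc] at h1
  obtain ⟨h2, -⟩ := of_inj (mul_mem hu (hSx hd)) (inv_mem hu) (mul_mem (hkS d hd) hu) (inv_mem hu) h1
  rw [h2, mul_inv_cancel_right]

/-- The subgroup `A` is not commutative. -/
def NC (A : Subgroup (FreeGroup ℕ)) : Prop := ∃ a ∈ A, ∃ b ∈ A, ¬ Commute a b

theorem NC.mono {A B : Subgroup (FreeGroup ℕ)} (h : NC A) (hAB : A ≤ B) : NC B := by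
  obtain ⟨a, ha, b, hb, hab⟩ := h
  exact ⟨a, hAB ha, b, hAB hb, hab⟩

theorem nc_FC {S : Set ℕ} (hS : S.Nontrivial) : NC (FC S) := by
  obtain ⟨i, hi, j, hj, hij⟩ := hS
  exact ⟨_, of_mem_FC hi, _, of_mem_FC hj, not_commute_of hij⟩

theorem nontrivial_Iio {n : ℕ} (hn : 2 ≤ n) : (Set.Iio n).Nontrivial :=
  ⟨0, Set.mem_Iio.2 (by omega), 1, Set.mem_Iio.2 (by omega), by decide⟩

theorem nc_Fn {n : ℕ} (hn : 2 ≤ n) : NC (Fn n) := nc_FC (nontrivial_Iio hn)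

theorem NC.eq_one {A : Subgroup (FreeGroup ℕ)} (hA : NC A) {w : FreeGroup ℕ}
    (h : ∀ a ∈ A, w * a * w⁻¹ = a) : w = 1 := by
  obtain ⟨a, ha, b, hb, hab⟩ := hA
  by_contra hw
  exact hab (commute_of_commute hw (mul_inv_eq_iff_eq_mul.1 (h a ha))
    (mul_inv_eq_iff_eq_mul.1 (h b hb)))

theorem toOut_eq_iff {g h : MulAut (FreeGroup ℕ)} :
    toOut g = toOut h ↔ ∃ w, h = g * MulAut.conj w := by
  have : toOut g = toOut h ↔ g⁻¹ * h ∈ Inn (FreeGroup ℕ) := QuotientGroup.eq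
  rw [this]
  constructor
  · rintro ⟨w, hw⟩
    exact ⟨w, by rw [hw, mul_inv_cancel_left]⟩
  · rintro ⟨w, rfl⟩
    exact ⟨w, by rw [inv_mul_cancel_left]⟩

theorem toOut_surjective : Function.Surjective (toOut : MulAut (FreeGroup ℕ) →* _) :=
  QuotientGroup.mk'_surjective _

theorem NC.eq_of_toOut {A : Subgroup (FreeGroup ℕ)} (hA : NC A) {g h : MulAut (FreeGroup ℕ)}
    (hg : g ∈ PS A) (hh : h ∈ PS A) (e : toOut g = toOut h) : g = h := by
  obtain ⟨w, rfl⟩ := toOut_eq_iff.1 e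
  have hw : MulAut.conj w ∈ PS A := by simpa using mul_mem (inv_mem hg) hh
  have : w = 1 := hA.eq_one fun a ha => hw a ha
  rw [this, map_one, mul_one]

theorem eq_conj_of_commute {k : MulAut (FreeGroup ℕ)} {m : ℕ} (hm : 2 ≤ m)
    (h : ∀ p ∈ PS (Fn m), k * p = p * k) : ∃ u, k = MulAut.conj u := by
  have hkm : ∀ d ∈ Fn m, k d ∈ Fn m := fun d hd => by
    refine (Fix_PS_FC (Set.Iio m)).le fun p hp => ?_
    rw [← MulAut.mul_apply, ← h p hp, MulAut.mul_apply, hp d hd]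
  have key : ∀ i, m ≤ i → ∃ u, k (of i) = u * of i * u⁻¹ ∧ ∀ d ∈ Fn m, k d = u * d * u⁻¹ := by
    intro i hi
    have hmi : Fn m ≤ FC {i}ᶜ := FC_mono fun j hj hji => by
      simp only [Set.mem_Iio, Set.mem_singleton_iff] at hj hji
      omega
    have hi' : i ∉ Set.Iio m := by simpa using hi
    obtain ⟨u, -, hu⟩ := exists_conj_of_commute (k := k) hi' (nontrivial_Iio hm)
      (fun d hd => hmi (hkm d hd))
      (fun d _ => h _ (PS_anti hmi (lmul_mem_PS _ _))) (h _ (PS_anti hmi (eps_mem_PS _)))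
    exact ⟨u, hu⟩
  obtain ⟨u, hu, hum⟩ := key m le_rfl
  refine ⟨u, aut_ext fun i => ?_⟩
  rw [MulAut.conj_apply]
  rcases lt_or_ge i m with hi | hi
  · exact hum _ (of_mem_Fn hi)
  · obtain ⟨v, hv, hvm⟩ := key i hi
    have : u⁻¹ * v = 1 := (nc_Fn hm).eq_one fun d hd => by
      have h1 : v * d * v⁻¹ = u * d * u⁻¹ := by rw [← hvm d hd, ← hum d hd]
      calc u⁻¹ * v * d * (u⁻¹ * v)⁻¹ = u⁻¹ * (v * d * v⁻¹) * u := by group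
        _ = d := by rw [h1]; group
    rw [hv, inv_mul_eq_one.1 this]

/-- An outer automorphism commuting with the pointwise stabilizer of a standard free factor of
finite rank is trivial. -/
theorem eq_one_of_commute_toOut {κ : OutAut (FreeGroup ℕ)} {n : ℕ}
    (h : ∀ p ∈ PS (Fn n), κ * toOut p = toOut p * κ) : κ = 1 := by
  obtain ⟨k, rfl⟩ := toOut_surjective κ
  obtain ⟨m, hm, hkm⟩ := exists_smul_Fn_le [k] (max n 2) (max n 2)
  have hk := hkm k (by simp)
  obtain ⟨u, hu⟩ := eq_conj_of_commute (k := k⁻¹) (m := m) (by omega) fun p hp => by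
    have h1 := h p (PS_anti (Fn_mono (by omega)) hp)
    have h2 : k⁻¹ * p * k ∈ PS (Fn (max n 2)) := fun d hd => by
      rw [MulAut.mul_apply, MulAut.mul_apply, hp _ (smul_le_iff.1 hk d hd), MulAut.inv_apply_self]
    have h3 := (nc_Fn (le_max_right n 2)).eq_of_toOut h2 (PS_anti (Fn_mono hm) hp) (by
      rw [map_mul, map_mul, mul_assoc, ← h1, map_inv, inv_mul_cancel_left])
    conv_rhs => rw [← h3]
    group
  rw [← inv_eq_one, ← map_inv, hu]
  exact (QuotientGroup.eq_one_iff _).2 ⟨u, rfl⟩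

end

/-! ### Lifting an automorphism of `Out F` to deep pointwise stabilizers -/

theorem countable_quotient {G ι : Type*} [Group G] [Countable ι] {H : Subgroup G} (f : G → ι)
    (hf : ∀ g g', f g = f g' → g⁻¹ * g' ∈ H) : Countable (G ⧸ H) := by
  refine Function.Injective.countable (f := fun q : G ⧸ H => f q.out) fun q q' h => ?_
  rw [← q.out_eq', ← q'.out_eq']
  exact QuotientGroup.eq.2 (hf _ _ h)

theorem exists_toOut_eq (Δ : MulAut (OutAut (FreeGroup ℕ))) (k : ℕ) :
    ∃ n, ∀ g ∈ PS (Fn n), ∃ h ∈ PS (Fn k), toOut h = Δ (toOut g) := by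
  choose r hr using fun g => toOut_surjective (Δ (toOut g))
  let H : Subgroup (MulAut (FreeGroup ℕ)) :=
    ((PS (Fn k)).map toOut).comap (Δ.toMonoidHom.comp toOut)
  have hH : Countable (MulAut (FreeGroup ℕ) ⧸ H) := by
    refine countable_quotient (fun g => fun i : Fin k => r g (of i)) fun g g' h => ?_
    refine ⟨(r g)⁻¹ * r g', inv_mul_mem_PS_iff.2 fun w hw => ?_, ?_⟩
    · refine (aut_eqOn (fun i hi => ?_) hw).symm
      exact congrFun h ⟨i, Set.mem_Iio.1 hi⟩
    · simp [hr]
  obtain ⟨n, hn⟩ := exists_PS_le hH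
  exact ⟨n, fun g hg => hn hg⟩

/-- `lam` is an injective homomorphism on the pointwise stabilizer of `Fn n₀` which, together
with its inverse, is compatible with the filtration by the pointwise stabilizers of the `Fn k`. -/
structure Lift (n₀ : ℕ) (lam : MulAut (FreeGroup ℕ) → MulAut (FreeGroup ℕ)) : Prop where
  map_mul : ∀ g ∈ PS (Fn n₀), ∀ h ∈ PS (Fn n₀), lam (g * h) = lam g * lam h
  inj : ∀ g ∈ PS (Fn n₀), ∀ h ∈ PS (Fn n₀), lam g = lam h → g = h
  tail : ∀ k, ∃ n ≥ n₀, ∀ g ∈ PS (Fn n), lam g ∈ PS (Fn k)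
  cotail : ∀ k, ∃ n, ∀ h ∈ PS (Fn n), ∃ g ∈ PS (Fn n₀), g ∈ PS (Fn k) ∧ lam g = h

theorem exists_lift (Δ : MulAut (OutAut (FreeGroup ℕ))) :
    ∃ n₀ lam, Lift n₀ lam ∧ ∀ g ∈ PS (Fn n₀), toOut (lam g) = Δ (toOut g) := by
  obtain ⟨n, hn⟩ := exists_toOut_eq Δ 2
  let n₀ := max n 2
  have hex : ∀ g, ∃ h, g ∈ PS (Fn n₀) → h ∈ PS (Fn 2) ∧ toOut h = Δ (toOut g) := fun g => by
    by_cases hg : g ∈ PS (Fn n₀)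
    · obtain ⟨h, h1, h2⟩ := hn g (PS_anti (Fn_mono (le_max_left _ _)) hg)
      exact ⟨h, fun _ => ⟨h1, h2⟩⟩
    · exact ⟨1, fun h => (hg h).elim⟩
  choose lam hlam using hex
  have uniq : ∀ g ∈ PS (Fn n₀), ∀ h ∈ PS (Fn 2), toOut h = Δ (toOut g) → lam g = h :=
    fun g hg h hh e => (nc_Fn le_rfl).eq_of_toOut (hlam g hg).1 hh ((hlam g hg).2.trans e.symm)
  refine ⟨n₀, lam, ⟨?_, ?_, ?_, ?_⟩, fun g hg => (hlam g hg).2⟩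
  · intro g hg h hh
    refine uniq _ (mul_mem hg hh) _ (mul_mem (hlam g hg).1 (hlam h hh).1) ?_
    rw [_root_.map_mul, _root_.map_mul, _root_.map_mul, (hlam g hg).2, (hlam h hh).2]
  · intro g hg h hh e
    refine (nc_Fn (le_max_right n 2)).eq_of_toOut hg hh (Δ.injective ?_)
    rw [← (hlam g hg).2, ← (hlam h hh).2, e]
  · intro k
    obtain ⟨m, hm⟩ := exists_toOut_eq Δ (max k 2)
    refine ⟨max m n₀, le_max_right _ _, fun g hg => ?_⟩
    obtain ⟨h, h1, h2⟩ := hm g (PS_anti (Fn_mono (le_max_left _ _)) hg)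
    rw [uniq g (PS_anti (Fn_mono (le_max_right _ _)) hg) h
      (PS_anti (Fn_mono (le_max_right _ _)) h1) h2]
    exact PS_anti (Fn_mono (le_max_left _ _)) h1
  · intro k
    obtain ⟨m, hm⟩ := exists_toOut_eq Δ⁻¹ (max k n₀)
    refine ⟨max m 2, fun h hh => ?_⟩
    obtain ⟨g, h1, h2⟩ := hm h (PS_anti (Fn_mono (le_max_left _ _)) hh)
    have hg := PS_anti (Fn_mono (le_max_right _ _)) h1
    refine ⟨g, hg, PS_anti (Fn_mono (le_max_left _ _)) h1,
      uniq g hg h (PS_anti (Fn_mono (le_max_right _ _)) hh) ?_⟩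
    rw [h2, MulAut.apply_inv_self]

/-- `lam` maps the pointwise stabilizer of `A` onto the pointwise stabilizer of `B`. -/
structure Matches (lam : MulAut (FreeGroup ℕ) → MulAut (FreeGroup ℕ))
    (A B : Subgroup (FreeGroup ℕ)) : Prop where
  mem : ∀ g ∈ PS A, lam g ∈ PS B
  exists_eq : ∀ h ∈ PS B, ∃ g ∈ PS A, lam g = h

namespace Lift

variable {n₀ : ℕ} {lam : MulAut (FreeGroup ℕ) → MulAut (FreeGroup ℕ)}

theorem map_one (L : Lift n₀ lam) : lam 1 = 1 := by
  have := L.map_mul 1 (one_mem _) 1 (one_mem _)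
  rwa [mul_one, left_eq_mul] at this

theorem map_inv (L : Lift n₀ lam) {g : MulAut (FreeGroup ℕ)} (hg : g ∈ PS (Fn n₀)) :
    lam g⁻¹ = (lam g)⁻¹ := by
  rw [eq_inv_iff_mul_eq_one, ← L.map_mul _ (inv_mem hg) _ hg, inv_mul_cancel, L.map_one]

theorem map_conj (L : Lift n₀ lam) {g h : MulAut (FreeGroup ℕ)} (hg : g ∈ PS (Fn n₀))
    (hh : h ∈ PS (Fn n₀)) : lam (g * h * g⁻¹) = lam g * lam h * (lam g)⁻¹ := by
  rw [L.map_mul _ (mul_mem hg hh) _ (inv_mem hg), L.map_mul _ hg _ hh, L.map_inv hg]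

theorem exists_symm (L : Lift n₀ lam) : ∃ n₁ mu, Lift n₁ mu ∧
    ∀ h ∈ PS (Fn n₁), mu h ∈ PS (Fn n₀) ∧ lam (mu h) = h := by
  obtain ⟨n₁, hn₁⟩ := L.cotail 0
  have hex : ∀ h, ∃ g, h ∈ PS (Fn n₁) → g ∈ PS (Fn n₀) ∧ lam g = h := fun h => by
    by_cases hh : h ∈ PS (Fn n₁)
    · obtain ⟨g, h1, -, h2⟩ := hn₁ h hh
      exact ⟨g, fun _ => ⟨h1, h2⟩⟩
    · exact ⟨1, fun h => (hh h).elim⟩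
  choose mu hmu using hex
  have uniq : ∀ h ∈ PS (Fn n₁), ∀ g ∈ PS (Fn n₀), lam g = h → mu h = g :=
    fun h hh g hg e => L.inj _ (hmu h hh).1 _ hg ((hmu h hh).2.trans e.symm)
  refine ⟨n₁, mu, ⟨?_, ?_, ?_, ?_⟩, hmu⟩
  · intro g hg h hh
    refine uniq _ (mul_mem hg hh) _ (mul_mem (hmu g hg).1 (hmu h hh).1) ?_
    rw [L.map_mul _ (hmu g hg).1 _ (hmu h hh).1, (hmu g hg).2, (hmu h hh).2]
  · intro g hg h hh e
    rw [← (hmu g hg).2, e, (hmu h hh).2]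
  · intro k
    obtain ⟨m, hm⟩ := L.cotail k
    refine ⟨max m n₁, le_max_right _ _, fun h hh => ?_⟩
    obtain ⟨g, h1, h2, h3⟩ := hm h (PS_anti (Fn_mono (le_max_left _ _)) hh)
    rwa [uniq h (PS_anti (Fn_mono (le_max_right _ _)) hh) g h1 h3]
  · intro k
    obtain ⟨m, hm, h⟩ := L.tail (max k n₁)
    refine ⟨m, fun g hg => ?_⟩
    have h1 := PS_anti (Fn_mono (le_max_right _ _)) (h g hg)
    exact ⟨lam g, h1, PS_anti (Fn_mono (le_max_left _ _)) (h g hg),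
      uniq _ h1 g (PS_anti (Fn_mono hm) hg) rfl⟩

end Lift

theorem PS_Fn_le_of_le {n m t : ℕ} (h : m ≤ t) {e : Equiv.Perm ℕ} (he1 : ∀ i < n, e i = i)
    (he2 : ∀ i, n ≤ i → i < m → e i = i + t)
    {M : Subgroup (MulAut (FreeGroup ℕ))} (h1 : PS (Fn m) ≤ M)
    (h2 : PS (permAut e • Fn m) ≤ M) : PS (Fn n) ≤ M := by
  intro g hg
  obtain ⟨N, q, hmN, hq1, -, hq3⟩ := exists_finitary g m
  obtain ⟨p, hp1, hp2, hp3⟩ := exists_shift_perm n m (N + m + t) (by omega)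
  have hpM : permAut p ∈ M := by
    refine h2 ?_
    rw [permAut_smul_FC]
    refine permAut_mem_PS ?_
    rintro _ ⟨i, hi, rfl⟩
    have hi := Set.mem_Iio.1 hi
    by_cases hin : i < n
    · rw [he1 i hin, hp1 i hin]
    · rw [he2 i (by omega) hi]
      exact hp3 _ (by omega) (by omega)
  have hqM : q ∈ M := by
    have : (permAut p)⁻¹ * q * permAut p ∈ M := by
      refine h1 ?_
      have : q ∈ PS (permAut p • Fn m) := by
        rw [permAut_smul_FC, mem_PS_FC]
        rintro _ ⟨i, hi, rfl⟩
        have hi := Set.mem_Iio.1 hi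
        by_cases hin : i < n
        · rw [hp1 i hin, hq1 _ (of_mem_Fn hi), hg _ (of_mem_Fn hin)]
        · rw [hp2 i (by omega) hi]
          exact hq3 _ (by omega)
      rw [← conj_mem_PS (g := permAut p)]
      simpa [mul_assoc] using this
    have := mul_mem (mul_mem hpM this) (inv_mem hpM)
    simpa [mul_assoc] using this
  have : q⁻¹ * g ∈ M := h1 (inv_mul_mem_PS_iff.2 fun w hw => (hq1 w hw).symm)
  simpa using mul_mem hqM this

/-! ### The induced correspondence between free factors -/

theorem conj_mem_PS_of_smul_eq {g p : MulAut (FreeGroup ℕ)} {S T : Subgroup (FreeGroup ℕ)}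
    (h : g • S = T) : g * p * g⁻¹ ∈ PS T ↔ p ∈ PS S := h ▸ conj_mem_PS

theorem inv_conj_mem_PS {g p : MulAut (FreeGroup ℕ)} {S : Subgroup (FreeGroup ℕ)} :
    g⁻¹ * p * g ∈ PS S ↔ p ∈ PS (g • S) := by
  rw [← conj_mem_PS (g := g)]
  simp only [mul_assoc, mul_inv_cancel, mul_one, mul_inv_cancel_left]

theorem IsFF.Fix_PS {A : Subgroup (FreeGroup ℕ)} (hA : IsFF A) : Fix (PS A) ≤ A := by
  obtain ⟨σ, n, rfl⟩ := hA
  intro w hw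
  rw [mem_smul_iff]
  refine (Fix_PS_FC (Set.Iio n)).le fun p hp => ?_
  have := hw _ (conj_mem_PS.2 hp : σ * p * σ⁻¹ ∈ _)
  rw [MulAut.mul_apply, MulAut.mul_apply] at this
  apply σ.injective
  rw [this, MulAut.apply_inv_self]

theorem IsFF.le_of_PS_le {A B : Subgroup (FreeGroup ℕ)} (hA : IsFF A) (h : PS A ≤ PS B) :
    B ≤ A := (le_PS_iff.1 h).trans hA.Fix_PS

theorem swap_smul_FC {C : Set ℕ} {i j : ℕ} (h : i ∈ C ↔ j ∈ C) :
    permAut (Equiv.swap i j) • FC C = FC C := by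
  rw [permAut_smul_FC]
  congr 1
  ext k
  rw [Equiv.image_eq_preimage_symm, Set.mem_preimage, Equiv.symm_swap]
  rcases eq_or_ne k i with rfl | hi
  · rw [Equiv.swap_apply_left, h]
  rcases eq_or_ne k j with rfl | hj
  · rw [Equiv.swap_apply_right, h]
  rw [Equiv.swap_apply_of_ne_of_ne hi hj]

namespace Lift

variable {n₀ : ℕ} {lam : MulAut (FreeGroup ℕ) → MulAut (FreeGroup ℕ)}

/-- The image under `lam` of the pointwise stabilizer of `A`. -/
def image (L : Lift n₀ lam) (A : Subgroup (FreeGroup ℕ)) (hA : Fn n₀ ≤ A) :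
    Subgroup (MulAut (FreeGroup ℕ)) where
  carrier := {h | ∃ g ∈ PS A, lam g = h}
  one_mem' := ⟨1, one_mem _, L.map_one⟩
  mul_mem' := by
    rintro _ _ ⟨g, hg, rfl⟩ ⟨h, hh, rfl⟩
    exact ⟨g * h, mul_mem hg hh, L.map_mul _ (PS_anti hA hg) _ (PS_anti hA hh)⟩
  inv_mem' := by
    rintro _ ⟨g, hg, rfl⟩
    exact ⟨g⁻¹, inv_mem hg, L.map_inv (PS_anti hA hg)⟩

/-- The elements of the pointwise stabilizer of `Fn n₀` whose image under `lam` fixes `b`. -/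
def stab (L : Lift n₀ lam) (b : FreeGroup ℕ) : Subgroup (MulAut (FreeGroup ℕ)) where
  carrier := {g | g ∈ PS (Fn n₀) ∧ lam g b = b}
  one_mem' := ⟨one_mem _, by rw [L.map_one]; rfl⟩
  mul_mem' := by
    rintro g h ⟨hg, h1⟩ ⟨hh, h2⟩
    exact ⟨mul_mem hg hh, by rw [L.map_mul _ hg _ hh, MulAut.mul_apply, h2, h1]⟩
  inv_mem' := by
    rintro g ⟨hg, h1⟩
    refine ⟨inv_mem hg, ?_⟩
    rw [L.map_inv hg]
    nth_rw 1 [← h1]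
    rw [MulAut.inv_apply_self]

theorem matches_smul (L : Lift n₀ lam) {A B : Subgroup (FreeGroup ℕ)} (hA : Fn n₀ ≤ A)
    (h : Matches lam A B) {σ : MulAut (FreeGroup ℕ)} (hσ : σ ∈ PS (Fn n₀)) :
    Matches lam (σ • A) (lam σ • B) := by
  have key : ∀ p ∈ PS A, lam (σ * p * σ⁻¹) = lam σ * lam p * (lam σ)⁻¹ :=
    fun p hp => L.map_conj hσ (PS_anti hA hp)
  refine ⟨fun g hg => ?_, fun g hg => ?_⟩
  · have h1 := inv_conj_mem_PS.2 hg
    have h2 := key _ h1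
    rw [show σ * (σ⁻¹ * g * σ) * σ⁻¹ = g by group] at h2
    rw [h2]
    exact conj_mem_PS.2 (h.mem _ h1)
  · obtain ⟨p, hp, e⟩ := h.exists_eq _ (inv_conj_mem_PS.2 hg)
    refine ⟨σ * p * σ⁻¹, conj_mem_PS.2 hp, ?_⟩
    rw [key p hp, e]
    group

theorem smul_Fix_image (L : Lift n₀ lam) {A : Subgroup (FreeGroup ℕ)} (hA : Fn n₀ ≤ A)
    {σ : MulAut (FreeGroup ℕ)} (hσ : σ ∈ PS (Fn n₀)) (hσA : σ • A = A) :
    lam σ • Fix (L.image A hA) = Fix (L.image A hA) := by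
  have key : ∀ τ ∈ PS (Fn n₀), τ • A = A → lam τ • Fix (L.image A hA) ≤ Fix (L.image A hA) := by
    refine fun τ hτ hτA => smul_le_iff.2 ?_
    rintro b hb _ ⟨g, hg, rfl⟩
    have h1 : τ⁻¹ * g * τ ∈ PS A := inv_conj_mem_PS.2 (by rwa [hτA])
    have h2 := L.map_conj hτ (PS_anti hA h1)
    rw [show τ * (τ⁻¹ * g * τ) * τ⁻¹ = g by group] at h2
    rw [h2, MulAut.mul_apply, MulAut.inv_apply_self, MulAut.mul_apply, hb _ ⟨_, h1, rfl⟩]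
  refine le_antisymm (key σ hσ hσA) ?_
  have := key σ⁻¹ (inv_mem hσ) (by rw [inv_smul_eq_iff, hσA])
  rwa [L.map_inv hσ, Subgroup.pointwise_smul_subset_iff, inv_inv] at this

theorem exists_matches_Fn (L : Lift n₀ lam) :
    ∃ N ≥ n₀, ∀ n ≥ N, ∃ B, IsFF B ∧ Matches lam (Fn n) B := by
  obtain ⟨m, hm⟩ := L.cotail (n₀ + 1)
  obtain ⟨n₃, hn₃, htail⟩ := L.tail m
  refine ⟨n₃, hn₃, fun n hn => ?_⟩
  have hA : Fn n₀ ≤ Fn n := Fn_mono (hn₃.trans hn)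
  let B := Fix (L.image (Fn n) hA)
  have hmem : ∀ g ∈ PS (Fn n), lam g ∈ PS B := fun g hg b hb => hb _ ⟨g, hg, rfl⟩
  refine ⟨B, ?_, hmem, fun h hh => ?_⟩
  · obtain ⟨k, hk⟩ := L.cotail n
    obtain ⟨m', hm', ht⟩ := L.tail k
    have hBk : B ≤ Fn k := by
      refine le_trans (Fix_anti ?_) (Fix_PS_FC (Set.Iio k)).le
      intro h hh
      obtain ⟨g, -, h2, h3⟩ := hk h hh
      exact ⟨g, h2, h3⟩
    obtain ⟨e, he1, he2, -⟩ := exists_shift_perm n m' m' le_rfl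
    have hu : permAut e ∈ PS (Fn n) := permAut_mem_PS he1
    have hu0 := PS_anti hA hu
    have hB : B = Fn k ⊓ lam (permAut e) • Fn k := by
      apply le_antisymm
      · refine le_inf hBk fun b hb => ?_
        rw [← hmem _ hu b hb]
        exact apply_mem_smul_iff.2 (hBk hb)
      · rintro b ⟨hb1, hb2⟩
        have : PS (Fn n) ≤ L.stab b := by
          refine PS_Fn_le_of_le le_rfl he1 he2 (fun g hg => ?_) fun g hg => ?_
          · exact ⟨PS_anti (Fn_mono hm') hg, ht g hg b hb1⟩
          · have h1 := inv_conj_mem_PS.2 hg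
            have h2 := PS_anti (Fn_mono hm') h1
            rw [show g = permAut e * ((permAut e)⁻¹ * g * permAut e) * (permAut e)⁻¹ by group]
            refine ⟨mul_mem (mul_mem hu0 h2) (inv_mem hu0), ?_⟩
            rw [L.map_conj hu0 h2]
            exact conj_mem_PS.2 (ht _ h1) b hb2
        rintro _ ⟨g, hg, rfl⟩
        exact (this hg).2
    rw [hB]
    exact (isFF_Fn k).inf ((isFF_Fn k).smul _)
  · have hmB : Fn m ≤ B := by
      refine le_PS_iff.1 ?_
      rintro _ ⟨g, hg, rfl⟩
      exact htail g (PS_anti (Fn_mono hn) hg)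
    have deep : ∀ g ∈ PS (Fn n₀), lam g ∈ PS B → g ∈ PS (Fn (n₀ + 1)) := fun g hg h1 => by
      obtain ⟨g', h2, h3, h4⟩ := hm _ (PS_anti hmB h1)
      rwa [← L.inj _ h2 _ hg h4]
    obtain ⟨g, hg, -, rfl⟩ := hm h (PS_anti hmB hh)
    refine ⟨g, mem_PS_FC.2 fun i hi => ?_, rfl⟩
    have hi := Set.mem_Iio.1 hi
    by_cases hin : i < n₀
    · exact hg _ (of_mem_Fn hin)
    let P := permAut (Equiv.swap n₀ i)
    have hP : P ∈ PS (Fn n₀) := permAut_mem_PS fun j hj => by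
      have hj := Set.mem_Iio.1 hj
      exact Equiv.swap_apply_of_ne_of_ne (by omega) (by omega)
    have hPn : P • Fn n = Fn n := swap_smul_FC (by simp only [Set.mem_Iio]; omega)
    have hPB : lam P • B = B := L.smul_Fix_image hA hP hPn
    have := deep (P * g * P⁻¹) (mul_mem (mul_mem hP hg) (inv_mem hP)) (by
      rw [L.map_conj hP hg]
      exact (conj_mem_PS_of_smul_eq hPB).2 hh) (of n₀) (of_mem_Fn (Nat.lt_succ_self _))
    rw [MulAut.mul_apply, MulAut.mul_apply] at this
    have hPi : P (of i) = of n₀ := by simp [P]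
    rw [← hPi, MulAut.inv_apply_self] at this
    exact P.injective this

theorem exists_matches (L : Lift n₀ lam) :
    ∃ N ≥ n₀, ∀ A, IsFF A → Fn N ≤ A → ∃ B, IsFF B ∧ Matches lam A B := by
  obtain ⟨N, hN, h⟩ := L.exists_matches_Fn
  refine ⟨N, hN, fun A hA hNA => ?_⟩
  obtain ⟨σ, M, hM, h1, rfl⟩ := hA.exists_adapted (σ := 1) (k := N) (by rwa [one_smul])
  obtain ⟨B, hB, hm⟩ := h M hM
  exact ⟨_, hB.smul _, L.matches_smul (Fn_mono (hN.trans hM)) hm (PS_anti (Fn_mono hN) h1)⟩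

end Lift

/-! ### Pairs of free factors of corank one -/

theorem Lift.le_of_le {n₀ : ℕ} {lam : MulAut (FreeGroup ℕ) → MulAut (FreeGroup ℕ)}
    (L : Lift n₀ lam) {A A' B B' : Subgroup (FreeGroup ℕ)} (h : Matches lam A B)
    (h' : Matches lam A' B') (hA : Fn n₀ ≤ A) (hA₀' : Fn n₀ ≤ A') (hA' : IsFF A') (hB : B ≤ B') :
    A ≤ A' := by
  refine hA'.le_of_PS_le fun p hp => ?_
  obtain ⟨g, hg, e⟩ := h.exists_eq _ (PS_anti hB (h'.mem p hp))
  rwa [← L.inj _ (PS_anti hA hg) _ (PS_anti hA₀' hp) e]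

theorem Matches.le_of_le {lam : MulAut (FreeGroup ℕ) → MulAut (FreeGroup ℕ)}
    {A A' B B' : Subgroup (FreeGroup ℕ)} (h : Matches lam A B) (h' : Matches lam A' B')
    (hB' : IsFF B') (hA : A ≤ A') : B ≤ B' := by
  refine hB'.le_of_PS_le fun p hp => ?_
  obtain ⟨g, hg, rfl⟩ := h'.exists_eq p hp
  exact h.mem _ (PS_anti hA hg)

theorem IsFF.eq_or_eq {A' : Subgroup (FreeGroup ℕ)} (hA' : IsFF A') {τ : MulAut (FreeGroup ℕ)}
    {n : ℕ} (h1 : τ • Fn n ≤ A') (h2 : A' ≤ τ • Fn (n + 1)) :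
    A' = τ • Fn n ∨ A' = τ • Fn (n + 1) := by
  obtain ⟨τ', n', hn, e1, rfl⟩ := hA'.exists_adapted h1
  obtain ⟨τ'', n'', hn', e2, e3⟩ := ((isFF_Fn (n + 1)).smul τ).exists_adapted h2
  have : n'' = n + 1 := rank_eq (g := τ⁻¹ * τ'') (by rw [mul_smul, e3, inv_smul_smul])
  obtain rfl | rfl : n' = n ∨ n' = n + 1 := by omega
  · exact .inl (smul_eq_of_eqOn e1)
  · right
    rw [← e3, this]
    exact (smul_eq_of_eqOn e2).symm

theorem of_notMem_Fn (n : ℕ) : of n ∉ Fn n := fun h =>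
  lt_irrefl n (Set.mem_Iio.1 (of_mem_FC_iff.1 h))

theorem Lift.exists_matches_pair {n₀ : ℕ} {lam : MulAut (FreeGroup ℕ) → MulAut (FreeGroup ℕ)}
    (L : Lift n₀ lam) : ∃ N ≥ n₀, ∀ (τ : MulAut (FreeGroup ℕ)) (n : ℕ), Fn N ≤ τ • Fn n →
      ∃ (σ : MulAut (FreeGroup ℕ)) (k : ℕ), Matches lam (τ • Fn n) (σ • Fn k) ∧
        Matches lam (τ • Fn (n + 1)) (σ • Fn (k + 1)) := by
  obtain ⟨N₁, hN₁, h₁⟩ := L.exists_matches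
  obtain ⟨n₁, mu, L', hmu⟩ := L.exists_symm
  obtain ⟨N₂, hN₂, h₂⟩ := L'.exists_matches
  obtain ⟨N₃, hN₃, h₃⟩ := L.tail N₂
  refine ⟨max N₁ N₃, by omega, fun τ n hA => ?_⟩
  have hA₁ : Fn N₁ ≤ τ • Fn n := (Fn_mono (le_max_left _ _)).trans hA
  have hA₃ : Fn N₃ ≤ τ • Fn n := (Fn_mono (le_max_right _ _)).trans hA
  have hA₀ : Fn n₀ ≤ τ • Fn n := (Fn_mono hN₁).trans hA₁
  have hAA : τ • Fn n ≤ τ • Fn (n + 1) :=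
    Subgroup.pointwise_smul_le_pointwise_smul_iff.2 (Fn_mono (Nat.le_succ n))
  obtain ⟨B, hB, m⟩ := h₁ _ ((isFF_Fn n).smul τ) hA₁
  obtain ⟨B', hB', m'⟩ := h₁ _ ((isFF_Fn (n + 1)).smul τ) (hA₁.trans hAA)
  have hBB : B ≤ B' := m.le_of_le m' hB' hAA
  have hNB : Fn N₂ ≤ B := by
    refine hB.le_of_PS_le fun p hp => ?_
    obtain ⟨g, hg, rfl⟩ := m.exists_eq p hp
    exact h₃ g (PS_anti hA₃ hg)
  have hmulam : ∀ g ∈ PS (τ • Fn n), mu (lam g) = g := fun g hg => by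
    have h1 := hmu (lam g) (PS_anti ((Fn_mono hN₂).trans hNB) (m.mem g hg))
    exact L.inj _ h1.1 _ (PS_anti hA₀ hg) h1.2
  have hmuB : ∀ h ∈ PS B, lam (mu h) = h := fun h hh =>
    (hmu h (PS_anti ((Fn_mono hN₂).trans hNB) hh)).2
  have between : ∀ B'', IsFF B'' → B ≤ B'' → B'' ≤ B' → B'' = B ∨ B'' = B' := by
    intro B'' hB'' h1 h2
    obtain ⟨A'', hA'', m''⟩ := h₂ B'' hB'' (hNB.trans h1)
    have hle : τ • Fn n ≤ A'' := by
      refine hA''.le_of_PS_le fun p hp => ?_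
      obtain ⟨h, hh, rfl⟩ := m''.exists_eq p hp
      obtain ⟨g, hg, rfl⟩ := m.exists_eq h (PS_anti h1 hh)
      rwa [hmulam g hg]
    have hlam : Matches lam A'' B'' := by
      refine ⟨fun g hg => ?_, fun h hh => ?_⟩
      · obtain ⟨h, hh, rfl⟩ := m''.exists_eq g hg
        rwa [hmuB h (PS_anti h1 hh)]
      · exact ⟨mu h, m''.mem h hh, hmuB h (PS_anti h1 hh)⟩
    have hle' : A'' ≤ τ • Fn (n + 1) := by
      refine ((isFF_Fn _).smul τ).le_of_PS_le fun p hp => ?_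
      rw [← hmulam p (PS_anti hAA hp)]
      exact m''.mem _ (PS_anti h2 (m'.mem p hp))
    rcases hA''.eq_or_eq hle hle' with rfl | rfl
    · exact .inl (le_antisymm (hlam.le_of_le m hB le_rfl) h1)
    · exact .inr (le_antisymm h2 (m'.le_of_le hlam hB'' le_rfl))
  obtain ⟨σ₀, k, rfl⟩ := hB
  obtain ⟨σ, M, hM, e, rfl⟩ := hB'.exists_adapted hBB
  have e' : σ • Fn k = σ₀ • Fn k := smul_eq_of_eqOn e
  have hlt : k ≠ M := by
    rintro rfl
    have h1 : τ • Fn (n + 1) ≤ τ • Fn n := by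
      refine ((isFF_Fn _).smul τ).le_of_PS_le fun p hp => ?_
      have h2 := m.mem p hp
      rw [← e'] at h2
      obtain ⟨g, hg, h3⟩ := m'.exists_eq _ h2
      rwa [← L.inj _ (PS_anti (hA₀.trans hAA) hg) _ (PS_anti hA₀ hp) h3]
    have h2 := (Subgroup.pointwise_smul_le_pointwise_smul_iff.1 h1) (of_mem_Fn (Nat.lt_succ_self n))
    exact of_notMem_Fn n h2
  refine ⟨σ, k, by rwa [e'], ?_⟩
  rcases between (σ • Fn (k + 1)) ((isFF_Fn _).smul σ)
    (by rw [← e']; exact Subgroup.pointwise_smul_le_pointwise_smul_iff.2 (Fn_mono (Nat.le_succ k)))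
    (Subgroup.pointwise_smul_le_pointwise_smul_iff.2 (Fn_mono (by omega))) with h | h
  · rw [← e'] at h
    have := (MulAction.injective σ h).le (of_mem_Fn (Nat.lt_succ_self k))
    exact (of_notMem_Fn k this).elim
  · rwa [h]

theorem FC_le_compl {x : ℕ} {C : Set ℕ} (hx : x ∉ C) : FC C ≤ FC {x}ᶜ :=
  FC_mono fun i hi h => hx (by rwa [Set.mem_singleton_iff.1 h] at hi)

theorem lmul_inv {x : ℕ} {d : FreeGroup ℕ} (hd : d ∈ FC {x}ᶜ) : (lmul x d)⁻¹ = lmul x d⁻¹ := by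
  rw [inv_eq_iff_mul_eq_one, lmul_mul hd (inv_mem hd), inv_mul_cancel, lmul_one]

theorem lmul_smul_FC {x : ℕ} {C : Set ℕ} (hx : x ∉ C) {d : FreeGroup ℕ} (hd : d ∈ FC C) :
    lmul x d • FC (insert x C) = FC (insert x C) := by
  have hle : ∀ c ∈ FC C, lmul x c • FC (insert x C) ≤ FC (insert x C) := fun c hc => by
    refine smul_FC_le.2 fun i hi => ?_
    by_cases hix : i = x
    · subst hix
      rw [lmul_self (FC_le_compl hx hc)]
      exact mul_mem (FC_mono (Set.subset_insert _ _) hc) (of_mem_FC hi)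
    · rw [lmul_of_ne _ hix]
      exact of_mem_FC hi
  refine le_antisymm (hle _ hd) ?_
  have := hle _ (inv_mem hd)
  rwa [← lmul_inv (FC_le_compl hx hd), Subgroup.pointwise_smul_subset_iff, inv_inv] at this

theorem eps_smul_FC {x : ℕ} {C : Set ℕ} (hx : x ∈ C) : eps x • FC C = FC C := by
  have hle : eps x • FC C ≤ FC C := by
    refine smul_FC_le.2 fun i hi => ?_
    by_cases hix : i = x
    · subst hix
      rw [eps_self]
      exact inv_mem (of_mem_FC hi)
    · rw [eps_of_ne hix]
      exact of_mem_FC hi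
  refine le_antisymm hle ?_
  rwa [Subgroup.pointwise_smul_subset_iff, inv_eq_of_mul_eq_one_left (eps_mul_self x)] at hle

/-- `K'` is the free product of `K` and of the cyclic group generated by `y`, and is a free
factor of finite rank. -/
def IsPair (K K' : Subgroup (FreeGroup ℕ)) (y : FreeGroup ℕ) : Prop :=
  ∃ (σ : MulAut (FreeGroup ℕ)) (k : ℕ), σ • Fn k = K ∧ σ • Fn (k + 1) = K' ∧ σ (of k) = y

namespace IsPair

variable {K K' : Subgroup (FreeGroup ℕ)} {y : FreeGroup ℕ}

theorem smul (h : IsPair K K' y) (τ : MulAut (FreeGroup ℕ)) :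
    IsPair (τ • K) (τ • K') (τ y) := by
  obtain ⟨σ, k, rfl, rfl, rfl⟩ := h
  exact ⟨τ * σ, k, mul_smul _ _ _, mul_smul _ _ _, rfl⟩

theorem isFF (h : IsPair K K' y) : IsFF K := by
  obtain ⟨σ, k, rfl, rfl, rfl⟩ := h
  exact ⟨σ, k, rfl⟩

theorem isFF' (h : IsPair K K' y) : IsFF K' := by
  obtain ⟨σ, k, rfl, rfl, rfl⟩ := h
  exact ⟨σ, k + 1, rfl⟩

theorem le (h : IsPair K K' y) : K ≤ K' := by
  obtain ⟨σ, k, rfl, rfl, rfl⟩ := h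
  exact Subgroup.pointwise_smul_le_pointwise_smul_iff.2 (Fn_mono (Nat.le_succ k))

theorem mem (h : IsPair K K' y) : y ∈ K' := by
  obtain ⟨σ, k, rfl, rfl, rfl⟩ := h
  exact apply_mem_smul_iff.2 (of_mem_Fn (Nat.lt_succ_self k))

theorem ne_one (h : IsPair K K' y) : y ≠ 1 := by
  obtain ⟨σ, k, rfl, rfl, rfl⟩ := h
  exact fun h => FreeGroup.of_ne_one k (σ.injective (h.trans (map_one σ).symm))

theorem le_of (h : IsPair K K' y) {H : Subgroup (FreeGroup ℕ)} (hK : K ≤ H) (hy : y ∈ H) :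
    K' ≤ H := by
  obtain ⟨σ, k, rfl, rfl, rfl⟩ := h
  refine smul_FC_le.2 fun i hi => ?_
  have hi := Set.mem_Iio.1 hi
  obtain rfl | hik : i = k ∨ i < k := by omega
  · exact hy
  · exact hK (apply_mem_smul_iff.2 (of_mem_Fn hik))

theorem mem_PS (h : IsPair K K' y) {g : MulAut (FreeGroup ℕ)} (hg : g ∈ PS K) (hy : g y = y) :
    g ∈ PS K' := by
  refine le_PS_iff.2 (h.le_of (le_PS_iff.1 ?_) ?_) (Subgroup.mem_zpowers g)
  · rwa [Subgroup.zpowers_le]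
  · have : Subgroup.zpowers g ≤ MulAction.stabilizer (MulAut (FreeGroup ℕ)) y := by
      rw [Subgroup.zpowers_le]; exact hy
    exact fun p hp => this hp

theorem Fn_le_compl (k : ℕ) : Fn k ≤ FC {k}ᶜ := FC_le_compl Set.self_notMem_Iio

theorem insert_Iio (k : ℕ) : insert k (Set.Iio k) = Set.Iio (k + 1) := by
  ext i
  simp only [Set.mem_insert_iff, Set.mem_Iio]
  omega

theorem exists_apply_eq (h : IsPair K K' y) {g : MulAut (FreeGroup ℕ)} (hg : g ∈ PS K)
    (hK' : g • K' = K') :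
    ∃ u ∈ K, ∃ v ∈ K, g y = u * y * v ∨ g y = u * y⁻¹ * v := by
  obtain ⟨σ, k, rfl, rfl, rfl⟩ := h
  obtain ⟨u, hu, v, hv, huv⟩ := exists_apply_eq_of_insert (x := k) (C := Set.Iio k)
    (inv_conj_mem_PS.2 hg) (by
      rw [insert_Iio, mul_smul, mul_smul, hK', inv_smul_smul])
  refine ⟨σ u, apply_mem_smul_iff.2 hu, σ v, apply_mem_smul_iff.2 hv, ?_⟩
  have key : ∀ w, (σ⁻¹ * g * σ) (of k) = w → g (σ (of k)) = σ w := fun w e => by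
    rw [← e, ← MulAut.mul_apply, ← MulAut.mul_apply]
    group
  refine huv.imp (fun e => ?_) fun e => ?_
  · rw [key _ e, map_mul, map_mul]
  · rw [key _ e, map_mul, map_mul, map_inv]

theorem inj (h : IsPair K K' y) {u v u' v' : FreeGroup ℕ} (hu : u ∈ K) (hv : v ∈ K)
    (hu' : u' ∈ K) (hv' : v' ∈ K) (e : u * y * v = u' * y * v') : u = u' ∧ v = v' := by
  obtain ⟨σ, k, rfl, rfl, rfl⟩ := h
  have h1 := of_inj (Fn_le_compl k (mem_smul_iff.1 hu)) (Fn_le_compl k (mem_smul_iff.1 hv))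
    (Fn_le_compl k (mem_smul_iff.1 hu')) (Fn_le_compl k (mem_smul_iff.1 hv')) (by
      apply σ.injective
      simpa only [map_mul, MulAut.apply_inv_self] using e)
  exact ⟨σ⁻¹.injective h1.1, σ⁻¹.injective h1.2⟩

theorem ne_inv (h : IsPair K K' y) {u v u' v' : FreeGroup ℕ} (hu : u ∈ K) (hv : v ∈ K)
    (hu' : u' ∈ K) (hv' : v' ∈ K) : u * y * v ≠ u' * y⁻¹ * v' := by
  obtain ⟨σ, k, rfl, rfl, rfl⟩ := h
  intro e
  refine of_ne_of_inv (Fn_le_compl k (mem_smul_iff.1 hu)) (Fn_le_compl k (mem_smul_iff.1 hv))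
    (Fn_le_compl k (mem_smul_iff.1 hu')) (Fn_le_compl k (mem_smul_iff.1 hv')) ?_
  apply σ.injective
  simpa only [map_mul, MulAut.apply_inv_self, map_inv] using e

theorem exists_lmul (h : IsPair K K' y) {d : FreeGroup ℕ} (hd : d ∈ K) :
    ∃ g ∈ PS K, g • K' = K' ∧ g y = d * y := by
  obtain ⟨σ, k, rfl, rfl, rfl⟩ := h
  have hd' := mem_smul_iff.1 hd
  have hl := PS_anti (Fn_le_compl k) (lmul_mem_PS k (σ⁻¹ d))
  have heq : lmul k (σ⁻¹ d) • Fn (k + 1) = Fn (k + 1) := by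
    have := lmul_smul_FC Set.self_notMem_Iio hd'
    rwa [insert_Iio] at this
  refine ⟨σ * lmul k (σ⁻¹ d) * σ⁻¹, conj_mem_PS.2 hl, ?_, ?_⟩
  · rw [mul_smul, mul_smul, inv_smul_smul, heq]
  · rw [MulAut.mul_apply, MulAut.mul_apply, MulAut.inv_apply_self,
      lmul_self (Fn_le_compl k hd'), map_mul, MulAut.apply_inv_self]

theorem mul_left (h : IsPair K K' y) {d : FreeGroup ℕ} (hd : d ∈ K) : IsPair K K' (d * y) := by
  obtain ⟨g, h1, h2, h3⟩ := h.exists_lmul hd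
  have := h.smul g
  rwa [smul_eq_of_mem_PS h1, h2, h3] at this

theorem inv (h : IsPair K K' y) : IsPair K K' y⁻¹ := by
  obtain ⟨σ, k, rfl, rfl, rfl⟩ := h
  refine ⟨σ * eps k, k, ?_, ?_, ?_⟩
  · rw [mul_smul, smul_eq_of_mem_PS (PS_anti (Fn_le_compl k) (eps_mem_PS k))]
  · rw [mul_smul, eps_smul_FC (Set.mem_Iio.2 (Nat.lt_succ_self k))]
  · rw [MulAut.mul_apply, eps_self, map_inv]

theorem conj (h : IsPair K K' y) {u : FreeGroup ℕ} (hu : u ∈ K) : IsPair K K' (u * y * u⁻¹) := by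
  have key : ∀ H : Subgroup (FreeGroup ℕ), u ∈ H → MulAut.conj u • H = H := fun H hH =>
    Subgroup.conj_smul_eq_self_of_mem hH
  have := h.smul (MulAut.conj u)
  rwa [key K hu, key K' (h.le hu), MulAut.conj_apply] at this

end IsPair

/-! ### Transvections are mapped to transvections -/

theorem Lift.smul_eq {n₀ : ℕ} {lam : MulAut (FreeGroup ℕ) → MulAut (FreeGroup ℕ)}
    (L : Lift n₀ lam) {A B : Subgroup (FreeGroup ℕ)} (hA : Fn n₀ ≤ A) (m : Matches lam A B)
    (hB : IsFF B) {g : MulAut (FreeGroup ℕ)} (hg : g ∈ PS (Fn n₀)) (e : g • A = A) :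
    lam g • B = B := by
  have := L.matches_smul hA m hg
  rw [e] at this
  exact le_antisymm (this.le_of_le m hB le_rfl) (m.le_of_le this (hB.smul _) le_rfl)

/-- The free factors spanned by `C` and by `insert x C` correspond to `K` and `K'`. -/
structure Level (n₀ : ℕ) (lam : MulAut (FreeGroup ℕ) → MulAut (FreeGroup ℕ)) (x : ℕ) (C : Set ℕ)
    (K K' : Subgroup (FreeGroup ℕ)) : Prop where
  lift : Lift n₀ lam
  notMem : x ∉ C
  le : Fn n₀ ≤ FC C
  nc : NC (FC C)
  isFF : IsFF (FC (insert x C))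
  matches_left : Matches lam (FC C) K
  matches_right : Matches lam (FC (insert x C)) K'

namespace Level

variable {n₀ x : ℕ} {lam : MulAut (FreeGroup ℕ) → MulAut (FreeGroup ℕ)} {C : Set ℕ}
  {K K' : Subgroup (FreeGroup ℕ)} {y : FreeGroup ℕ} {g h : MulAut (FreeGroup ℕ)}

theorem lmul_mem (V : Level n₀ lam x C K K') (a : FreeGroup ℕ) : lmul x a ∈ PS (FC C) :=
  PS_anti (FC_le_compl V.notMem) (lmul_mem_PS x a)

theorem eps_mem (V : Level n₀ lam x C K K') : eps x ∈ PS (FC C) :=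
  PS_anti (FC_le_compl V.notMem) (eps_mem_PS x)

theorem map_mul (V : Level n₀ lam x C K K') (hg : g ∈ PS (FC C)) (hh : h ∈ PS (FC C)) :
    lam (g * h) = lam g * lam h :=
  V.lift.map_mul _ (PS_anti V.le hg) _ (PS_anti V.le hh)

theorem le_insert (V : Level n₀ lam x C K K') : Fn n₀ ≤ FC (insert x C) :=
  V.le.trans (FC_mono (Set.subset_insert _ _))

theorem apply_eq_iff (V : Level n₀ lam x C K K') (P : IsPair K K' y) (hg : g ∈ PS (FC C))
    (hh : h ∈ PS (FC C)) : lam g y = lam h y ↔ g (of x) = h (of x) := by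
  have h1 : lam (h⁻¹ * g) = (lam h)⁻¹ * lam g := by
    rw [V.map_mul (inv_mem hh) hg, V.lift.map_inv (PS_anti V.le hh)]
  have h2 : ∀ (a b : MulAut (FreeGroup ℕ)) z, a z = b z ↔ (b⁻¹ * a) z = z := fun a b z => by
    rw [MulAut.mul_apply]
    refine ⟨fun e => by rw [e, MulAut.inv_apply_self], fun e => ?_⟩
    nth_rw 2 [← e]
    rw [MulAut.apply_inv_self]
  have h3 := mul_mem (inv_mem hh) hg
  rw [h2, h2 g, ← h1]
  constructor
  · intro e
    obtain ⟨q, hq, e'⟩ := V.matches_right.exists_eq _ (P.mem_PS (V.matches_left.mem _ h3) e)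
    rw [← V.lift.inj _ (PS_anti V.le_insert hq) _ (PS_anti V.le h3) e']
    exact hq _ (of_mem_FC (Set.mem_insert x C))
  · intro e
    refine V.matches_right.mem _ (mem_PS_FC.2 fun i hi => ?_) y P.mem
    rcases hi with rfl | hi
    · exact e
    · exact h3 _ (of_mem_FC hi)

theorem exists_apply_eq (V : Level n₀ lam x C K K') (P : IsPair K K' y) (hg : g ∈ PS (FC C))
    (e : g • FC (insert x C) = FC (insert x C)) :
    ∃ u ∈ K, ∃ v ∈ K, lam g y = u * y * v ∨ lam g y = u * y⁻¹ * v :=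
  P.exists_apply_eq (V.matches_left.mem _ hg)
    (V.lift.smul_eq V.le_insert V.matches_right P.isFF' (PS_anti V.le hg) e)

theorem exists_eps (V : Level n₀ lam x C K K') (P : IsPair K K' y) :
    ∃ y', IsPair K K' y' ∧ lam (eps x) y' = y'⁻¹ := by
  obtain ⟨u, hu, v, hv, e⟩ := V.exists_apply_eq P V.eps_mem (eps_smul_FC (Set.mem_insert x C))
  have hK := V.matches_left.mem _ V.eps_mem
  have hsq : lam (eps x) (lam (eps x) y) = y := by
    rw [← MulAut.mul_apply, ← V.map_mul V.eps_mem V.eps_mem, eps_mul_self, V.lift.map_one]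
    rfl
  rcases e with e | e
  · rw [e, _root_.map_mul, _root_.map_mul, hK u hu, hK v hv, e] at hsq
    have h1 := P.inj (mul_mem hu hu) (mul_mem hv hv) (one_mem _) (one_mem _)
      (show u * u * y * (v * v) = 1 * y * 1 by simpa [mul_assoc] using hsq)
    rw [← pow_two, ← pow_two, pow_eq_one_iff_left two_ne_zero,
      pow_eq_one_iff_left two_ne_zero] at h1
    rw [h1.1, h1.2, one_mul, mul_one] at e
    have h2 := (V.apply_eq_iff P V.eps_mem (one_mem _)).1 (e.trans (by rw [V.lift.map_one]; rfl))
    rw [eps_self, MulAut.one_apply] at h2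
    exact absurd h2 fun h => FreeGroup.of_ne_one x
      ((pow_eq_one_iff_left two_ne_zero).1 (by rw [pow_two]; exact (inv_eq_iff_mul_eq_one.1 h)))
  · rw [e, _root_.map_mul, _root_.map_mul, _root_.map_inv, hK u hu, hK v hv, e] at hsq
    have h1 := P.inj (mul_mem hu (inv_mem hv)) (mul_mem (inv_mem hu) hv) (one_mem _) (one_mem _)
      (show u * v⁻¹ * y * (u⁻¹ * v) = 1 * y * 1 by simpa [mul_assoc] using hsq)
    have h2 : u = v := mul_inv_eq_one.1 h1.1
    subst h2
    refine ⟨u⁻¹ * y, P.mul_left (inv_mem hu), ?_⟩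
    rw [_root_.map_mul, hK _ (inv_mem hu), e]
    group

theorem apply_rmul (V : Level n₀ lam x C K K') (a : FreeGroup ℕ) :
    lam (eps x * lmul x a * eps x) = lam (eps x) * lam (lmul x a) * lam (eps x) := by
  rw [V.map_mul (mul_mem V.eps_mem (V.lmul_mem a)) V.eps_mem, V.map_mul V.eps_mem (V.lmul_mem a)]

theorem rmul_mem (V : Level n₀ lam x C K K') (a : FreeGroup ℕ) :
    eps x * lmul x a * eps x ∈ PS (FC C) :=
  mul_mem (mul_mem V.eps_mem (V.lmul_mem a)) V.eps_mem

theorem rmul_of {a : FreeGroup ℕ} (ha : a ∈ FC {x}ᶜ) :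
    (eps x * lmul x a * eps x) (of x) = of x * a⁻¹ := by
  rw [MulAut.mul_apply, MulAut.mul_apply, eps_self, _root_.map_inv, lmul_self ha, mul_inv_rev,
    _root_.map_mul, _root_.map_inv, _root_.map_inv, eps_self, eps_mem_PS x a ha, inv_inv]

theorem lmul_rmul_of {a b : FreeGroup ℕ} (ha : a ∈ FC {x}ᶜ) (hb : b ∈ FC {x}ᶜ) :
    (lmul x a * (eps x * lmul x b * eps x)) (of x) = a * of x * b⁻¹ := by
  rw [MulAut.mul_apply, rmul_of hb, _root_.map_mul, lmul_self ha, lmul_mem_PS x a _ (inv_mem hb)]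

theorem rmul_lmul_of {a b : FreeGroup ℕ} (ha : a ∈ FC {x}ᶜ) (hb : b ∈ FC {x}ᶜ) :
    ((eps x * lmul x b * eps x) * lmul x a) (of x) = a * of x * b⁻¹ := by
  have h : eps x * lmul x b * eps x ∈ PS (FC {x}ᶜ) :=
    mul_mem (mul_mem (eps_mem_PS x) (lmul_mem_PS x b)) (eps_mem_PS x)
  rw [MulAut.mul_apply, lmul_self ha, _root_.map_mul, rmul_of hb, h a ha, mul_assoc]

/-- The images of left and right multiplications commute. -/
theorem apply_comm (V : Level n₀ lam x C K K') (P : IsPair K K' y) {a b : FreeGroup ℕ}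
    (ha : a ∈ FC C) (hb : b ∈ FC C) :
    lam (lmul x a) (lam (eps x * lmul x b * eps x) y) =
      lam (eps x * lmul x b * eps x) (lam (lmul x a) y) := by
  rw [← MulAut.mul_apply, ← MulAut.mul_apply, ← V.map_mul (V.lmul_mem a) (V.rmul_mem b),
    ← V.map_mul (V.rmul_mem b) (V.lmul_mem a),
    V.apply_eq_iff P (mul_mem (V.lmul_mem a) (V.rmul_mem b)) (mul_mem (V.rmul_mem b) (V.lmul_mem a)),
    lmul_rmul_of (FC_le_compl V.notMem ha) (FC_le_compl V.notMem hb),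
    rmul_lmul_of (FC_le_compl V.notMem ha) (FC_le_compl V.notMem hb)]

theorem rmul_pos (V : Level n₀ lam x C K K') (hE : lam (eps x) y = y⁻¹) {b p q : FreeGroup ℕ}
    (hp : p ∈ K) (hq : q ∈ K) (e : lam (lmul x b) y = p * y * q) :
    lam (eps x * lmul x b * eps x) y = q⁻¹ * y * p⁻¹ := by
  have hK := V.matches_left.mem _ V.eps_mem
  rw [V.apply_rmul, MulAut.mul_apply, MulAut.mul_apply, hE, _root_.map_inv, e, mul_inv_rev,
    mul_inv_rev, _root_.map_mul, _root_.map_mul, _root_.map_inv _ y, hE, hK _ (inv_mem hp),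
    hK _ (inv_mem hq), inv_inv, mul_assoc]

theorem rmul_neg (V : Level n₀ lam x C K K') (hE : lam (eps x) y = y⁻¹) {b p q : FreeGroup ℕ}
    (hp : p ∈ K) (hq : q ∈ K) (e : lam (lmul x b) y = p * y⁻¹ * q) :
    lam (eps x * lmul x b * eps x) y = q⁻¹ * y⁻¹ * p⁻¹ := by
  have hK := V.matches_left.mem _ V.eps_mem
  rw [V.apply_rmul, MulAut.mul_apply, MulAut.mul_apply, hE, _root_.map_inv, e, mul_inv_rev,
    mul_inv_rev, inv_inv, _root_.map_mul, _root_.map_mul, hE, hK _ (inv_mem hp),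
    hK _ (inv_mem hq), mul_assoc]

theorem commute_of_pos (V : Level n₀ lam x C K K') (P : IsPair K K' y)
    (hE : lam (eps x) y = y⁻¹) {a b p q p' q' : FreeGroup ℕ} (ha : a ∈ FC C) (hb : b ∈ FC C)
    (hp : p ∈ K) (hq : q ∈ K) (e : lam (lmul x a) y = p * y * q)
    (hp' : p' ∈ K) (hq' : q' ∈ K) (e' : lam (lmul x b) y = p' * y * q') : Commute p q' := by
  have h1 := V.apply_comm P ha hb
  have h2 := V.matches_left.mem _ (V.lmul_mem a)
  have h3 := V.matches_left.mem _ (V.rmul_mem b)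
  rw [V.rmul_pos hE hp' hq' e', e, _root_.map_mul, _root_.map_mul, _root_.map_mul, _root_.map_mul,
    e, V.rmul_pos hE hp' hq' e', h2 _ (inv_mem hq'), h2 _ (inv_mem hp'), h3 _ hp, h3 _ hq] at h1
  have h4 := (P.inj (u := q'⁻¹ * p) (v := q * p'⁻¹) (u' := p * q'⁻¹) (v' := p'⁻¹ * q)
    (mul_mem (inv_mem hq') hp) (mul_mem hq (inv_mem hp')) (mul_mem hp (inv_mem hq'))
    (mul_mem (inv_mem hp') hq) (by simpa [mul_assoc] using h1)).1
  exact Commute.inv_right_iff.1 h4.symm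

theorem apply_lmul_mul (V : Level n₀ lam x C K K') {a b p q p' q' : FreeGroup ℕ} (ha : a ∈ FC C)
    (hb : b ∈ FC C) (e : lam (lmul x a) y = p * y * q)
    (hp' : p' ∈ K) (hq' : q' ∈ K) (e' : lam (lmul x b) y = p' * y * q') :
    lam (lmul x (b * a)) y = p' * p * y * (q * q') := by
  have h2 := V.matches_left.mem _ (V.lmul_mem a)
  rw [← lmul_mul (FC_le_compl V.notMem ha) (FC_le_compl V.notMem hb),
    V.map_mul (V.lmul_mem a) (V.lmul_mem b), MulAut.mul_apply, e', _root_.map_mul, _root_.map_mul,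
    e, h2 _ hp', h2 _ hq']
  simp only [mul_assoc]

theorem eq_of_apply_lmul_eq (V : Level n₀ lam x C K K') (P : IsPair K K' y) {a b : FreeGroup ℕ}
    (ha : a ∈ FC C) (hb : b ∈ FC C) (e : lam (lmul x a) y = lam (lmul x b) y) : a = b := by
  rw [V.apply_eq_iff P (V.lmul_mem a) (V.lmul_mem b), lmul_self (FC_le_compl V.notMem ha),
    lmul_self (FC_le_compl V.notMem hb)] at e
  exact mul_right_cancel e

/-- The elements of the form `p * y * q` cannot all commute. -/
theorem not_both (V : Level n₀ lam x C K K') (P : IsPair K K' y)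
    (hE : lam (eps x) y = y⁻¹) {a b p q p' q' : FreeGroup ℕ} (ha : a ∈ FC C) (hb : b ∈ FC C)
    (hp : p ∈ K) (hq : q ∈ K) (e : lam (lmul x a) y = p * y * q)
    (hp' : p' ∈ K) (hq' : q' ∈ K) (e' : lam (lmul x b) y = p' * y * q')
    (hp1 : p ≠ 1) (hq1 : q' ≠ 1) : False := by
  have key : ∀ c ∈ FC C, ∀ d ∈ FC C, ∀ r ∈ K, ∀ s ∈ K, ∀ t ∈ K, ∀ u ∈ K,
      lam (lmul x c) y = r * y * s → lam (lmul x d) y = t * y * u → Commute c d := by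
    intro c hc d hd r hr s hs t ht u hu e1 e2
    have h1 : Commute r t := commute_of_commute hq1
      (V.commute_of_pos P hE hc hb hr hs e1 hp' hq' e').symm
      (V.commute_of_pos P hE hd hb ht hu e2 hp' hq' e').symm
    have h2 : Commute s u := commute_of_commute hp1
      (V.commute_of_pos P hE ha hc hp hq e hr hs e1)
      (V.commute_of_pos P hE ha hd hp hq e ht hu e2)
    refine V.eq_of_apply_lmul_eq P (mul_mem hc hd) (mul_mem hd hc) ?_
    rw [V.apply_lmul_mul hd hc e2 hr hs e1, V.apply_lmul_mul hc hd e1 ht hu e2, h1.eq, h2.eq]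
  have sq : ∀ c ∈ FC C, ∃ r ∈ K, ∃ s ∈ K, lam (lmul x (c * c)) y = r * y * s := by
    intro c hc
    obtain ⟨u, hu, v, hv, e1 | e1⟩ :=
      V.exists_apply_eq P (V.lmul_mem c) (lmul_smul_FC V.notMem hc)
    · exact ⟨_, mul_mem hu hu, _, mul_mem hv hv, V.apply_lmul_mul hc hc e1 hu hv e1⟩
    · refine ⟨u * v⁻¹, mul_mem hu (inv_mem hv), u⁻¹ * v, mul_mem (inv_mem hu) hv, ?_⟩
      have h2 := V.matches_left.mem _ (V.lmul_mem c)
      rw [← lmul_mul (FC_le_compl V.notMem hc) (FC_le_compl V.notMem hc),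
        V.map_mul (V.lmul_mem c) (V.lmul_mem c), MulAut.mul_apply, e1, _root_.map_mul,
        _root_.map_mul, _root_.map_inv, e1, h2 _ hu, h2 _ hv]
      group
  obtain ⟨c, hc, d, hd, hcd⟩ := V.nc
  obtain ⟨r, hr, s, hs, e1⟩ := sq c hc
  obtain ⟨t, ht, u, hu, e2⟩ := sq d hd
  have h1 := key _ (mul_mem hc hc) _ (mul_mem hd hd) r hr s hs t ht u hu e1 e2
  have hc1 : c * c ≠ 1 := fun h => hcd (by
    rw [← pow_two, pow_eq_one_iff_left two_ne_zero] at h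
    rw [h]; exact Commute.one_left d)
  have hd1 : d * d ≠ 1 := fun h => hcd (by
    rw [← pow_two, pow_eq_one_iff_left two_ne_zero] at h
    rw [h]; exact Commute.one_right c)
  have h2 : Commute c (d * d) := commute_of_commute hc1 (by simp [commute_iff_eq, mul_assoc]) h1
  exact hcd (commute_of_commute hd1 h2.symm (by simp [commute_iff_eq, mul_assoc]))

theorem exists_pos (V : Level n₀ lam x C K K') (P : IsPair K K' y) (hE : lam (eps x) y = y⁻¹)
    {a : FreeGroup ℕ} (ha : a ∈ FC C) : ∃ p ∈ K, ∃ q ∈ K, lam (lmul x a) y = p * y * q := by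
  obtain ⟨p, hp, q, hq, e | e⟩ :=
    V.exists_apply_eq P (V.lmul_mem a) (lmul_smul_FC V.notMem ha)
  · exact ⟨p, hp, q, hq, e⟩
  exfalso
  have h2 := V.matches_left.mem _ (V.lmul_mem a)
  have h3 := V.matches_left.mem _ (V.rmul_mem a)
  have h1 := V.apply_comm P ha ha
  rw [V.rmul_neg hE hp hq e, e, _root_.map_mul, _root_.map_mul, _root_.map_mul, _root_.map_mul,
    _root_.map_inv _ y, _root_.map_inv _ y, e, V.rmul_neg hE hp hq e, h2 _ (inv_mem hq),
    h2 _ (inv_mem hp), h3 _ hp, h3 _ hq] at h1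
  have h4 := (P.inj (u := q⁻¹ * q⁻¹) (v := p⁻¹ * p⁻¹) (u' := p * p) (v' := q * q)
    (mul_mem (inv_mem hq) (inv_mem hq)) (mul_mem (inv_mem hp) (inv_mem hp)) (mul_mem hp hp)
    (mul_mem hq hq) (by simpa [mul_assoc] using h1)).1
  have h5 : q⁻¹ = p := by
    rw [← pow_two, ← pow_two] at h4
    exact pow_left_injective two_ne_zero h4
  obtain rfl : q = p⁻¹ := by rw [← h5, inv_inv]
  have hsq : lam (lmul x (a * a)) y = p * p * y * (p⁻¹ * p⁻¹) := by
    rw [← lmul_mul (FC_le_compl V.notMem ha) (FC_le_compl V.notMem ha),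
      V.map_mul (V.lmul_mem a) (V.lmul_mem a), MulAut.mul_apply, e, _root_.map_mul,
      _root_.map_mul, _root_.map_inv _ y, e, h2 _ hp, h2 _ hq]
    group
  by_cases hp1 : p = 1
  · subst hp1
    have h6 : lam (lmul x (a * a)) y = lam (lmul x 1) y := by
      rw [hsq, lmul_one, V.lift.map_one, MulAut.one_apply]
      simp
    have h7 := V.eq_of_apply_lmul_eq P (mul_mem ha ha) (one_mem _) h6
    rw [← pow_two, pow_eq_one_iff_left two_ne_zero] at h7
    rw [h7, lmul_one, V.lift.map_one, MulAut.one_apply] at e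
    exact P.ne_inv (one_mem _) (one_mem _) (one_mem _) (one_mem _)
      (show 1 * y * 1 = 1 * y⁻¹ * 1 by simpa using e)
  · have hpp : p * p ≠ 1 := fun h => hp1 (by
      rwa [← pow_two, pow_eq_one_iff_left two_ne_zero] at h)
    refine V.not_both P hE (mul_mem ha ha) (mul_mem ha ha) (mul_mem hp hp) (mul_mem hq hq) hsq
      (mul_mem hp hp) (mul_mem hq hq) hsq hpp fun h => hpp ?_
    rw [← mul_inv_rev] at h
    exact inv_eq_one.1 h

theorem exists_left (V : Level n₀ lam x C K K') (P : IsPair K K' y) :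
    ∃ y', IsPair K K' y' ∧ lam (eps x) y' = y'⁻¹ ∧
      ∀ a ∈ FC C, ∃ d ∈ K, lam (lmul x a) y' = d * y' := by
  obtain ⟨y, P, hE⟩ := V.exists_eps P
  by_cases hq : ∀ a ∈ FC C, ∃ d ∈ K, lam (lmul x a) y = d * y
  · exact ⟨y, P, hE, hq⟩
  push Not at hq
  obtain ⟨b, hb, hb1⟩ := hq
  obtain ⟨p', hp', q', hq', e'⟩ := V.exists_pos P hE hb
  have hq1 : q' ≠ 1 := by
    rintro rfl
    exact hb1 p' hp' (by rw [e', mul_one])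
  refine ⟨y⁻¹, P.inv, by rw [_root_.map_inv, hE], fun a ha => ?_⟩
  obtain ⟨p, hp, q, hq, e⟩ := V.exists_pos P hE ha
  obtain rfl : p = 1 := by
    by_contra hp1
    exact V.not_both P hE ha hb hp hq e hp' hq' e' hp1 hq1
  exact ⟨q⁻¹, inv_mem hq, by rw [_root_.map_inv, e, one_mul, mul_inv_rev]⟩

end Level

/-- The images of `x ↦ x⁻¹` and of the transvections `x ↦ a * x` with `a ∈ A` act on `y` by
inversion and by left multiplication by elements of `K`, and all of `K` occurs. -/
structure Good (lam : MulAut (FreeGroup ℕ) → MulAut (FreeGroup ℕ)) (x : ℕ)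
    (A K : Subgroup (FreeGroup ℕ)) (y : FreeGroup ℕ) : Prop where
  eps : lam (eps x) y = y⁻¹
  left : ∀ a ∈ A, ∃ d ∈ K, lam (lmul x a) y = d * y
  surj : ∀ d ∈ K, ∃ a ∈ A, lam (lmul x a) y = d * y

theorem IsPair.apply_eq {K K' : Subgroup (FreeGroup ℕ)} {y w : FreeGroup ℕ} (P : IsPair K K' y)
    {g h : MulAut (FreeGroup ℕ)} (hg : g ∈ PS K) (hh : h ∈ PS K) (e : g y = h y) (hw : w ∈ K') :
    g w = h w := by
  have h1 := P.mem_PS (mul_mem (inv_mem hh) hg) (by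
    rw [MulAut.mul_apply, e, MulAut.inv_apply_self])
  exact inv_mul_mem_PS_iff.1 h1 w hw

namespace Level

variable {n₀ x : ℕ} {lam : MulAut (FreeGroup ℕ) → MulAut (FreeGroup ℕ)} {C C₁ : Set ℕ}
  {K K' K₁ K₁' : Subgroup (FreeGroup ℕ)} {y y₁ : FreeGroup ℕ}

theorem smul_eq_of_apply (V : Level n₀ lam x C K K') {g : MulAut (FreeGroup ℕ)}
    (hg : g ∈ PS (FC C)) (e : lam g • K' = K') : g • FC (insert x C) = FC (insert x C) := by
  have h1 := V.lift.matches_smul V.le_insert V.matches_right (PS_anti V.le hg)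
  rw [e] at h1
  have h2 : Fn n₀ ≤ g • FC (insert x C) := by
    rw [← smul_eq_of_mem_PS (PS_anti V.le hg)]
    exact Subgroup.pointwise_smul_le_pointwise_smul_iff.2 V.le_insert
  exact le_antisymm (V.lift.le_of_le h1 V.matches_right h2 V.le_insert V.isFF le_rfl)
    (V.lift.le_of_le V.matches_right h1 V.le_insert h2 (V.isFF.smul g) le_rfl)

theorem exists_good (V : Level n₀ lam x C K K') (P : IsPair K K' y) :
    ∃ y', IsPair K K' y' ∧ Good lam x (FC C) K y' := by
  obtain ⟨y, P, hE, hl⟩ := V.exists_left P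
  refine ⟨y, P, hE, hl, fun d hd => ?_⟩
  have hC := FC_le_compl V.notMem
  have form : ∀ u ∈ FC C, ∀ v ∈ FC C, ∃ p ∈ K, ∃ q ∈ K, lam (lmul x u) y = p * y ∧
      lam (lmul x u * (OutFree.eps x * lmul x v * OutFree.eps x)) y = p * y * q := by
    intro u hu v hv
    obtain ⟨p, hp, e1⟩ := hl u hu
    obtain ⟨q, hq, e2⟩ := hl v hv
    refine ⟨p, hp, q⁻¹, inv_mem hq, e1, ?_⟩
    have h2 := V.matches_left.mem _ (V.lmul_mem u)
    rw [V.map_mul (V.lmul_mem u) (V.rmul_mem v), MulAut.mul_apply,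
      V.rmul_pos hE hq (one_mem _) (by rw [e2, mul_one]), inv_one, one_mul, _root_.map_mul, e1,
      h2 _ (inv_mem hq)]
  obtain ⟨h, h1, h2, h3⟩ := P.exists_lmul hd
  obtain ⟨g, hg, rfl⟩ := V.matches_left.exists_eq h h1
  obtain ⟨u, hu, v, hv, e | e⟩ := exists_apply_eq_of_insert hg (V.smul_eq_of_apply hg h2)
  · obtain ⟨p, hp, q, hq, e1, e2⟩ := form u hu v⁻¹ (inv_mem hv)
    have e3 := (V.apply_eq_iff P hg (mul_mem (V.lmul_mem u) (V.rmul_mem v⁻¹))).2 (by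
      rw [e, lmul_rmul_of (hC hu) (hC (inv_mem hv)), inv_inv])
    rw [h3, e2] at e3
    refine ⟨u, hu, ?_⟩
    rw [e1, (P.inj hd (one_mem _) hp hq (by rw [mul_one, e3])).1]
  · obtain ⟨p, hp, q, hq, e1, e2⟩ := form v⁻¹ (inv_mem hv) u hu
    have h5 := mul_mem (V.lmul_mem v⁻¹) (V.rmul_mem u)
    have e3 := (V.apply_eq_iff P hg (mul_mem h5 V.eps_mem)).2 (by
      rw [e, MulAut.mul_apply, eps_self, map_inv, lmul_rmul_of (hC (inv_mem hv)) (hC hu)]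
      group)
    rw [h3, V.map_mul h5 V.eps_mem, MulAut.mul_apply, hE, map_inv, e2] at e3
    exact (P.ne_inv hd (one_mem _) (inv_mem hq) (inv_mem hp) (by rw [e3]; group)).elim

theorem Fn_of_retr {k : ℕ} {u : FreeGroup ℕ} (hu : u ∈ FC {k}ᶜ) :
    retr (Set.Iio (k + 1)) u ∈ Fn k := by
  have : FC {k}ᶜ ≤ (Fn k).comap (retr (Set.Iio (k + 1))) := FC_le.2 fun i hi => by
    rw [Subgroup.mem_comap]
    by_cases hik : i < k
    · rw [retr_of_mem (Set.mem_Iio.2 (by omega))]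
      exact of_mem_Fn hik
    · rw [retr_of_notMem fun h => hi (by
        have := Set.mem_Iio.1 h
        rw [Set.mem_singleton_iff]
        omega)]
      exact one_mem _
  exact this hu

theorem exists_conj (V : Level n₀ lam x C K K') (P : IsPair K K' y) (G : Good lam x (FC C) K y)
    (V₁ : Level n₀ lam x C₁ K₁ K₁') (P₁ : IsPair K₁ K₁' y₁) (G₁ : Good lam x (FC C₁) K₁ y₁)
    (hC : C ⊆ C₁) (hK : K ≤ K₁) (hK' : K' ≤ K₁') : ∃ u ∈ K₁, y = u * y₁ * u⁻¹ := by
  obtain ⟨a, ha, b, hb, hab⟩ := V.nc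
  obtain ⟨d, hd, ed⟩ := G.left a ha
  obtain ⟨d', hd', ed'⟩ := G.left b hb
  have ha₁ := FC_mono hC ha
  have hb₁ := FC_mono hC hb
  obtain ⟨c, hc, ec⟩ := G₁.left a ha₁
  obtain ⟨c', hc', ec'⟩ := G₁.left b hb₁
  have hcc : ¬ Commute c c' := fun h => hab (by
    refine V₁.eq_of_apply_lmul_eq P₁ (mul_mem ha₁ hb₁) (mul_mem hb₁ ha₁) ?_
    rw [V₁.apply_lmul_mul hb₁ ha₁ (q := 1) (by rw [ec', mul_one]) hc (one_mem _)
      (by rw [ec, mul_one]), V₁.apply_lmul_mul ha₁ hb₁ (q := 1) (by rw [ec, mul_one]) hc'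
      (one_mem _) (by rw [ec', mul_one]), h.eq])
  have hy := hK' P.mem
  have hy1 := P.ne_one
  obtain ⟨σ, k, rfl, rfl, rfl⟩ := id P₁
  have hle := IsPair.Fn_le_compl k
  have hPS : ∀ p ∈ PS (FC {k}ᶜ), σ * p * σ⁻¹ ∈ PS (σ • Fn k) := fun p hp =>
    conj_mem_PS.2 (PS_anti hle hp)
  have key : ∀ p ∈ PS (FC {k}ᶜ), ∀ g ∈ PS (FC C₁), lam g (σ (of k)) = σ (p (of k)) →
      p (σ⁻¹ y) = σ⁻¹ (lam g y) := fun p hp g hg e => by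
    have h1 := P₁.apply_eq (V₁.matches_left.mem g hg) (hPS p hp) (by
      rw [e, MulAut.mul_apply, MulAut.mul_apply, MulAut.inv_apply_self]) hy
    rw [h1, MulAut.mul_apply, MulAut.mul_apply, MulAut.inv_apply_self]
  have hl : ∀ c ∈ σ • Fn k, ∀ a, lam (lmul x a) (σ (of k)) = c * σ (of k) →
      lmul k (σ⁻¹ c) (σ⁻¹ y) = σ⁻¹ (lam (lmul x a) y) := fun c hc a e => by
    refine key _ (lmul_mem_PS k _) _ (V₁.lmul_mem a) ?_
    rw [e, lmul_self (hle (mem_smul_iff.1 hc)), _root_.map_mul, MulAut.apply_inv_self]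
  obtain ⟨u, hu, e⟩ := exists_conj_form (x := k) (w := σ⁻¹ y) (c₁ := σ⁻¹ c) (c₂ := σ⁻¹ c')
    (d₁ := σ⁻¹ d) (d₂ := σ⁻¹ d') (hle (mem_smul_iff.1 hc)) (hle (mem_smul_iff.1 hc'))
    (fun h => hcc (by simpa only [MulAut.apply_inv_self] using h.map σ))
    (hle (mem_smul_iff.1 (hK hd))) (hle (mem_smul_iff.1 (hK hd')))
    (by rw [hl c hc a ec, ed, _root_.map_mul]) (by rw [hl c' hc' b ec', ed', _root_.map_mul])
    (fun h => hy1 (σ⁻¹.injective (h.trans (map_one _).symm)))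
    (by
      rw [key _ (eps_mem_PS k) _ V₁.eps_mem (by rw [G₁.eps, eps_self, map_inv]), G.eps, map_inv])
  refine ⟨σ (retr (Set.Iio (k + 1)) u), apply_mem_smul_iff.2 (Fn_of_retr hu), ?_⟩
  have h1 : σ⁻¹ y = retr (Set.Iio (k + 1)) (σ⁻¹ y) := (retr_eq_self (mem_smul_iff.1 hy)).symm
  rw [e, _root_.map_mul, _root_.map_mul, map_inv,
    retr_of_mem (Set.mem_Iio.2 (Nat.lt_succ_self k)), ← e] at h1
  rw [← map_inv, ← _root_.map_mul, ← _root_.map_mul, ← h1, MulAut.apply_inv_self]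

theorem good_of_good (V : Level n₀ lam x C K K') (P : IsPair K K' y) (G : Good lam x (FC C) K y)
    (V₁ : Level n₀ lam x C₁ K₁ K₁') (P₁ : IsPair K₁ K₁' y₁)
    (hC : C ⊆ C₁) (hK : K ≤ K₁) (hK' : K' ≤ K₁') :
    IsPair K₁ K₁' y ∧ Good lam x (FC C₁) K₁ y := by
  obtain ⟨y₁, P₁, G₁⟩ := V₁.exists_good P₁
  obtain ⟨u, hu, e⟩ := V.exists_conj P G V₁ P₁ G₁ hC hK hK'
  have h1 : ∀ a d, lam (lmul x a) y₁ = d * y₁ → lam (lmul x a) y = u * d * u⁻¹ * y := by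
    intro a d h
    have h2 := V₁.matches_left.mem _ (V₁.lmul_mem a)
    rw [e, _root_.map_mul, _root_.map_mul, h, h2 u hu, h2 _ (inv_mem hu)]
    group
  refine ⟨e ▸ P₁.conj hu, G.eps, fun a ha => ?_, fun d hd => ?_⟩
  · obtain ⟨d, hd, h⟩ := G₁.left a ha
    exact ⟨_, mul_mem (mul_mem hu hd) (inv_mem hu), h1 a d h⟩
  · obtain ⟨a, ha, h⟩ := G₁.surj (u⁻¹ * d * u) (mul_mem (mul_mem (inv_mem hu) hd) hu)
    exact ⟨a, ha, by rw [h1 a _ h]; group⟩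

end Level

/-! ### Normalizing the lift -/

theorem insert_Iio_diff {x m : ℕ} (h : x ≤ m) :
    insert x (Set.Iio (m + 1) \ {x}) = Set.Iio (m + 1) := by
  rw [Set.insert_sdiff_singleton, Set.insert_eq_of_mem (Set.mem_Iio.2 (Nat.lt_succ_of_le h))]

theorem swap_image_Iio {x m : ℕ} (h : x ≤ m) :
    Equiv.swap x m '' Set.Iio m = Set.Iio (m + 1) \ {x} := by
  ext i
  rw [Equiv.image_eq_preimage_symm, Equiv.symm_swap, Set.mem_preimage, Set.mem_Iio,
    Set.mem_sdiff, Set.mem_Iio, Set.mem_singleton_iff, Equiv.swap_apply_def]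
  split_ifs <;> omega

/-- Compatible levels for the letter `x`, exhausting all letters. -/
structure Tower (n₀ : ℕ) (lam : MulAut (FreeGroup ℕ) → MulAut (FreeGroup ℕ)) (x : ℕ)
    (K K' : ℕ → Subgroup (FreeGroup ℕ)) (y : FreeGroup ℕ) : Prop where
  level : ∀ m, x ≤ m → Level n₀ lam x (Set.Iio (m + 1) \ {x}) (K m) (K' m)
  pair : ∀ m, x ≤ m → IsPair (K m) (K' m) y
  good : ∀ m, x ≤ m → Good lam x (FC (Set.Iio (m + 1) \ {x})) (K m) y

theorem Lift.exists_tower {n₀ : ℕ} {lam : MulAut (FreeGroup ℕ) → MulAut (FreeGroup ℕ)}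
    (L : Lift n₀ lam) : ∃ x K K' y, n₀ ≤ x ∧ Tower n₀ lam x K K' y := by
  obtain ⟨N, hN, hpair⟩ := L.exists_matches_pair
  let x := max N 2
  have hNx : N ≤ x := le_max_left _ _
  have h2x : 2 ≤ x := le_max_right _ _
  have hsub : ∀ k m, k ≤ x → x ≤ m → Fn k ≤ FC (Set.Iio (m + 1) \ {x}) := fun k m h1 h2 =>
    FC_mono fun i hi => by
      have := Set.mem_Iio.1 hi
      exact ⟨Set.mem_Iio.2 (by omega), fun h => by
        rw [Set.mem_singleton_iff] at h
        omega⟩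
  have key : ∀ m, ∃ K K' y, x ≤ m →
      Level n₀ lam x (Set.Iio (m + 1) \ {x}) K K' ∧ IsPair K K' y := by
    intro m
    by_cases hm : x ≤ m
    · have h1 : permAut (Equiv.swap x m) • Fn m = FC (Set.Iio (m + 1) \ {x}) := by
        rw [permAut_smul_FC, swap_image_Iio hm]
      have h2 : permAut (Equiv.swap x m) • Fn (m + 1) = Fn (m + 1) :=
        swap_smul_FC (by simp only [Set.mem_Iio]; omega)
      obtain ⟨σ, k, h3, h4⟩ := hpair (permAut (Equiv.swap x m)) m (by
        rw [h1]
        exact hsub N m hNx hm)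
      rw [h1] at h3
      rw [h2] at h4
      refine ⟨σ • Fn k, σ • Fn (k + 1), σ (of k), fun _ => ⟨⟨L, fun h => h.2 rfl,
        hsub n₀ m (hN.trans hNx) hm, (nc_Fn le_rfl).mono (hsub 2 m h2x hm), ?_, h3, ?_⟩,
        σ, k, rfl, rfl, rfl⟩⟩
      · rw [insert_Iio_diff hm]
        exact isFF_Fn _
      · rwa [insert_Iio_diff hm]
    · exact ⟨⊥, ⊥, 1, fun h => (hm h).elim⟩
  choose K K' y h using key
  obtain ⟨y', P, G⟩ := (h x le_rfl).1.exists_good (h x le_rfl).2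
  have hall : ∀ m, x ≤ m → IsPair (K m) (K' m) y' ∧
      Good lam x (FC (Set.Iio (m + 1) \ {x})) (K m) y' := fun m hm => by
    have hs : Set.Iio (x + 1) \ {x} ⊆ Set.Iio (m + 1) \ {x} := fun i hi =>
      ⟨Set.mem_Iio.2 ((Set.mem_Iio.1 hi.1).trans_le (Nat.succ_le_succ hm)), hi.2⟩
    exact (h x le_rfl).1.good_of_good P G (h m hm).1 (h m hm).2 hs
      ((h x le_rfl).1.matches_left.le_of_le (h m hm).1.matches_left (h m hm).2.isFF (FC_mono hs))
      ((h x le_rfl).1.matches_right.le_of_le (h m hm).1.matches_right (h m hm).2.isFF'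
        (FC_mono (Set.insert_subset_insert hs)))
  exact ⟨x, K, K', y', hN.trans hNx, fun m hm => (h m hm).1, fun m hm => (hall m hm).1,
    fun m hm => (hall m hm).2⟩

theorem exists_mem_FC_diff {x : ℕ} {d : FreeGroup ℕ} (hd : d ∈ FC {x}ᶜ) :
    ∃ m, x ≤ m ∧ d ∈ FC (Set.Iio (m + 1) \ {x}) := by
  obtain ⟨n, hn⟩ := exists_mem_Fn d
  refine ⟨max n x, le_max_right _ _, ?_⟩
  rw [Set.sdiff_eq, ← FC_inf]
  exact ⟨Fn_mono ((le_max_left n x).trans (Nat.le_succ _)) hn, hd⟩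

theorem Good.apply_eq {n₀ x : ℕ} {lam : MulAut (FreeGroup ℕ) → MulAut (FreeGroup ℕ)} {C : Set ℕ}
    {K K' : Subgroup (FreeGroup ℕ)} {y : FreeGroup ℕ} (G : Good lam x (FC C) K y)
    (V : Level n₀ lam x C K K') {c : FreeGroup ℕ →* FreeGroup ℕ}
    (hc : ∀ i ∈ C, lam (lmul x (of i)) y = c (of i) * y) {d : FreeGroup ℕ} (hd : d ∈ FC C) :
    c d ∈ K ∧ lam (lmul x d) y = c d * y := by
  suffices h : lam (lmul x d) y = c d * y by
    obtain ⟨p, hp, e⟩ := G.left d hd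
    exact ⟨mul_right_cancel (h.symm.trans e) ▸ hp, h⟩
  induction hd using Subgroup.closure_induction with
  | mem _ h =>
    obtain ⟨i, hi, rfl⟩ := h
    exact hc i hi
  | one => rw [lmul_one, V.lift.map_one, MulAut.one_apply, map_one, one_mul]
  | mul a b ha hb iha ihb =>
    obtain ⟨p, hp, e⟩ := G.left a ha
    rw [V.apply_lmul_mul hb ha (q := 1) (by rw [ihb, mul_one]) hp (one_mem _) (by rw [e, mul_one]),
      mul_right_cancel (e.symm.trans iha), map_mul, mul_one, mul_one]
  | inv a ha iha =>
    obtain ⟨p, hp, e⟩ := G.left _ (inv_mem ha)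
    have h1 := V.apply_lmul_mul ha (inv_mem ha) (q := 1) (by rw [iha, mul_one]) hp (one_mem _)
      (by rw [e, mul_one])
    rw [inv_mul_cancel, lmul_one, V.lift.map_one, MulAut.one_apply, mul_one, mul_one] at h1
    rw [e, map_inv, eq_inv_of_mul_eq_one_left (mul_eq_right.1 h1.symm)]

theorem Tower.exists_aut {n₀ x : ℕ} {lam : MulAut (FreeGroup ℕ) → MulAut (FreeGroup ℕ)}
    {K K' : ℕ → Subgroup (FreeGroup ℕ)} {y : FreeGroup ℕ} (T : Tower n₀ lam x K K' y) :
    ∃ c : MulAut (FreeGroup ℕ), c (of x) = y ∧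
      (∀ d ∈ FC {x}ᶜ, lam (lmul x d) y = c d * y) ∧
      (∀ m, x ≤ m → c • FC (Set.Iio (m + 1) \ {x}) = K m) ∧
      ∀ m, x ≤ m → c • Fn (m + 1) = K' m := by
  let c : FreeGroup ℕ →* FreeGroup ℕ := FreeGroup.lift fun i =>
    if i = x then y else lam (lmul x (of i)) y * y⁻¹
  have cx : c (of x) = y := by simp [c]
  have hc : ∀ m, x ≤ m → ∀ d ∈ FC (Set.Iio (m + 1) \ {x}),
      c d ∈ K m ∧ lam (lmul x d) y = c d * y := fun m hm d hd =>
    (T.good m hm).apply_eq (T.level m hm) (fun i hi => by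
      have : i ≠ x := hi.2
      simp [c, this]) hd
  have hsurj : ∀ m, x ≤ m → ∀ w ∈ K m, ∃ d ∈ FC (Set.Iio (m + 1) \ {x}), c d = w := by
    intro m hm w hw
    obtain ⟨a, ha, e⟩ := (T.good m hm).surj w hw
    exact ⟨a, ha, mul_right_cancel ((hc m hm a ha).2.symm.trans e)⟩
  have hK : ∀ m, x ≤ m → K' m ≤ c.range := fun m hm =>
    (T.pair m hm).le_of (fun w hw => (hsurj m hm w hw).imp fun _ h => h.2) ⟨of x, cx⟩
  have hbij : Function.Bijective c := by
    refine ⟨(injective_iff_map_eq_one c).2 fun w hw => ?_, fun w => ?_⟩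
    · obtain ⟨n, hn⟩ := exists_mem_Fn w
      obtain ⟨m, hm, hnm⟩ : ∃ m, x ≤ m ∧ n ≤ m + 1 := ⟨max n x, by omega, by omega⟩
      obtain ⟨σ, k, h1, -, h3⟩ := T.pair m hm
      choose! a ha using fun j (hj : j < k) => hsurj m hm (σ (of j)) (by
        rw [← h1]
        exact apply_mem_smul_iff.2 (of_mem_Fn hj))
      let g : FreeGroup ℕ →* FreeGroup ℕ := FreeGroup.lift fun j => if j < k then a j else of x
      have hg : Fn k ≤ (FC (Set.Iio (m + 1) \ {x})).comap g := FC_le.2 fun j hj => by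
        have hj := Set.mem_Iio.1 hj
        rw [Subgroup.mem_comap]
        simpa [g, hj] using (ha j hj).1
      have hcg : ∀ v ∈ Fn k, c (g v) = σ v := fun v hv =>
        hom_eqOn (f := c.comp g) (g := σ.toMonoidHom) (fun j hj => by
          have hj := Set.mem_Iio.1 hj
          simpa [g, hj] using (ha j hj).2) hv
      have key : g (σ⁻¹ (c w)) = w := by
        refine hom_eqOn (f := (g.comp (σ⁻¹).toMonoidHom).comp c) (g := MonoidHom.id _)
          (C := Set.Iio (m + 1)) (fun i hi => ?_) (Fn_mono hnm hn)
        change g (σ⁻¹ (c (of i))) = of i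
        by_cases hix : i = x
        · rw [hix, cx, ← h3, MulAut.inv_apply_self]
          simp [g]
        · have hi : of i ∈ FC (Set.Iio (m + 1) \ {x}) := of_mem_FC ⟨hi, hix⟩
          have h4 : σ⁻¹ (c (of i)) ∈ Fn k := by
            rw [← mem_smul_iff, h1]
            exact (hc m hm _ hi).1
          refine (T.level m hm).eq_of_apply_lmul_eq (T.pair m hm) (hg h4) hi ?_
          rw [(hc m hm _ (hg h4)).2, (hc m hm _ hi).2, hcg _ h4, MulAut.apply_inv_self]
      rw [← key, hw, map_one, map_one]
    · obtain ⟨k, hk⟩ := exists_mem_Fn w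
      obtain ⟨n, -, hn⟩ := (T.level x le_rfl).lift.tail k
      obtain ⟨m, hm, hnm⟩ : ∃ m, x ≤ m ∧ n ≤ m + 1 := ⟨max n x, by omega, by omega⟩
      refine hK m hm ((T.pair m hm).isFF'.le_of_PS_le (fun h hh => ?_) hk)
      obtain ⟨g, hg, rfl⟩ := (T.level m hm).matches_right.exists_eq h hh
      rw [insert_Iio_diff hm] at hg
      exact hn g (PS_anti (Fn_mono hnm) hg)
  let e : MulAut (FreeGroup ℕ) := MulEquiv.ofBijective c hbij
  have he : ∀ w, e w = c w := fun _ => rfl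
  have hleft : ∀ m, x ≤ m → e • FC (Set.Iio (m + 1) \ {x}) = K m := fun m hm => by
    refine le_antisymm (smul_FC_le.2 fun i hi => (hc m hm _ (of_mem_FC hi)).1) fun w hw => ?_
    obtain ⟨d, hd, rfl⟩ := hsurj m hm w hw
    exact apply_mem_smul_iff (g := e).2 hd
  refine ⟨e, cx, fun d hd => ?_, hleft, fun m hm => le_antisymm (smul_FC_le.2 fun i hi => ?_) ?_⟩
  · obtain ⟨m, hm, hd⟩ := exists_mem_FC_diff hd
    exact (hc m hm d hd).2
  · by_cases hix : i = x
    · rw [hix, he, cx]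
      exact (T.pair m hm).mem
    · exact (T.pair m hm).le (hc m hm _ (of_mem_FC ⟨hi, hix⟩)).1
  · refine (T.pair m hm).le_of ?_ ?_
    · rw [← hleft m hm]
      exact Subgroup.pointwise_smul_le_pointwise_smul_iff.2 (FC_mono Set.sdiff_subset)
    · rw [← cx]
      exact apply_mem_smul_iff (g := e).2 (of_mem_Fn (Nat.lt_succ_of_le hm))

/-! ### A normalized lift is the identity -/

/-- `lam` is a homomorphism on the pointwise stabilizer of `Fn n₀` which fixes the transvections
at `x` and the inversion of `x`, and preserves the pointwise stabilizers of the factors spanned by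
the first letters, with or without `x`. -/
structure Normalized (n₀ : ℕ) (lam : MulAut (FreeGroup ℕ) → MulAut (FreeGroup ℕ)) (x : ℕ) :
    Prop where
  le : n₀ ≤ x
  map_mul : ∀ g ∈ PS (Fn n₀), ∀ h ∈ PS (Fn n₀), lam (g * h) = lam g * lam h
  lmul : ∀ d ∈ FC {x}ᶜ, lam (lmul x d) = lmul x d
  eps : lam (eps x) = eps x
  left : ∀ m, x ≤ m → ∀ g ∈ PS (FC (Set.Iio (m + 1) \ {x})), lam g ∈ PS (FC (Set.Iio (m + 1) \ {x}))
  right : ∀ m, x ≤ m → ∀ g ∈ PS (Fn (m + 1)), lam g ∈ PS (Fn (m + 1))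

theorem PS_compl_le {n i : ℕ} (h : n ≤ i) : PS (FC {i}ᶜ) ≤ PS (Fn n) :=
  PS_anti (FC_le_compl fun hi => absurd (Set.mem_Iio.1 hi) (not_lt.2 h))

theorem swap_smul_compl (i j : ℕ) : permAut (Equiv.swap i j) • FC {i}ᶜ = FC {j}ᶜ := by
  rw [permAut_smul_FC]
  congr 1
  ext k
  rw [Equiv.image_eq_preimage_symm, Set.mem_preimage, Equiv.symm_swap, Set.mem_compl_singleton_iff,
    Set.mem_compl_singleton_iff, Ne, Equiv.swap_apply_eq_iff, Equiv.swap_apply_left]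

theorem swap_mem_PS (i j : ℕ) : permAut (Equiv.swap i j) ∈ PS (FC {i, j}ᶜ) :=
  permAut_mem_PS fun _ hk => Equiv.swap_apply_of_ne_of_ne (fun h => hk (Or.inl h))
    fun h => hk (Or.inr h)

theorem swap_mem_PS_Fn {n i j : ℕ} (hi : n ≤ i) (hj : n ≤ j) :
    permAut (Equiv.swap i j) ∈ PS (Fn n) :=
  permAut_mem_PS fun k hk => by
    have := Set.mem_Iio.1 hk
    exact Equiv.swap_apply_of_ne_of_ne (by omega) (by omega)

theorem insert_compl_pair {i j : ℕ} (h : i ≠ j) : insert j ({i, j} : Set ℕ)ᶜ = {i}ᶜ := by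
  ext k
  simp only [Set.mem_insert_iff, Set.mem_compl_iff, Set.mem_singleton_iff]
  grind

theorem nontrivial_compl_pair (i j : ℕ) : ({i, j} : Set ℕ)ᶜ.Nontrivial :=
  ((Set.toFinite {i, j}).infinite_compl).nontrivial

theorem notMem_compl_left (i j : ℕ) : i ∉ ({i, j} : Set ℕ)ᶜ := fun h => h (Or.inl rfl)

theorem notMem_compl_right (i j : ℕ) : j ∉ ({i, j} : Set ℕ)ᶜ := fun h => h (Or.inr rfl)

theorem inv_mul_commute {G : Type*} [Group G] {p q l : G} (h : p * l * p⁻¹ = q * l * q⁻¹) :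
    p⁻¹ * q * l = l * (p⁻¹ * q) := by
  rw [eq_mul_inv_iff_mul_eq] at h
  rw [mul_assoc, ← h]
  group

namespace Normalized

variable {n₀ x : ℕ} {lam : MulAut (FreeGroup ℕ) → MulAut (FreeGroup ℕ)}

theorem map_one (H : Normalized n₀ lam x) : lam 1 = 1 := by
  have h := H.map_mul 1 (one_mem _) 1 (one_mem _)
  rw [one_mul] at h
  exact left_eq_mul.1 h

theorem map_inv (H : Normalized n₀ lam x) {g : MulAut (FreeGroup ℕ)} (hg : g ∈ PS (Fn n₀)) :
    lam g⁻¹ = (lam g)⁻¹ := by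
  rw [eq_inv_iff_mul_eq_one, ← H.map_mul _ (inv_mem hg) _ hg, inv_mul_cancel, H.map_one]

theorem map_conj (H : Normalized n₀ lam x) {g h : MulAut (FreeGroup ℕ)} (hg : g ∈ PS (Fn n₀))
    (hh : h ∈ PS (Fn n₀)) : lam (g * h * g⁻¹) = lam g * lam h * (lam g)⁻¹ := by
  rw [H.map_mul _ (mul_mem hg hh) _ (inv_mem hg), H.map_mul _ hg _ hh, H.map_inv hg]

theorem apply_of_smul_eq (H : Normalized n₀ lam x) {g : MulAut (FreeGroup ℕ)}
    (hg : g ∈ PS (Fn (x + 1))) (e : g • FC {x}ᶜ = FC {x}ᶜ) : lam g = g := by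
  have hg0 : g ∈ PS (Fn n₀) := PS_anti (Fn_mono (H.le.trans (Nat.le_succ x))) hg
  have hx : of x ∈ Fn (x + 1) := of_mem_Fn (Nat.lt_succ_self x)
  have h1 := H.right x le_rfl g hg
  refine aut_ext fun i => ?_
  by_cases hi : i = x
  · rw [hi, h1 _ hx, hg _ hx]
  · have hi : of i ∈ FC {x}ᶜ := of_mem_FC hi
    have hgi : g (of i) ∈ FC {x}ᶜ := apply_mem_of_smul_eq e hi
    have h2 := H.map_conj hg0 (PS_compl_le H.le (lmul_mem_PS x (of i)))
    rw [conj_lmul (hg _ hx) e hi, H.lmul _ hi, H.lmul _ hgi] at h2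
    have h3 := DFunLike.congr_fun h2 (of x)
    rw [MulAut.mul_apply, MulAut.mul_apply, inv_mem h1 _ hx, lmul_self hi, lmul_self hgi,
      _root_.map_mul, h1 _ hx] at h3
    exact (mul_right_cancel h3).symm

theorem lmul_of_lt (H : Normalized n₀ lam x) {c : ℕ} (hc : x < c) {d : FreeGroup ℕ}
    (hd : d ∈ FC {x, c}ᶜ) : lam (OutFree.lmul c d) = OutFree.lmul c d := by
  refine H.apply_of_smul_eq (PS_compl_le hc (lmul_mem_PS c d)) ?_
  rw [← insert_compl_pair hc.ne]
  exact lmul_smul_FC (notMem_compl_right x c) hd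

theorem eps_of_lt (H : Normalized n₀ lam x) {c : ℕ} (hc : x < c) :
    lam (OutFree.eps c) = OutFree.eps c :=
  H.apply_of_smul_eq (PS_compl_le hc (eps_mem_PS c)) (eps_smul_FC hc.ne')

theorem apply_swap_mem (H : Normalized n₀ lam x) {c : ℕ} (hc : x < c) :
    lam (permAut (Equiv.swap x c)) ∈ PS (FC {x, c}ᶜ) := by
  refine mem_PS_FC.2 fun i hi => ?_
  have hix : i ≠ x := fun h => hi (Or.inl h)
  have hic : i ≠ c := fun h => hi (Or.inr h)
  obtain ⟨m, hm, him⟩ : ∃ m, c ≤ m ∧ i ≤ m := ⟨max c i, by omega, by omega⟩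
  have hρ : lam (permAut (Equiv.swap c (m + 1))) = permAut (Equiv.swap c (m + 1)) :=
    H.apply_of_smul_eq (swap_mem_PS_Fn hc (by omega))
      (swap_smul_FC (by simp only [Set.mem_compl_iff, Set.mem_singleton_iff]; omega))
  have hx := H.le
  have h1 : permAut (Equiv.swap c (m + 1)) * permAut (Equiv.swap x c) *
      (permAut (Equiv.swap c (m + 1)))⁻¹ = permAut (Equiv.swap x (m + 1)) := by
    rw [mul_inv_eq_iff_eq_mul]
    refine aut_ext fun j => ?_
    simp only [MulAut.mul_apply, permAut_of, Equiv.swap_apply_def]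
    congr 1
    split_ifs <;> omega
  have h2 := H.left m (by omega) _ (permAut_mem_PS (e := Equiv.swap x (m + 1)) fun j hj =>
    Equiv.swap_apply_of_ne_of_ne hj.2 (Set.mem_Iio.1 hj.1).ne) (of i)
    (of_mem_FC ⟨Set.mem_Iio.2 (by omega), hix⟩)
  rw [← h1, H.map_conj (swap_mem_PS_Fn (by omega) (by omega)) (swap_mem_PS_Fn hx (by omega)), hρ]
    at h2
  have h3 : permAut (Equiv.swap c (m + 1)) (of i) = of i := by
    rw [permAut_of, Equiv.swap_apply_of_ne_of_ne hic (by omega)]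
  have h4 : (permAut (Equiv.swap c (m + 1)))⁻¹ (of i) = of i := by
    nth_rw 1 [← h3]
    rw [MulAut.inv_apply_self]
  rw [MulAut.mul_apply, MulAut.mul_apply, h4] at h2
  exact (permAut (Equiv.swap c (m + 1))).injective (h2.trans h3.symm)

theorem apply_swap (H : Normalized n₀ lam x) {c : ℕ} (hc : x < c) :
    lam (permAut (Equiv.swap x c)) = permAut (Equiv.swap x c) := by
  have hx := H.le
  have hfix := H.apply_swap_mem hc
  have hfix' := swap_mem_PS x c
  have hπ : permAut (Equiv.swap x c) ∈ PS (Fn n₀) := swap_mem_PS_Fn hx (by omega)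
  have key : ∀ a b, n₀ ≤ a → Equiv.swap x c a = b →
      permAut (Equiv.swap x c) • FC {a}ᶜ = FC {b}ᶜ → a ∉ ({x, c} : Set ℕ)ᶜ →
      (∀ d ∈ FC {x, c}ᶜ, lam (OutFree.lmul a d) = OutFree.lmul a d) →
      (∀ d ∈ FC {x, c}ᶜ, lam (OutFree.lmul b d) = OutFree.lmul b d) →
      lam (OutFree.eps a) = OutFree.eps a → lam (OutFree.eps b) = OutFree.eps b →
      lam (permAut (Equiv.swap x c)) (of a) = of b := by
    intro a b ha hab hsm haS la lb ea eb
    have hof : permAut (Equiv.swap x c) (of a) = of b := by rw [permAut_of, hab]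
    have hle := FC_le_compl haS
    obtain ⟨u, -, e1, e2⟩ := exists_conj_of_commute
      (k := (permAut (Equiv.swap x c))⁻¹ * lam (permAut (Equiv.swap x c))) haS
      (nontrivial_compl_pair x c) (fun d hd => by
        rw [mul_mem (inv_mem hfix') hfix d hd]
        exact hle hd) (fun d hd => by
        have h1 := H.map_conj hπ (PS_compl_le ha (lmul_mem_PS a d))
        have h2 := conj_lmul hof hsm (hle hd)
        rw [hfix' d hd] at h2
        rw [h2, la d hd, lb d hd, ← h2] at h1
        exact inv_mul_commute h1) (by
        have h1 := H.map_conj hπ (PS_compl_le ha (eps_mem_PS a))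
        have h2 := conj_eps hof hsm
        rw [h2, ea, eb, ← h2] at h1
        exact inv_mul_commute h1)
    have hu : u = 1 := (nc_FC (nontrivial_compl_pair x c)).eq_one fun d hd => by
      rw [← e2 d hd, mul_mem (inv_mem hfix') hfix d hd]
    rw [hu, one_mul, inv_one, mul_one, MulAut.mul_apply] at e1
    rw [← hof, ← e1, MulAut.apply_inv_self, e1]
  refine aut_ext fun i => ?_
  rw [permAut_of]
  by_cases hi : i = x
  · rw [hi, Equiv.swap_apply_left]
    exact key x c hx (Equiv.swap_apply_left _ _) (swap_smul_compl x c) (notMem_compl_left x c)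
      (fun d hd => H.lmul d (FC_le_compl (notMem_compl_left x c) hd))
      (fun d hd => H.lmul_of_lt hc hd) H.eps (H.eps_of_lt hc)
  by_cases hi' : i = c
  · rw [hi', Equiv.swap_apply_right]
    exact key c x (by omega) (Equiv.swap_apply_right _ _)
      (by rw [Equiv.swap_comm]; exact swap_smul_compl c x) (notMem_compl_right x c)
      (fun d hd => H.lmul_of_lt hc hd)
      (fun d hd => H.lmul d (FC_le_compl (notMem_compl_left x c) hd)) (H.eps_of_lt hc) H.eps
  · have : i ∈ ({x, c} : Set ℕ)ᶜ := by
      rintro (h | h)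
      exacts [hi h, hi' h]
    rw [hfix _ (of_mem_FC this), Equiv.swap_apply_of_ne_of_ne hi hi']

theorem smul_compl_le {q : MulAut (FreeGroup ℕ)} {M : ℕ} (h : q • Fn M = Fn M)
    (hq : ∀ i, M ≤ i → q (of i) = of i) : q • FC {M}ᶜ ≤ FC {M}ᶜ :=
  smul_FC_le.2 fun i hi => by
    rcases lt_or_ge i M with h1 | h1
    · exact IsPair.Fn_le_compl M (apply_mem_of_smul_eq h (of_mem_Fn h1))
    · rw [hq i h1]
      exact of_mem_FC hi

theorem apply_eq (H : Normalized n₀ lam x) {f : MulAut (FreeGroup ℕ)}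
    (hf : f ∈ PS (Fn (x + 1))) : lam f = f := by
  have hx := H.le
  have hn₀ : PS (Fn (x + 1)) ≤ PS (Fn n₀) := PS_anti (Fn_mono (hx.trans (Nat.le_succ x)))
  refine aut_ext fun i => ?_
  obtain ⟨m, hm, him⟩ : ∃ m, x ≤ m ∧ i < m + 1 := ⟨max x i, by omega, by omega⟩
  obtain ⟨M, q, hM, hq, hqM, hqi⟩ := exists_finitary f (m + 1)
  have hxM : x < M := by omega
  have hqx : q ∈ PS (Fn (x + 1)) := fun w hw => by
    rw [hq w (Fn_mono (Nat.succ_le_succ hm) hw), hf w hw]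
  have hlamq : lam q = q := by
    have hπ : permAut (Equiv.swap x M) ∈ PS (Fn n₀) := swap_mem_PS_Fn hx (by omega)
    have hs := swap_smul_compl M x
    rw [Equiv.swap_comm] at hs
    have hqc : q • FC {M}ᶜ = FC {M}ᶜ := by
      refine le_antisymm (smul_compl_le hqM hqi) ?_
      rw [Subgroup.subset_pointwise_smul_iff]
      refine smul_compl_le (by rw [inv_smul_eq_iff, hqM]) fun i hi => ?_
      rw [← hqi i hi, MulAut.inv_apply_self, hqi i hi]
    have hπi : ∀ j, (permAut (Equiv.swap x M))⁻¹ (of j) = of (Equiv.swap x M j) := fun j => by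
      apply (permAut (Equiv.swap x M)).injective
      rw [MulAut.apply_inv_self, permAut_of, Equiv.swap_apply_self]
    have h1 := H.apply_of_smul_eq
      (g := permAut (Equiv.swap x M) * q * (permAut (Equiv.swap x M))⁻¹)
      (mem_PS_FC.2 fun j hj => by
        have hj := Set.mem_Iio.1 hj
        have : q (of (Equiv.swap x M j)) = of (Equiv.swap x M j) := by
          rcases Nat.lt_succ_iff_lt_or_eq.1 hj with h | rfl
          · rw [Equiv.swap_apply_of_ne_of_ne (by omega) (by omega)]
            exact hqx _ (of_mem_Fn hj)
          · rw [Equiv.swap_apply_left, hqi M le_rfl]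
        rw [MulAut.mul_apply, MulAut.mul_apply, hπi, this, permAut_of, Equiv.swap_apply_self])
      (by rw [mul_smul, mul_smul, inv_smul_eq_iff.2 hs.symm, hqc, hs])
    rw [H.map_conj hπ (hn₀ hqx), H.apply_swap hxM] at h1
    exact mul_left_cancel (mul_right_cancel h1)
  have h2 := H.right m hm (q⁻¹ * f) (inv_mul_mem_PS_iff.2 fun w hw => (hq w hw).symm)
  rw [H.map_mul _ (inv_mem (hn₀ hqx)) _ (hn₀ hf), H.map_inv (hn₀ hqx), hlamq] at h2
  rw [inv_mul_mem_PS_iff.1 h2 _ (of_mem_Fn him), hq _ (of_mem_Fn him)]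

end Normalized

theorem eq_one_of_apply_toOut {Φ : MulAut (OutAut (FreeGroup ℕ))} {n : ℕ}
    (h : ∀ p ∈ PS (Fn n), Φ (toOut p) = toOut p) : Φ = 1 := by
  refine MulEquiv.ext fun g => ?_
  obtain ⟨γ, rfl⟩ := toOut_surjective g
  obtain ⟨m, hm, hγ⟩ := exists_smul_Fn_le [γ] n n
  have hγ := hγ γ (by simp)
  refine mul_inv_eq_one.1 (eq_one_of_commute_toOut (n := m) fun p hp => ?_)
  have h1 := h _ (inv_conj_mem_PS.2 (PS_anti hγ hp))
  rw [map_mul, map_mul, map_mul, map_mul, map_inv, map_inv, h p (PS_anti (Fn_mono hm) hp)] at h1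
  have h2 := congrArg (fun t => Φ (toOut γ) * t * (toOut γ)⁻¹) h1
  simpa [mul_assoc] using h2.symm

theorem exists_normalized (Δ : MulAut (OutAut (FreeGroup ℕ))) :
    ∃ (c : MulAut (FreeGroup ℕ)) (n₀ x : ℕ) (lam : MulAut (FreeGroup ℕ) → MulAut (FreeGroup ℕ)),
      Normalized n₀ lam x ∧
      ∀ g ∈ PS (Fn n₀), toOut (lam g) = (toOut c)⁻¹ * Δ (toOut g) * toOut c := by
  obtain ⟨n₀, lam, L, hlam⟩ := exists_lift Δ
  obtain ⟨x, K, K', y, hx, T⟩ := L.exists_tower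
  obtain ⟨c, rfl, hl, hK, hK'⟩ := T.exists_aut
  have hfix : ∀ g ∈ PS (FC {x}ᶜ), ∀ i, i ≠ x → (c⁻¹ * lam g * c) (of i) = of i := by
    intro g hg i hi
    obtain ⟨m, hm, h⟩ := exists_mem_FC_diff (of_mem_FC (C := {x}ᶜ) hi)
    refine inv_conj_mem_PS.2 ?_ _ h
    rw [hK m hm]
    exact (T.level m hm).matches_left.mem g (PS_anti (FC_le_compl fun h => h.2 rfl) hg)
  refine ⟨c, n₀, x, fun g => c⁻¹ * lam g * c, ⟨hx, ?_, ?_, ?_, ?_, ?_⟩, fun g hg => ?_⟩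
  · intro g hg h hh
    rw [L.map_mul g hg h hh]
    group
  · intro d hd
    refine aut_ext fun i => ?_
    by_cases hi : i = x
    · rw [hi, MulAut.mul_apply, MulAut.mul_apply, hl d hd, ← map_mul, MulAut.inv_apply_self,
        lmul_self hd]
    · rw [hfix _ (lmul_mem_PS x d) i hi, lmul_of_ne d hi]
  · refine aut_ext fun i => ?_
    by_cases hi : i = x
    · rw [hi, MulAut.mul_apply, MulAut.mul_apply, (T.good x le_rfl).eps, ← map_inv,
        MulAut.inv_apply_self, eps_self]
    · rw [hfix _ (eps_mem_PS x) i hi, eps_of_ne hi]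
  · intro m hm g hg
    refine inv_conj_mem_PS.2 ?_
    rw [hK m hm]
    exact (T.level m hm).matches_left.mem g hg
  · intro m hm g hg
    refine inv_conj_mem_PS.2 ?_
    rw [hK' m hm]
    exact (T.level m hm).matches_right.mem g (by rwa [insert_Iio_diff hm])
  · rw [map_mul, map_mul, map_inv, hlam g hg]

end OutFree

/-- The outer automorphism group of a free group of countably infinite rank is
complete: it has trivial center and all of its automorphisms are inner. -/
theorem outAut_freeGroup_complete :
    Subgroup.center (OutAut (FreeGroup ℕ)) = ⊥ ∧
    ∀ Δ : MulAut (OutAut (FreeGroup ℕ)), ∃ g : OutAut (FreeGroup ℕ), Δ = MulAut.conj g := by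
  refine ⟨eq_bot_iff.2 fun κ hκ => ?_, fun Δ => ?_⟩
  · exact OutFree.eq_one_of_commute_toOut (n := 0) fun p _ => (Subgroup.mem_center_iff.1 hκ _).symm
  · obtain ⟨c, n₀, x, lam, H, h⟩ := OutFree.exists_normalized Δ
    refine ⟨toOut c, (inv_mul_eq_one.1 (OutFree.eq_one_of_apply_toOut (n := x + 1) fun p hp => ?_)).symm⟩
    have h1 := h p (OutFree.PS_anti (OutFree.Fn_mono (H.le.trans (Nat.le_succ x))) hp)
    rw [H.apply_eq hp] at h1
    rw [MulAut.mul_apply, ← map_inv, MulAut.conj_apply, inv_inv, ← h1]
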